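/- arXiv:2205.15352 — 6 statements merged into one kernel-verified Lean document; each statement's English description precedes it below -/
import Mathlib

section
/- Let g, r ≥ 0 be integers and let N = 2g or N = 2g+1. Let F_N be the free group on N generators and let ρ : F_N → GL_r(ℂ) be a representation which has finite orbit under Aut(F_N) (equivalently, the conjugacy class of ρ has finite orbit under Out(F_N)). If r² ≤ g (equivalently r < √(g+1)), then ρ has finite image. -/
/-- Two representations are conjugate if they differ by a global conjugation. -/
def RepConj {G : Type*} [Group G] {r : ℕ}
    (ρ ρ' : G →* GL (Fin r) ℂ) : Prop :=
  ∃ M : GL (Fin r) ℂ, ∀ x, ρ' x = M * ρ x * M⁻¹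

/-- `ρ` has finite orbit under `Aut G`: the representations `ρ ∘ φ`, for `φ ∈ Aut G`,
fall into finitely many conjugacy classes. -/
def FiniteAutOrbit {G : Type*} [Group G] {r : ℕ}
    (ρ : G →* GL (Fin r) ℂ) : Prop :=
  ∃ s : Set (G →* GL (Fin r) ℂ), s.Finite ∧
    ∀ φ : MulAut G, ∃ ρ' ∈ s, RepConj (ρ.comp φ.toMonoidHom) ρ'

lemma exists_small_gen {k B ι : Type*} [Field k] [Ring B] [Algebra k B] [FiniteDimensional k B]
    [Nontrivial B] [DecidableEq ι] (a : ι → B) (U : Finset ι) :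
    ∃ S ⊆ U, Algebra.adjoin k (a '' (S : Set ι)) = Algebra.adjoin k (a '' (U : Set ι)) ∧
      S.card + 1 ≤ Module.finrank k (Algebra.adjoin k (a '' (S : Set ι))) := by
  induction U using Finset.induction_on with
  | empty => exact ⟨∅, subset_rfl, rfl, by
      rw [Finset.coe_empty, Set.image_empty, Algebra.adjoin_empty, Subalgebra.finrank_bot]; simp⟩
  | insert x U hx ih =>
    obtain ⟨S, hS, h1, h2⟩ := ih
    have h3 : Algebra.adjoin k (a '' ((insert x U : Finset ι) : Set ι)) =
        Algebra.adjoin k (a '' (U : Set ι)) ⊔ Algebra.adjoin k {a x} := by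
      rw [← Algebra.adjoin_union]; congr 1
      rw [Finset.coe_insert, Set.image_insert_eq, Set.insert_eq, Set.union_comm]
    by_cases hm : a x ∈ Algebra.adjoin k (a '' (S : Set ι))
    · refine ⟨S, hS.trans (Finset.subset_insert _ _), ?_, h2⟩
      rw [h3, h1, eq_comm, sup_eq_left, ← h1]
      exact Algebra.adjoin_le (by simpa using hm)
    · have hxS : x ∉ S := fun h => hx (hS h)
      have h4 : Algebra.adjoin k (a '' ((insert x S : Finset ι) : Set ι)) =
        Algebra.adjoin k (a '' (S : Set ι)) ⊔ Algebra.adjoin k {a x} := by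
        rw [← Algebra.adjoin_union]; congr 1
        rw [Finset.coe_insert, Set.image_insert_eq, Set.insert_eq, Set.union_comm]
      refine ⟨insert x S, Finset.insert_subset_insert _ hS, by rw [h3, h4, h1], ?_⟩
      rw [Finset.card_insert_of_notMem hxS]
      have : Algebra.adjoin k (a '' (S : Set ι)) <
          Algebra.adjoin k (a '' ((insert x S : Finset ι) : Set ι)) := by
        rw [h4]
        refine lt_of_le_of_ne le_sup_left fun h => hm ?_
        rw [h]
        exact (le_sup_right : Algebra.adjoin k {a x} ≤ _) (Algebra.self_mem_adjoin_singleton k _)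
      have := Submodule.finrank_lt_finrank_of_lt
        (show Subalgebra.toSubmodule (Algebra.adjoin k (a '' (S : Set ι))) <
          Subalgebra.toSubmodule (Algebra.adjoin k (a '' ((insert x S : Finset ι) : Set ι))) from this)
      change Module.finrank k (Algebra.adjoin k (a '' (S : Set ι))) <
        Module.finrank k (Algebra.adjoin k (a '' ((insert x S : Finset ι) : Set ι))) at this
      omega

noncomputable def transvHom {ι : Type*} [DecidableEq ι] (j : ι) (w : FreeGroup ι) :
    FreeGroup ι →* FreeGroup ι :=
  FreeGroup.lift fun i => if i = j then FreeGroup.of j * w else FreeGroup.of i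

lemma transvHom_fix {ι : Type*} [DecidableEq ι] (j : ι) (w u : FreeGroup ι)
    (hu : u ∈ Subgroup.closure (FreeGroup.of '' {i | i ≠ j})) : transvHom j w u = u := by
  have : Subgroup.closure (FreeGroup.of '' {i | i ≠ j}) ≤
      (transvHom j w).eqLocus (MonoidHom.id _) := by
    rw [Subgroup.closure_le]
    rintro _ ⟨i, hi, rfl⟩
    change transvHom j w _ = _
    simp only [Set.mem_ofPred_eq] at hi
    simp [transvHom, hi]
  exact this hu

noncomputable def transv {ι : Type*} [DecidableEq ι] (j : ι) (w : FreeGroup ι)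
    (hw : w ∈ Subgroup.closure (FreeGroup.of '' {i | i ≠ j})) : MulAut (FreeGroup ι) :=
  MonoidHom.toMulEquiv (transvHom j w) (transvHom j w⁻¹)
    (by
      ext i
      by_cases h : i = j
      · subst h
        have := transvHom_fix i w⁻¹ w hw
        simp only [MonoidHom.comp_apply]
        have e : transvHom i w (FreeGroup.of i) = FreeGroup.of i * w := by simp [transvHom]
        rw [e, map_mul, this]; simp [transvHom]
      · simp [transvHom, h])
    (by
      ext i
      by_cases h : i = j
      · subst h
        have := transvHom_fix i w w⁻¹ (inv_mem hw)
        simp only [MonoidHom.comp_apply]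
        have e : transvHom i w⁻¹ (FreeGroup.of i) = FreeGroup.of i * w⁻¹ := by simp [transvHom]
        rw [e, map_mul, this]; simp [transvHom]
      · simp [transvHom, h])

lemma finite_Gj {N r : ℕ} (ρ : FreeGroup (Fin N) →* GL (Fin r) ℂ) (hfin : FiniteAutOrbit ρ)
    (j : Fin N)
    (h : (ρ (FreeGroup.of j) : Matrix (Fin r) (Fin r) ℂ) ∈
      Algebra.adjoin ℂ ((fun i => (ρ (FreeGroup.of i) : Matrix (Fin r) (Fin r) ℂ)) '' {i | i ≠ j})) :
    (Subgroup.closure ((fun i => ρ (FreeGroup.of i)) '' {i | i ≠ j}) : Set (GL (Fin r) ℂ)).Finite := by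
  obtain ⟨s, hs, hφ⟩ := hfin
  have hcl : (Subgroup.closure ((fun i => ρ (FreeGroup.of i)) '' {i | i ≠ j}) : Set (GL (Fin r) ℂ))
      = ρ '' (Subgroup.closure (FreeGroup.of '' {i | i ≠ j}) : Set (FreeGroup (Fin N))) := by
    rw [← Subgroup.coe_map, MonoidHom.map_closure, Set.image_image]
  rw [hcl]
  have hex : ∀ w : Subgroup.closure (FreeGroup.of '' {i | i ≠ j}), ∃ ρ' : s,
      RepConj (ρ.comp (transv j w.1 w.2).toMonoidHom) ρ'.1 := fun w => by
    obtain ⟨ρ', h1, h2⟩ := hφ (transv j w.1 w.2)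
    exact ⟨⟨ρ', h1⟩, h2⟩
  choose f hf using hex
  have key : ∀ w w', f w = f w' → ρ w.1 = ρ w'.1 := by
    intro w w' hww
    obtain ⟨M, hM⟩ := hf w
    obtain ⟨M', hM'⟩ := hf w'
    rw [hww] at hM
    have e1 : ∀ x, ρ (transvHom j w'.1 x) = (M'⁻¹ * M) * ρ (transvHom j w.1 x) * (M'⁻¹ * M)⁻¹ := by
      intro x
      have a1 := hM x
      have a2 := hM' x
      rw [a1] at a2
      change M * ρ (transvHom j w.1 x) * M⁻¹ = M' * ρ (transvHom j w'.1 x) * M'⁻¹ at a2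
      have : ρ (transvHom j w'.1 x) = M'⁻¹ * (M' * ρ (transvHom j w'.1 x) * M'⁻¹) * M' := by group
      rw [this, ← a2]; group
    set P := M'⁻¹ * M with hP
    have e2 : ∀ i, i ≠ j → ρ (FreeGroup.of i) * P = P * ρ (FreeGroup.of i) := by
      intro i hi
      have := e1 (FreeGroup.of i)
      have q : ∀ v, transvHom j v (FreeGroup.of i) = FreeGroup.of i := fun v => by
        simp [transvHom, hi]
      rw [q, q] at this
      nth_rewrite 1 [this]; group
    have e3 : ρ (FreeGroup.of j) * P = P * ρ (FreeGroup.of j) := by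
      have : Algebra.adjoin ℂ ((fun i => (ρ (FreeGroup.of i) : Matrix (Fin r) (Fin r) ℂ)) '' {i | i ≠ j})
          ≤ Subalgebra.centralizer ℂ {(P : Matrix (Fin r) (Fin r) ℂ)} := by
        apply Algebra.adjoin_le
        rintro _ ⟨i, hi, rfl⟩
        simp only [SetLike.mem_coe, Subalgebra.mem_centralizer_iff, Set.mem_singleton_iff,
          forall_eq]
        exact (congrArg Units.val (e2 i hi)).symm
      have := this h
      simp only [Subalgebra.mem_centralizer_iff, Set.mem_singleton_iff,
          forall_eq] at this
      exact Units.ext this.symm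
    have e4 : ∀ x, ρ x * P = P * ρ x := by
      intro x
      have : (⊤ : Subgroup (FreeGroup (Fin N))) ≤ (Subgroup.centralizer {P}).comap ρ := by
        rw [← FreeGroup.closure_range_of, Subgroup.closure_le]
        rintro _ ⟨i, rfl⟩
        simp only [SetLike.mem_coe, Subgroup.mem_comap, Subgroup.mem_centralizer_singleton_iff]
        by_cases hi : i = j
        · subst hi; exact e3
        · exact e2 i hi
      have := this (Subgroup.mem_top x)
      simpa only [Subgroup.mem_comap, Subgroup.mem_centralizer_singleton_iff] using this
    have e5 := e1 (FreeGroup.of j)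
    rw [← e4, mul_inv_cancel_right] at e5
    simp only [transvHom, FreeGroup.lift_apply_of, if_true, map_mul] at e5
    exact (mul_left_cancel e5).symm
  have : Finite s := hs
  have : Finite (ρ '' (Subgroup.closure (FreeGroup.of '' {i | i ≠ j}) : Set (FreeGroup (Fin N)))) := by
    have hg : ∀ y : (ρ '' (Subgroup.closure (FreeGroup.of '' {i | i ≠ j}) : Set (FreeGroup (Fin N)))),
        ∃ w : Subgroup.closure (FreeGroup.of '' {i | i ≠ j}), ρ w.1 = y.1 := by
      rintro ⟨_, w, hw, rfl⟩
      exact ⟨⟨w, hw⟩, rfl⟩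
    choose g hg using hg
    refine Finite.of_injective (fun y => f (g y)) fun y y' hy => ?_
    apply Subtype.ext
    rw [← hg, ← hg]
    exact key _ _ hy
  exact this


lemma adjoin_of_surj {O k C : Type*} [CommRing O] [CommRing k] [Ring C] [Algebra O k] [Algebra k C]
    [Algebra O C] [IsScalarTower O k C] (h : Function.Surjective (algebraMap O k)) (s : Set C)
    (x : C) (hx : x ∈ Algebra.adjoin k s) : x ∈ Algebra.adjoin O s := by
  induction hx using Algebra.adjoin_induction with
  | mem x hx => exact Algebra.subset_adjoin hx
  | algebraMap c =>
    obtain ⟨c, rfl⟩ := h c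
    rw [← IsScalarTower.algebraMap_apply]
    exact Subalgebra.algebraMap_mem _ _
  | add _ _ _ _ h1 h2 => exact add_mem h1 h2
  | mul _ _ _ _ h1 h2 => exact mul_mem h1 h2

open TensorProduct in
lemma exists_small_gen_val {r : ℕ} (hr : 0 < r) {ι : Type*} [DecidableEq ι] (O : ValuationSubring ℂ)
    (a : ι → Matrix (Fin r) (Fin r) ℂ) (U : Finset ι)
    (hfg : (Subalgebra.toSubmodule (Algebra.adjoin O (a '' (U : Set ι)))).FG) :
    ∃ S ⊆ U, Algebra.adjoin O (a '' (S : Set ι)) = Algebra.adjoin O (a '' (U : Set ι)) ∧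
      S.card + 1 ≤ r ^ 2 := by
  classical
  have : Nonempty (Fin r) := ⟨⟨0, hr⟩⟩
  set L := Algebra.adjoin O (a '' (U : Set ι)) with hL
  have hfin : Module.Finite O L := Module.Finite.iff_fg.mpr hfg
  have htf : Module.IsTorsionFree O L := by
    apply Module.IsTorsionFree.of_smul_eq_zero
    intro c m hcm
    by_contra! hne
    have h1 : (c : ℂ) • (m : Matrix (Fin r) (Fin r) ℂ) = 0 := congrArg Subtype.val hcm
    rcases smul_eq_zero.mp h1 with h | h
    · exact hne.1 (Subtype.ext h)
    · exact hne.2 (Subtype.ext h)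
  have hflat : Module.Flat O L := by
    rw [Module.Flat.flat_iff_torsion_eq_bot_of_isBezout]
    exact (Submodule.isTorsionFree_iff_torsion_eq_bot).mp htf
  have hfree : Module.Free O L := Module.free_of_flat_of_isLocalRing
  have hrank : Module.finrank O L ≤ r ^ 2 := by
    let b := Module.finBasis O L
    have h1 : LinearIndependent O (fun i => (b i : Matrix (Fin r) (Fin r) ℂ)) :=
      b.linearIndependent.map' L.val.toLinearMap
        (LinearMap.ker_eq_bot.mpr Subtype.val_injective)
    have h2 : LinearIndependent ℂ (fun i => (b i : Matrix (Fin r) (Fin r) ℂ)) :=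
      (LinearIndependent.iff_fractionRing O ℂ).mp h1
    have := h2.fintype_card_le_finrank
    simpa [Module.finrank_matrix, pow_two] using this
  let k := IsLocalRing.ResidueField O
  let a' : U → k ⊗[O] L := fun i => 1 ⊗ₜ ⟨a i, Algebra.subset_adjoin ⟨i, i.2, rfl⟩⟩
  have hfr : Module.finrank k (k ⊗[O] L) ≤ r ^ 2 := by
    rw [Module.finrank_baseChange]; exact hrank
  have hL1 : Nontrivial L := inferInstance
  have : Nontrivial (k ⊗[O] L) := by
    apply Module.nontrivial_of_finrank_pos (R := k)
    rw [Module.finrank_baseChange]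
    exact Module.finrank_pos
  obtain ⟨S, -, hS, hcard⟩ := exists_small_gen (k := k) a' Finset.univ
  have hsurj : Function.Surjective (algebraMap O k) := Ideal.Quotient.mk_surjective
  let inc : L →ₐ[O] k ⊗[O] L := Algebra.TensorProduct.includeRight
  -- sub generators in L
  let aL : U → L := fun i => ⟨a i, Algebra.subset_adjoin ⟨i, i.2, rfl⟩⟩
  have hmapgen : ∀ T : Set U, (Algebra.adjoin O (aL '' T)).map inc = Algebra.adjoin O (a' '' T) := by
    intro T
    rw [AlgHom.map_adjoin, Set.image_image]; rfl
  have htopL : Algebra.adjoin O (aL '' Set.univ) = ⊤ := by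
    apply Subalgebra.map_injective (f := L.val) Subtype.val_injective
    rw [AlgHom.map_adjoin, Algebra.map_top, Subalgebra.range_val, Set.image_image]
    refine Eq.trans ?_ hL.symm
    congr 1
    ext y; simp [aL]
  refine ⟨S.map (Function.Embedding.subtype _), ?_, ?_, ?_⟩
  · intro x hx
    simp only [Finset.mem_map] at hx
    obtain ⟨y, _, rfl⟩ := hx
    exact y.2
  · have hTop : Algebra.adjoin O (aL '' (S : Set U)) = ⊤ := by
      rw [← Algebra.toSubmodule_eq_top, ← IsLocalRing.map_tensorProduct_mk_eq_top]
      rw [eq_top_iff]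
      have h1 : (Subalgebra.toSubmodule (⊤ : Subalgebra O L)).map (TensorProduct.mk O k L 1) = ⊤ := by
        rw [IsLocalRing.map_tensorProduct_mk_eq_top]; rfl
      rintro x -
      have hx : x ∈ (Subalgebra.toSubmodule (⊤ : Subalgebra O L)).map (TensorProduct.mk O k L 1) := by
        rw [h1]; trivial
      rw [← htopL] at hx
      have hx2 : x ∈ (Algebra.adjoin O (aL '' Set.univ)).map inc := hx
      rw [hmapgen] at hx2
      have hx3 : x ∈ Algebra.adjoin k (a' '' Set.univ) := by
        have : Algebra.adjoin O (a' '' Set.univ) ≤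
          (Algebra.adjoin k (a' '' Set.univ)).restrictScalars O :=
          Algebra.adjoin_le Algebra.subset_adjoin
        exact this hx2
      rw [Finset.coe_univ] at hS
      rw [← hS] at hx3
      have hx4 := adjoin_of_surj hsurj _ _ hx3
      rw [← hmapgen] at hx4
      exact hx4
    have := congrArg (Subalgebra.map L.val) hTop
    rw [AlgHom.map_adjoin, Algebra.map_top, Subalgebra.range_val, Set.image_image] at this
    rw [← this]
    congr 1
    ext y; simp [aL]
  · rw [Finset.card_map]
    have h5 := Submodule.finrank_le (Subalgebra.toSubmodule (Algebra.adjoin k (a' '' (S : Set U))))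
    exact hcard.trans (le_trans h5 hfr)


lemma exists_extend_embedding (K : IntermediateField ℚ ℂ) [FiniteDimensional ℚ K] (φ : K →+* ℂ) :
    ∃ σ : ℂ →+* ℂ, ∀ x : K, σ x = φ x := by
  let Q := algebraicClosure ℚ ℂ
  have hQc : IsAlgClosure ℚ Q := algebraicClosure.isAlgClosure ℚ ℂ
  have hQn : Normal ℚ Q := IsAlgClosure.normal ℚ Q
  have hKQ : ∀ x : K, (x : ℂ) ∈ Q := fun x => by
    rw [mem_algebraicClosure_iff]
    exact IsAlgebraic.algHom K.val (Algebra.IsAlgebraic.isAlgebraic (R := ℚ) x)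
  have hφQ : ∀ x : K, φ x ∈ Q := fun x => by
    rw [mem_algebraicClosure_iff]
    exact IsAlgebraic.algHom φ.toRatAlgHom (Algebra.IsAlgebraic.isAlgebraic (R := ℚ) x)
  let i : K →ₐ[ℚ] Q := K.val.codRestrict Q.toSubalgebra hKQ
  let f : K →ₐ[ℚ] Q := φ.toRatAlgHom.codRestrict Q.toSubalgebra hφQ
  let : Algebra K Q := i.toRingHom.toAlgebra
  have : IsScalarTower ℚ K Q := IsScalarTower.of_algebraMap_eq (fun x => (i.commutes x).symm)
  let τ : Q →ₐ[ℚ] Q := f.liftNormal Q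
  have hτ : ∀ x : K, τ (i x) = f x := fun x => by
    exact f.liftNormal_commutes Q x
  have hτb : Function.Bijective τ := Algebra.IsAlgebraic.algHom_bijective τ
  let τe : Q ≃+* Q := RingEquiv.ofBijective τ hτb
  obtain ⟨s, hs⟩ := exists_isTranscendenceBasis Q ℂ
  have := IsAlgClosed.isAlgClosure_of_transcendence_basis _ hs
  let e : Algebra.adjoin Q (Set.range ((↑) : s → ℂ)) ≃+* Algebra.adjoin Q (Set.range ((↑) : s → ℂ)) :=
    (hs.1.aevalEquiv.symm.toRingEquiv.trans (MvPolynomial.mapEquiv s τe)).trans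
      hs.1.aevalEquiv.toRingEquiv
  let σ := IsAlgClosure.equivOfEquiv ℂ ℂ e
  refine ⟨σ, fun x => ?_⟩
  have h1 : e (algebraMap Q _ (i x)) = algebraMap Q _ (f x) := by
    simp only [e, RingEquiv.trans_apply]
    have : hs.1.aevalEquiv.symm.toRingEquiv (algebraMap Q _ (i x)) = MvPolynomial.C (i x) :=
      hs.1.aevalEquiv.symm.commutes _
    rw [this]
    have : MvPolynomial.mapEquiv s τe (MvPolynomial.C (i x)) = MvPolynomial.C (f x) := by
      rw [MvPolynomial.mapEquiv_apply, MvPolynomial.map_C]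
      congr 1
      exact hτ x
    rw [this]
    exact hs.1.aevalEquiv.commutes _
  have h2 := IsAlgClosure.equivOfEquiv_algebraMap ℂ ℂ e (algebraMap Q _ (i x))
  rw [h1] at h2
  exact h2


/-- coercion of a set of invertible matrices to matrices -/
def mset {r : ℕ} (G : Set (GL (Fin r) ℂ)) : Set (Matrix (Fin r) (Fin r) ℂ) :=
  (fun g : GL (Fin r) ℂ => (g : Matrix (Fin r) (Fin r) ℂ)) '' G

open scoped MatrixOrder ComplexOrder Matrix in
lemma exists_inv_form {r : ℕ} (G : Subgroup (GL (Fin r) ℂ)) (hG : (G : Set (GL (Fin r) ℂ)).Finite) :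
    ∃ H : Matrix (Fin r) (Fin r) ℂ, H.PosDef ∧
      ∀ a ∈ G, (a : Matrix (Fin r) (Fin r) ℂ)ᴴ * H * (a : Matrix (Fin r) (Fin r) ℂ) = H := by
  classical
  refine ⟨∑ g ∈ hG.toFinset, (g : Matrix (Fin r) (Fin r) ℂ)ᴴ * (g : Matrix (Fin r) (Fin r) ℂ), ?_, ?_⟩
  · apply Matrix.posDef_sum
    · exact ⟨1, by simp⟩
    · intro g _
      apply Matrix.PosDef.conjTranspose_mul_self
      exact Matrix.mulVec_injective_of_isUnit g.isUnit
  · intro a ha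
    rw [Finset.mul_sum, Finset.sum_mul]
    refine Finset.sum_bij' (fun g _ => g * a) (fun g _ => g * a⁻¹) ?_ ?_ ?_ ?_ ?_
    · intro g hg; simp at hg ⊢; exact G.mul_mem hg ha
    · intro g hg; simp at hg ⊢; exact G.mul_mem hg (G.inv_mem ha)
    · intro g hg; simp
    · intro g hg; simp
    · intro g hg
      simp [Matrix.conjTranspose_mul, Matrix.mul_assoc]

open scoped ComplexOrder Matrix in
lemma form_comm {r : ℕ} {H a : Matrix (Fin r) (Fin r) ℂ} (hH : H.PosDef) {b : Matrix (Fin r) (Fin r) ℂ}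
    (hab : a * b = 1) (h : aᴴ * H * a = H) : H⁻¹ * aᴴ * H = b := by
  have hu : IsUnit H.det := (Matrix.isUnit_iff_isUnit_det H).1 hH.isUnit
  calc H⁻¹ * aᴴ * H = H⁻¹ * (aᴴ * H * a) * b := by
        simp only [Matrix.mul_assoc, hab, Matrix.mul_one]
    _ = b := by rw [h, Matrix.nonsing_inv_mul _ hu, Matrix.one_mul]

open scoped ComplexOrder Matrix in
lemma form_transfer {r : ℕ} (G0 G : Subgroup (GL (Fin r) ℂ)) (hG : (G : Set (GL (Fin r) ℂ)).Finite)
    (hle : G0 ≤ G) (hsp : ∀ a ∈ G, (a : Matrix (Fin r) (Fin r) ℂ) ∈ Submodule.span ℂ (mset (G0 : Set (GL (Fin r) ℂ))))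
    {H0 : Matrix (Fin r) (Fin r) ℂ} (hH0 : H0.PosDef)
    (hinv : ∀ a ∈ G0, (a : Matrix (Fin r) (Fin r) ℂ)ᴴ * H0 * (a : Matrix (Fin r) (Fin r) ℂ) = H0) :
    ∀ a ∈ G, (a : Matrix (Fin r) (Fin r) ℂ)ᴴ * H0 * (a : Matrix (Fin r) (Fin r) ℂ) = H0 := by
  obtain ⟨H, hH, hHinv⟩ := exists_inv_form G hG
  have hu : IsUnit H.det := (Matrix.isUnit_iff_isUnit_det H).1 hH.isUnit
  have hu0 : IsUnit H0.det := (Matrix.isUnit_iff_isUnit_det H0).1 hH0.isUnit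
  have hB : H0 * (H0⁻¹ * H) = H := by
    rw [← Matrix.mul_assoc, Matrix.mul_nonsing_inv _ hu0, Matrix.one_mul]
  have hBu : IsUnit (H0⁻¹ * H) := by
    refine IsUnit.mul ?_ hH.isUnit
    exact (Matrix.isUnit_nonsing_inv_iff).2 hH0.isUnit
  generalize H0⁻¹ * H = B at hB hBu
  have hc0 : ∀ g ∈ G0, B * (g : Matrix (Fin r) (Fin r) ℂ) = (g : Matrix (Fin r) (Fin r) ℂ) * B := by
    intro g hg
    have h1 := hHinv g (hle hg)
    have h2 := hinv g hg
    have e : (g : Matrix (Fin r) (Fin r) ℂ)ᴴ * H0 * (B * g) = (g : Matrix (Fin r) (Fin r) ℂ)ᴴ * H0 * (g * B) := by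
      calc _ = (g : Matrix (Fin r) (Fin r) ℂ)ᴴ * (H0 * B) * g := by simp only [Matrix.mul_assoc]
        _ = H0 * B := by rw [hB, h1]
        _ = (g : Matrix (Fin r) (Fin r) ℂ)ᴴ * H0 * g * B := by rw [h2]
        _ = _ := by simp only [Matrix.mul_assoc]
    have hgu : IsUnit ((g : Matrix (Fin r) (Fin r) ℂ)ᴴ * H0) := by
      refine IsUnit.mul ?_ hH0.isUnit
      exact g.isUnit.star
    exact hgu.mul_left_cancel e
  intro a ha
  have hca : B * (a : Matrix (Fin r) (Fin r) ℂ) = (a : Matrix (Fin r) (Fin r) ℂ) * B := by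
    have := hsp a ha
    generalize (a : Matrix (Fin r) (Fin r) ℂ) = x at this ⊢
    induction this using Submodule.span_induction with
    | mem x hx => obtain ⟨g, hg, rfl⟩ := hx; exact hc0 g hg
    | zero => simp
    | add x y _ _ hx hy => rw [mul_add, add_mul, hx, hy]
    | smul c x _ hx => rw [mul_smul_comm, smul_mul_assoc, hx]
  refine hBu.mul_right_cancel ?_
  calc _ = (a : Matrix (Fin r) (Fin r) ℂ)ᴴ * H0 * (a * B) := by simp only [Matrix.mul_assoc]
    _ = (a : Matrix (Fin r) (Fin r) ℂ)ᴴ * (H0 * B) * a := by rw [← hca]; simp only [Matrix.mul_assoc]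
    _ = H0 * B := by rw [hB, hHinv a ha]

open scoped ComplexOrder Matrix in
lemma norm_trace_le {r : ℕ} {H a : Matrix (Fin r) (Fin r) ℂ} (hH : H.PosDef)
    (h : aᴴ * H * a = H) : ‖a.trace‖ ≤ r := by
  have key : ∀ μ ∈ a.charpoly.roots, ‖μ‖ ≤ 1 := by
    intro μ hμ
    have hroot := (Polynomial.mem_roots (a.charpoly_monic.ne_zero)).1 hμ
    have hs := (Matrix.mem_spectrum_iff_isRoot_charpoly).2 hroot
    rw [← Matrix.spectrum_toLin', ← Module.End.hasEigenvalue_iff_mem_spectrum] at hs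
    obtain ⟨v, hv⟩ := hs.exists_hasEigenvector
    have hv1 : a.mulVec v = μ • v := by simpa using hv.apply_eq_smul
    have hpos := hH.dotProduct_mulVec_pos hv.2
    have e : star v ⬝ᵥ (H.mulVec v) = (star μ * μ) * (star v ⬝ᵥ (H.mulVec v)) := by
      conv_lhs => rw [← h]
      rw [← Matrix.mulVec_mulVec, ← Matrix.mulVec_mulVec, hv1, Matrix.dotProduct_mulVec,
        ← Matrix.star_mulVec, hv1, Matrix.mulVec_smul, dotProduct_smul, star_smul, smul_dotProduct]
      simp only [smul_eq_mul]; ring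
    have e2 : star μ * μ = 1 := by
      have : (star μ * μ - 1) * (star v ⬝ᵥ (H.mulVec v)) = 0 := by rw [sub_mul, ← e]; ring
      rcases mul_eq_zero.1 this with h | h
      · exact sub_eq_zero.1 h
      · exact absurd h hpos.ne'
    have e3 : ‖μ‖ * ‖μ‖ = 1 := by
      have := congrArg norm e2
      simpa using this
    nlinarith [norm_nonneg μ]
  rw [Matrix.trace_eq_sum_roots_charpoly]
  refine (norm_multiset_sum_le _).trans ?_
  have : (Multiset.map (fun μ : ℂ => ‖μ‖) a.charpoly.roots).sum ≤ (Multiset.card (Multiset.map (fun μ : ℂ => ‖μ‖) a.charpoly.roots)) • (1:ℝ) := by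
    apply Multiset.sum_le_card_nsmul
    intro x hx
    obtain ⟨μ, hμ, rfl⟩ := Multiset.mem_map.1 hx
    exact key μ hμ
  refine this.trans ?_
  rw [Multiset.card_map, nsmul_eq_mul, mul_one]
  have := a.charpoly.card_roots'
  rw [a.charpoly_natDegree_eq_dim, Fintype.card_fin] at this
  exact_mod_cast this

open scoped MatrixOrder ComplexOrder Matrix in
lemma trace_nondeg {r : ℕ} (G : Subgroup (GL (Fin r) ℂ)) (hG : (G : Set (GL (Fin r) ℂ)).Finite)
    {a : Matrix (Fin r) (Fin r) ℂ} (ha : a ∈ Submodule.span ℂ (mset (G : Set (GL (Fin r) ℂ))))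
    (h : ∀ g ∈ G, (a * (g : Matrix (Fin r) (Fin r) ℂ)).trace = 0) : a = 0 := by
  obtain ⟨H, hH, hinv⟩ := exists_inv_form G hG
  have h1 : ∀ x ∈ Submodule.span ℂ (mset (G : Set (GL (Fin r) ℂ))), (a * x).trace = 0 := by
    intro x hx
    induction hx using Submodule.span_induction with
    | mem x hx => obtain ⟨g, hg, rfl⟩ := hx; exact h g hg
    | zero => simp
    | add x y _ _ hx hy => rw [mul_add, Matrix.trace_add, hx, hy, add_zero]
    | smul c x _ hx => rw [mul_smul_comm, Matrix.trace_smul, hx, smul_zero]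
  have h2 : ∀ x ∈ Submodule.span ℂ (mset (G : Set (GL (Fin r) ℂ))), H⁻¹ * xᴴ * H ∈ Submodule.span ℂ (mset (G : Set (GL (Fin r) ℂ))) := by
    intro x hx
    induction hx using Submodule.span_induction with
    | mem x hx =>
      obtain ⟨g, hg, rfl⟩ := hx
      rw [form_comm hH (b := ((g⁻¹ : GL (Fin r) ℂ) : Matrix (Fin r) (Fin r) ℂ)) (by rw [← Units.val_mul]; simp) (hinv g hg)]
      exact Submodule.subset_span ⟨g⁻¹, G.inv_mem hg, rfl⟩
    | zero => simp
    | add x y _ _ hx hy =>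
      rw [Matrix.conjTranspose_add, mul_add, add_mul]; exact Submodule.add_mem _ hx hy
    | smul c x _ hx =>
      rw [Matrix.conjTranspose_smul, mul_smul_comm, smul_mul_assoc]; exact Submodule.smul_mem _ _ hx
  have h3 := h1 _ (h2 a ha)
  obtain ⟨y, hy, rfl⟩ := CStarAlgebra.isStrictlyPositive_iff_eq_star_mul_self.mp
    hH.isStrictlyPositive
  obtain ⟨u, rfl⟩ := hy
  have hud : IsUnit (u : Matrix (Fin r) (Fin r) ℂ).det := (Matrix.isUnit_iff_isUnit_det _).1 u.isUnit
  have e1 : a * ((star (u : Matrix (Fin r) (Fin r) ℂ) * u)⁻¹ * aᴴ * (star (u : Matrix (Fin r) (Fin r) ℂ) * u)) =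
      a * (u : Matrix (Fin r) (Fin r) ℂ)⁻¹ * ((u : Matrix (Fin r) (Fin r) ℂ) * a * (u : Matrix (Fin r) (Fin r) ℂ)⁻¹)ᴴ * u := by
    rw [Matrix.mul_inv_rev, Matrix.conjTranspose_mul, Matrix.conjTranspose_mul, Matrix.star_eq_conjTranspose,
      Matrix.conjTranspose_nonsing_inv]
    simp only [Matrix.mul_assoc]
  rw [e1, Matrix.trace_mul_comm, ← Matrix.mul_assoc, ← Matrix.mul_assoc,
    Matrix.trace_mul_conjTranspose_self_eq_zero_iff] at h3
  calc a = (u : Matrix (Fin r) (Fin r) ℂ)⁻¹ * ((u : Matrix (Fin r) (Fin r) ℂ) * a * (u : Matrix (Fin r) (Fin r) ℂ)⁻¹) * u := by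
        simp only [Matrix.mul_assoc, Matrix.nonsing_inv_mul _ hud, Matrix.mul_one]
        rw [← Matrix.mul_assoc, Matrix.nonsing_inv_mul _ hud, Matrix.one_mul]
    _ = 0 := by rw [h3]; simp


lemma subgroup_sup_ind {G : Type*} [Group G] (G1 G2 : Subgroup G) (P : G → Prop) (h1 : ∀ x ∈ G1, P x)
    (h2 : ∀ x ∈ G2, P x) (hm : ∀ x y, P x → P y → P (x * y)) : ∀ x ∈ G1 ⊔ G2, P x := by
  intro x hx
  rw [Subgroup.sup_eq_closure, ← Subgroup.mem_toSubmonoid, Subgroup.closure_toSubmonoid] at hx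
  induction hx using Submonoid.closure_induction with
  | mem x hx =>
    rcases hx with (hx | hx) | hx
    · exact h1 x hx
    · exact h2 x hx
    · rcases hx with hx | hx
      · exact h1 x (by simpa using hx)
      · exact h2 x (by simpa using hx)
  | one => exact h1 1 G1.one_mem
  | mul x y _ _ hx hy => exact hm x y hx hy

lemma adjoin_eq_span_closure {r : ℕ} {R : Type*} [CommRing R] [Algebra R (Matrix (Fin r) (Fin r) ℂ)]
    {T : Set (GL (Fin r) ℂ)} (hT : (Subgroup.closure T : Set (GL (Fin r) ℂ)).Finite) :
    Subalgebra.toSubmodule (Algebra.adjoin R (mset T)) =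
      Submodule.span R (mset (Subgroup.closure T : Set (GL (Fin r) ℂ))) := by
  rw [Algebra.adjoin_eq_span]
  congr 1
  have hfin : Finite (Subgroup.closure T) := hT
  have hs : ∀ x ∈ T, IsOfFinOrder x := by
    intro x hx
    have := isOfFinOrder_of_finite (⟨x, Subgroup.subset_closure hx⟩ : Subgroup.closure T)
    obtain ⟨n, hn, h⟩ := isOfFinOrder_iff_pow_eq_one.1 this
    exact isOfFinOrder_iff_pow_eq_one.2 ⟨n, hn, by simpa using congrArg Subtype.val h⟩
  have h1 := Subgroup.closure_toSubmonoid_of_isOfFinOrder hs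
  have h2 := MonoidHom.map_mclosure (Units.coeHom (Matrix (Fin r) (Fin r) ℂ)) T
  have h3 : (Units.coeHom (Matrix (Fin r) (Fin r) ℂ)) '' T = mset T := rfl
  rw [h3] at h2
  rw [← h2, ← h1]
  rfl

lemma adjoin_fg {r : ℕ} {R : Type*} [CommRing R] [Algebra R (Matrix (Fin r) (Fin r) ℂ)]
    {T : Set (GL (Fin r) ℂ)} (hT : (Subgroup.closure T : Set (GL (Fin r) ℂ)).Finite) :
    (Subalgebra.toSubmodule (Algebra.adjoin R (mset T))).FG := by
  rw [adjoin_eq_span_closure hT]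
  exact Submodule.fg_span (hT.image _)

lemma isIntegral_int_of_valuation {x : ℂ} (h : ∀ O : ValuationSubring ℂ, x ∈ O) : IsIntegral ℤ x := by
  have h1 : x ∈ (⨅ V : {V : ValuationSubring ℂ // (∅ : Set ℂ) ⊆ V.toSubring}, V.1.toSubring) := by
    rw [Subring.mem_iInf]; intro V; exact h V.1
  rw [iInf_valuationSubring_superset] at h1
  have h2 : IsIntegral (Subring.closure (∅ : Set ℂ)) x := h1
  have h3 : Algebra.IsIntegral ℤ (Subring.closure (∅ : Set ℂ)) := by
    constructor
    rintro ⟨y, hy⟩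
    rw [Subring.closure_empty] at hy
    obtain ⟨n, rfl⟩ := Subring.mem_bot.1 hy
    have := isIntegral_algebraMap (R := ℤ) (A := Subring.closure (∅ : Set ℂ)) (x := n)
    convert this using 1
    ext; simp
  exact isIntegral_trans x h2

lemma mem_of_isIntegral_matrix {r : ℕ} {a : Matrix (Fin r) (Fin r) ℂ} (O : ValuationSubring ℂ)
    (h : IsIntegral O a) {μ : ℂ} (hμ : μ ∈ a.charpoly.roots) : μ ∈ O := by
  have hroot := (Polynomial.mem_roots (a.charpoly_monic.ne_zero)).1 hμ
  have hs := (Matrix.mem_spectrum_iff_isRoot_charpoly).2 hroot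
  obtain ⟨p, hp, hpa⟩ := h
  have h1 : Polynomial.aeval a (p.map (algebraMap O ℂ)) = 0 := by
    rw [Polynomial.aeval_map_algebraMap]; exact hpa
  have h2 := spectrum.subset_polynomial_aeval a (p.map (algebraMap O ℂ)) ⟨μ, hs, rfl⟩
  rw [h1] at h2
  have hne : Nonempty (Fin r) := by
    by_contra hc
    rw [not_nonempty_iff] at hc
    have : Subsingleton (Matrix (Fin r) (Fin r) ℂ) := inferInstance
    rw [spectrum.of_subsingleton] at h2
    exact h2
  rw [spectrum.zero_eq] at h2
  have h3 : IsIntegral O μ := ⟨p, hp, by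
    rw [Polynomial.eval₂_eq_eval_map]; exact h2⟩
  obtain ⟨y, hy⟩ := IsIntegrallyClosed.isIntegral_iff.1 h3
  rw [← hy]; exact y.2

lemma trace_isIntegral {r : ℕ} {a : Matrix (Fin r) (Fin r) ℂ}
    (h : ∀ O : ValuationSubring ℂ, IsIntegral O a) : IsIntegral ℤ a.trace := by
  rw [Matrix.trace_eq_sum_roots_charpoly]
  have : ∀ μ ∈ a.charpoly.roots, μ ∈ (integralClosure ℤ ℂ) := fun μ hμ =>
    isIntegral_int_of_valuation fun O => mem_of_isIntegral_matrix O (h O) hμ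
  exact (integralClosure ℤ ℂ).multiset_sum_mem this

lemma map_mem_span {r : ℕ} (G0 : Subgroup (GL (Fin r) ℂ)) (σ : ℂ →+* ℂ)
    {a : Matrix (Fin r) (Fin r) ℂ} (ha : a ∈ Submodule.span ℂ (mset (G0 : Set (GL (Fin r) ℂ)))) :
    a.map σ ∈ Submodule.span ℂ (mset ((G0.map (Matrix.GeneralLinearGroup.map σ) :
      Subgroup (GL (Fin r) ℂ)) : Set (GL (Fin r) ℂ))) := by
  induction ha using Submodule.span_induction with
  | mem x hx =>
    obtain ⟨g, hg, rfl⟩ := hx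
    exact Submodule.subset_span ⟨_, Subgroup.mem_map_of_mem _ hg, rfl⟩
  | zero => simp
  | add x y _ _ hx hy =>
    have : (x + y).map σ = x.map σ + y.map σ := Matrix.map_add _ (map_add σ) _ _
    rw [this]; exact Submodule.add_mem _ hx hy
  | smul c x _ hx =>
    have : (c • x).map σ = σ c • x.map σ := by ext; simp
    rw [this]; exact Submodule.smul_mem _ _ hx

open scoped ComplexOrder Matrix in
lemma norm_sigma_trace_le {r : ℕ} (G0 G1 G2 : Subgroup (GL (Fin r) ℂ))
    (hf0 : (G0 : Set (GL (Fin r) ℂ)).Finite)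
    (hf1 : (G1 : Set (GL (Fin r) ℂ)).Finite) (hf2 : (G2 : Set (GL (Fin r) ℂ)).Finite)
    (h01 : G0 ≤ G1) (h02 : G0 ≤ G2)
    (hs1 : ∀ a ∈ G1, (a : Matrix (Fin r) (Fin r) ℂ) ∈ Submodule.span ℂ (mset (G0 : Set (GL (Fin r) ℂ))))
    (hs2 : ∀ a ∈ G2, (a : Matrix (Fin r) (Fin r) ℂ) ∈ Submodule.span ℂ (mset (G0 : Set (GL (Fin r) ℂ))))
    (σ : ℂ →+* ℂ) (γ : GL (Fin r) ℂ) (hγ : γ ∈ G1 ⊔ G2) :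
    ‖σ (γ : Matrix (Fin r) (Fin r) ℂ).trace‖ ≤ r := by
  let m : GL (Fin r) ℂ →* GL (Fin r) ℂ := Matrix.GeneralLinearGroup.map σ
  have key : ∀ G : Subgroup (GL (Fin r) ℂ), (∀ a ∈ G, (a : Matrix (Fin r) (Fin r) ℂ) ∈ Submodule.span ℂ (mset (G0 : Set (GL (Fin r) ℂ)))) →
      ∀ a ∈ G.map m, (a : Matrix (Fin r) (Fin r) ℂ) ∈ Submodule.span ℂ (mset (G0.map m : Set (GL (Fin r) ℂ))) := by
    intro G hG a ha
    obtain ⟨b, hb, rfl⟩ := Subgroup.mem_map.1 ha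
    exact map_mem_span G0 σ (hG b hb)
  have hfm : ∀ G : Subgroup (GL (Fin r) ℂ), (G : Set (GL (Fin r) ℂ)).Finite → (G.map m : Set (GL (Fin r) ℂ)).Finite := by
    intro G hG; rw [Subgroup.coe_map]; exact hG.image _
  obtain ⟨H, hH, hinv⟩ := exists_inv_form (G0.map m) (hfm _ hf0)
  have i1 := form_transfer (G0.map m) (G1.map m) (hfm _ hf1) (Subgroup.map_mono h01) (key _ hs1) hH hinv
  have i2 := form_transfer (G0.map m) (G2.map m) (hfm _ hf2) (Subgroup.map_mono h02) (key _ hs2) hH hinv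
  have i3 : ∀ x ∈ G1 ⊔ G2, ((m x : GL (Fin r) ℂ) : Matrix (Fin r) (Fin r) ℂ)ᴴ * H * ((m x : GL (Fin r) ℂ) : Matrix (Fin r) (Fin r) ℂ) = H := by
    intro x hx
    refine subgroup_sup_ind G1 G2 (fun x => ((m x : GL (Fin r) ℂ) : Matrix (Fin r) (Fin r) ℂ)ᴴ * H * ((m x : GL (Fin r) ℂ) : Matrix (Fin r) (Fin r) ℂ) = H) ?_ ?_ ?_ x hx
    · exact fun x hx => i1 _ (Subgroup.mem_map_of_mem _ hx)
    · exact fun x hx => i2 _ (Subgroup.mem_map_of_mem _ hx)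
    · intro x y ihx ihy
      rw [map_mul, Units.val_mul, Matrix.conjTranspose_mul]
      calc _ = ((m y : GL (Fin r) ℂ) : Matrix (Fin r) (Fin r) ℂ)ᴴ * (((m x : GL (Fin r) ℂ) : Matrix (Fin r) (Fin r) ℂ)ᴴ * H * ((m x : GL (Fin r) ℂ) : Matrix (Fin r) (Fin r) ℂ)) * ((m y : GL (Fin r) ℂ) : Matrix (Fin r) (Fin r) ℂ) := by
            simp only [Matrix.mul_assoc]
        _ = H := by rw [ihx, ihy]
  have := norm_trace_le hH (i3 γ hγ)
  have e : ((m γ : GL (Fin r) ℂ) : Matrix (Fin r) (Fin r) ℂ).trace = σ (γ : Matrix (Fin r) (Fin r) ℂ).trace := by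
    change ((γ : Matrix (Fin r) (Fin r) ℂ).map σ).trace = _
    exact (AddMonoidHom.map_trace σ.toAddMonoidHom _).symm
  rwa [e] at this


lemma finite_sup {r : ℕ} (G0 G1 G2 : Subgroup (GL (Fin r) ℂ))
    (hf0 : (G0 : Set (GL (Fin r) ℂ)).Finite)
    (hf1 : (G1 : Set (GL (Fin r) ℂ)).Finite) (hf2 : (G2 : Set (GL (Fin r) ℂ)).Finite)
    (h01 : G0 ≤ G1) (h02 : G0 ≤ G2)
    (hs1 : ∀ a ∈ G1, (a : Matrix (Fin r) (Fin r) ℂ) ∈ Submodule.span ℂ (mset (G0 : Set (GL (Fin r) ℂ))))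
    (hs2 : ∀ a ∈ G2, (a : Matrix (Fin r) (Fin r) ℂ) ∈ Submodule.span ℂ (mset (G0 : Set (GL (Fin r) ℂ))))
    (hint : ∀ γ ∈ G1 ⊔ G2, IsIntegral ℤ (γ : Matrix (Fin r) (Fin r) ℂ).trace) :
    ((G1 ⊔ G2 : Subgroup (GL (Fin r) ℂ)) : Set (GL (Fin r) ℂ)).Finite := by
  classical
  set T : Set ℂ := Set.image2 (fun x g : GL (Fin r) ℂ => ((x * g : GL (Fin r) ℂ) : Matrix (Fin r) (Fin r) ℂ).trace)
    ((G1 : Set (GL (Fin r) ℂ)) ∪ G2) G0 with hTdef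
  have hTfin : T.Finite := (hf1.union hf2).image2 _ hf0
  have h0 : G0 ≤ G1 ⊔ G2 := h01.trans le_sup_left
  have hTint : ∀ x ∈ T, IsIntegral ℚ x := by
    rintro _ ⟨x, hx, g, hg, rfl⟩
    refine IsIntegral.tower_top (R := ℤ) (hint (x * g) (Subgroup.mul_mem _ ?_ (h0 hg)))
    rcases hx with hx | hx
    · exact le_sup_left (a := G1) hx
    · exact le_sup_right (a := G1) hx
  have hTf : Finite T := hTfin
  let K : IntermediateField ℚ ℂ := IntermediateField.adjoin ℚ T
  have hKfd : FiniteDimensional ℚ K := IntermediateField.finiteDimensional_adjoin hTint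
  have hTK : ∀ x ∈ T, x ∈ K := fun x hx => IntermediateField.subset_adjoin ℚ T hx
  obtain ⟨π, hπ⟩ := LinearMap.exists_leftInverse_of_injective (Algebra.linearMap K ℂ)
    (LinearMap.ker_eq_bot.2 (algebraMap K ℂ).injective)
  have hπK : ∀ x ∈ K, ((π x : K) : ℂ) = x := by
    intro x hx
    have := LinearMap.congr_fun hπ ⟨x, hx⟩
    exact congrArg Subtype.val this
  have hG0K : ∀ h ∈ G0, ∀ g ∈ G0, ((h : Matrix (Fin r) (Fin r) ℂ) * (g : Matrix (Fin r) (Fin r) ℂ)).trace ∈ K := by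
    intro h hh g hg
    exact hTK _ ⟨h, Or.inl (h01 hh), g, hg, rfl⟩
  have step : ∀ y ∈ Submodule.span ℂ (mset (G0 : Set (GL (Fin r) ℂ))),
      ∃ y' ∈ Submodule.span K (mset (G0 : Set (GL (Fin r) ℂ))),
        ∀ g ∈ G0, (y' * (g : Matrix (Fin r) (Fin r) ℂ)).trace = (π ((y * (g : Matrix (Fin r) (Fin r) ℂ)).trace) : ℂ) := by
    intro y hy
    induction hy using Submodule.closure_induction with
    | zero => exact ⟨0, Submodule.zero_mem _, by simp⟩
    | add x y _ _ hx hy =>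
      obtain ⟨x', hx', hx2⟩ := hx
      obtain ⟨y', hy', hy2⟩ := hy
      refine ⟨x' + y', Submodule.add_mem _ hx' hy', fun g hg => ?_⟩
      rw [add_mul, add_mul, Matrix.trace_add, Matrix.trace_add, hx2 g hg, hy2 g hg, map_add]
      rfl
    | smul_mem c x hx =>
      have hxs := hx
      obtain ⟨h, hh, rfl⟩ := hx
      refine ⟨(π c) • (h : Matrix (Fin r) (Fin r) ℂ), Submodule.smul_mem _ _ (Submodule.subset_span hxs), fun g hg => ?_⟩
      have hk := hG0K h hh g hg
      simp only [smul_mul_assoc, Matrix.trace_smul]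
      generalize ((h : Matrix (Fin r) (Fin r) ℂ) * (g : Matrix (Fin r) (Fin r) ℂ)).trace = t at hk
      have e : c • t = (⟨t, hk⟩ : K) • c := by
        change c * t = t * c
        ring
      rw [e, map_smul]
      change (π c : ℂ) * t = t * (π c : ℂ)
      ring
  have hspanle : ∀ y ∈ Submodule.span K (mset (G0 : Set (GL (Fin r) ℂ))), y ∈ Submodule.span ℂ (mset (G0 : Set (GL (Fin r) ℂ))) := by
    intro y hy
    exact Submodule.span_le_restrictScalars K ℂ _ hy
  have hX : ∀ x : GL (Fin r) ℂ, (x ∈ G1 ∨ x ∈ G2) → (x : Matrix (Fin r) (Fin r) ℂ) ∈ Submodule.span K (mset (G0 : Set (GL (Fin r) ℂ))) := by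
    intro x hx
    have hxs : (x : Matrix (Fin r) (Fin r) ℂ) ∈ Submodule.span ℂ (mset (G0 : Set (GL (Fin r) ℂ))) := by
      rcases hx with hx | hx
      · exact hs1 x hx
      · exact hs2 x hx
    obtain ⟨y', hy', hy2⟩ := step _ hxs
    have : y' - (x : Matrix (Fin r) (Fin r) ℂ) = 0 := by
      apply trace_nondeg G0 hf0 (Submodule.sub_mem _ (hspanle _ hy') hxs)
      intro g hg
      rw [sub_mul, Matrix.trace_sub, hy2 g hg, sub_eq_zero]
      exact hπK _ (hTK _ ⟨x, hx, g, hg, rfl⟩)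
    rw [sub_eq_zero] at this
    rwa [← this]
  have hcl : Subgroup.closure (G0 : Set (GL (Fin r) ℂ)) = G0 := Subgroup.closure_eq G0
  have hadj := adjoin_eq_span_closure (R := K) (T := (G0 : Set (GL (Fin r) ℂ))) (by rw [hcl]; exact hf0)
  rw [hcl] at hadj
  have hΓ : ∀ γ ∈ G1 ⊔ G2, (γ : Matrix (Fin r) (Fin r) ℂ) ∈ Submodule.span K (mset (G0 : Set (GL (Fin r) ℂ))) := by
    refine subgroup_sup_ind G1 G2 _ (fun x hx => hX x (Or.inl hx)) (fun x hx => hX x (Or.inr hx)) ?_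
    intro x y hx hy
    rw [← hadj] at hx hy ⊢
    exact Subalgebra.mul_mem _ hx hy
  have htrK : ∀ y ∈ Submodule.span K (mset (G0 : Set (GL (Fin r) ℂ))), y.trace ∈ K := by
    intro y hy
    induction hy using Submodule.span_induction with
    | mem x hx =>
      obtain ⟨h, hh, rfl⟩ := hx
      have := hG0K h hh 1 G0.one_mem
      simpa using this
    | zero => simp
    | add x y _ _ hx hy => rw [Matrix.trace_add]; exact K.add_mem hx hy
    | smul c x _ hx => rw [Matrix.trace_smul]; exact K.mul_mem c.2 hx
  have hNF : NumberField K := ⟨⟩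
  have hfinS := NumberField.Embeddings.finite_of_norm_le K ℂ (r : ℝ)
  set S : Set ℂ := (fun x : K => (x : ℂ)) '' {x : K | IsIntegral ℤ x ∧ ∀ φ : K →+* ℂ, ‖φ x‖ ≤ (r : ℝ)} with hS
  have hSfin : S.Finite := hfinS.image _
  have htrS : ∀ γ ∈ G1 ⊔ G2, (γ : Matrix (Fin r) (Fin r) ℂ).trace ∈ S := by
    intro γ hγ
    refine ⟨⟨_, htrK _ (hΓ γ hγ)⟩, ⟨?_, ?_⟩, rfl⟩
    · exact (isIntegral_algebraMap_iff (algebraMap K ℂ).injective).1 (hint γ hγ)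
    · intro φ
      obtain ⟨σ, hσ⟩ := exists_extend_embedding K φ
      rw [← hσ]
      exact norm_sigma_trace_le G0 G1 G2 hf0 hf1 hf2 h01 h02 hs1 hs2 σ γ hγ
  have hG0f : Finite G0 := hf0
  refine Set.Finite.of_injOn (f := fun γ : GL (Fin r) ℂ => fun g : G0 => ((γ * g : GL (Fin r) ℂ) : Matrix (Fin r) (Fin r) ℂ).trace)
    (t := Set.pi Set.univ (fun _ => S)) ?_ ?_ (Set.Finite.pi' (fun _ => hSfin) |>.subset (fun f hf i => hf i trivial))
  · intro γ hγ g _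
    exact htrS _ (Subgroup.mul_mem _ hγ (h0 g.2))
  · intro γ hγ γ' hγ' he
    apply Units.ext
    rw [← sub_eq_zero]
    apply trace_nondeg G0 hf0 (Submodule.sub_mem _ (hspanle _ (hΓ γ hγ)) (hspanle _ (hΓ γ' hγ')))
    intro g hg
    have := congrFun he ⟨g, hg⟩
    rw [sub_mul, Matrix.trace_sub, sub_eq_zero]
    exact this


lemma mset_image {r : ℕ} {ι : Type*} (A : ι → GL (Fin r) ℂ) (T : Set ι) :
    mset (A '' T) = (fun i => (A i : Matrix (Fin r) (Fin r) ℂ)) '' T := by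
  unfold mset; rw [Set.image_image]

lemma core_finite {r : ℕ} (hr : 0 < r) {ι : Type*} [Fintype ι] [DecidableEq ι] (A : ι → GL (Fin r) ℂ)
    (hcard : r ^ 2 + 1 ≤ Fintype.card ι)
    (HB : ∀ j, (A j : Matrix (Fin r) (Fin r) ℂ) ∈
        Algebra.adjoin ℂ ((fun i => (A i : Matrix (Fin r) (Fin r) ℂ)) '' {i | i ≠ j}) →
      (Subgroup.closure (A '' {i | i ≠ j}) : Set (GL (Fin r) ℂ)).Finite) :
    (Subgroup.closure (Set.range A) : Set (GL (Fin r) ℂ)).Finite := by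
  have hne : Nonempty (Fin r) := ⟨⟨0, hr⟩⟩
  set a : ι → Matrix (Fin r) (Fin r) ℂ := fun i => (A i : Matrix (Fin r) (Fin r) ℂ) with ha
  -- two redundant generators
  obtain ⟨S, -, hS1, hS2⟩ := exists_small_gen (k := ℂ) a Finset.univ
  have hS3 : S.card + 1 ≤ r ^ 2 := by
    refine hS2.trans ((Submodule.finrank_le (Subalgebra.toSubmodule (Algebra.adjoin ℂ (a '' (S : Set ι))))).trans ?_)
    rw [Module.finrank_matrix]; simp [sq]
  have hScompl : 1 < (Sᶜ).card := by rw [Finset.card_compl]; omega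
  obtain ⟨j, hj, j', hj', hjj⟩ := Finset.one_lt_card.1 hScompl
  rw [Finset.mem_compl] at hj hj'
  have hall : ∀ i, a i ∈ Algebra.adjoin ℂ (a '' (S : Set ι)) := by
    intro i; rw [hS1]; exact Algebra.subset_adjoin ⟨i, by simp, rfl⟩
  have hSj : ∀ k, k ∉ S → (S : Set ι) ⊆ {i | i ≠ k} := by
    intro k hk i hi h; exact hk (h ▸ hi)
  have hf1 := HB j (Algebra.adjoin_mono (Set.image_mono (hSj j hj)) (hall j))
  have hf2 := HB j' (Algebra.adjoin_mono (Set.image_mono (hSj j' hj')) (hall j'))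
  set G1 := Subgroup.closure (A '' {i | i ≠ j}) with hG1
  set G2 := Subgroup.closure (A '' {i | i ≠ j'}) with hG2
  set G0 := Subgroup.closure (A '' {i | i ≠ j ∧ i ≠ j'}) with hG0
  have h01 : G0 ≤ G1 := Subgroup.closure_mono (Set.image_mono fun i hi => hi.1)
  have h02 : G0 ≤ G2 := Subgroup.closure_mono (Set.image_mono fun i hi => hi.2)
  have hf0 : (G0 : Set (GL (Fin r) ℂ)).Finite := hf1.subset h01
  have hsup : Subgroup.closure (Set.range A) = G1 ⊔ G2 := by
    rw [hG1, hG2, ← Subgroup.closure_union, ← Set.image_union]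
    congr 1
    ext x
    constructor
    · rintro ⟨i, rfl⟩
      refine ⟨i, ?_, rfl⟩
      by_cases h : i = j
      · right; rw [h]; exact hjj
      · left; exact h
    · rintro ⟨i, -, rfl⟩; exact ⟨i, rfl⟩
  -- general transfer statement
  have hsub : ∀ {R : Type} [CommRing R] [Algebra R (Matrix (Fin r) (Fin r) ℂ)]
      (B : Subalgebra R (Matrix (Fin r) (Fin r) ℂ)), (∀ i, a i ∈ B) →
      ∀ (G : Subgroup (GL (Fin r) ℂ)) (T : Set ι), G = Subgroup.closure (A '' T) →
        (G : Set (GL (Fin r) ℂ)).Finite →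
        ∀ x ∈ G, (x : Matrix (Fin r) (Fin r) ℂ) ∈ B := by
    intro R _ _ B hB G T hG hGf x hx
    subst hG
    have h1 : (x : Matrix (Fin r) (Fin r) ℂ) ∈ Subalgebra.toSubmodule (Algebra.adjoin R (mset (A '' T))) := by
      rw [adjoin_eq_span_closure hGf]
      exact Submodule.subset_span ⟨x, hx, rfl⟩
    refine (Algebra.adjoin_le (S := B) ?_) h1
    rintro _ ⟨_, ⟨i, -, rfl⟩, rfl⟩
    exact hB i
  have hspan : ∀ i, a i ∈ Algebra.adjoin ℂ (mset (A '' {i | i ≠ j ∧ i ≠ j'})) := by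
    intro i
    rw [mset_image]
    refine Algebra.adjoin_mono (Set.image_mono ?_) (hall i)
    intro k hk; exact ⟨hSj j hj hk, hSj j' hj' hk⟩
  have hmem : ∀ x : Matrix (Fin r) (Fin r) ℂ, x ∈ Algebra.adjoin ℂ (mset (A '' {i | i ≠ j ∧ i ≠ j'})) →
      x ∈ Submodule.span ℂ (mset (G0 : Set (GL (Fin r) ℂ))) := by
    intro x hx
    rw [hG0, ← adjoin_eq_span_closure hf0]
    exact hx
  rw [hsup]
  refine finite_sup G0 G1 G2 hf0 hf1 hf2 h01 h02
    (fun x hx => hmem _ (hsub _ hspan G1 _ hG1 hf1 x hx))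
    (fun x hx => hmem _ (hsub _ hspan G2 _ hG2 hf2 x hx)) ?_
  intro γ hγ
  apply trace_isIntegral
  intro O
  have hUj : ((Finset.univ.erase j : Finset ι) : Set ι) = {i | i ≠ j} := by ext; simp
  obtain ⟨S', hS'1, hS'2, hS'3⟩ := exists_small_gen_val hr O a (Finset.univ.erase j) (by
    rw [hUj, ← mset_image]; exact adjoin_fg hf1)
  have hex : ∃ k, k ∉ insert j S' := by
    by_contra hc
    push Not at hc
    have h1 : insert j S' = Finset.univ := Finset.eq_univ_iff_forall.2 hc
    have h2 := Finset.card_insert_le j S'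
    rw [h1, Finset.card_univ] at h2
    omega
  obtain ⟨k, hk⟩ := hex
  rw [Finset.mem_insert, not_or] at hk
  have hkO : a k ∈ Algebra.adjoin O (a '' {i | i ≠ k}) := by
    have h1 : a k ∈ Algebra.adjoin O (a '' (S' : Set ι)) := by
      rw [hS'2]; exact Algebra.subset_adjoin ⟨k, by simp [hk.1], rfl⟩
    refine Algebra.adjoin_mono (Set.image_mono ?_) h1
    intro i hi h; exact hk.2 (h ▸ hi)
  have hkC : a k ∈ Algebra.adjoin ℂ (a '' {i | i ≠ k}) := by
    have hle : Algebra.adjoin O (a '' {i | i ≠ k}) ≤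
        (Algebra.adjoin ℂ (a '' {i | i ≠ k})).restrictScalars O :=
      Algebra.adjoin_le Algebra.subset_adjoin
    exact hle hkO
  have hfk := HB k hkC
  have hallO : ∀ i, a i ∈ Algebra.adjoin O (mset (A '' {i | i ≠ k})) := by
    intro i
    rw [mset_image]
    by_cases h : i = k
    · rw [h]; exact hkO
    · exact Algebra.subset_adjoin ⟨i, h, rfl⟩
  refine IsIntegral.of_mem_of_fg (Algebra.adjoin O (mset (A '' {i | i ≠ k}))) (adjoin_fg hfk) _ ?_
  refine subgroup_sup_ind G1 G2 (fun x => (x : Matrix (Fin r) (Fin r) ℂ) ∈ Algebra.adjoin O (mset (A '' {i | i ≠ k})))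
    (fun x hx => hsub _ hallO G1 _ hG1 hf1 x hx) (fun x hx => hsub _ hallO G2 _ hG2 hf2 x hx) ?_ γ hγ
  intro x y hx hy
  rw [Units.val_mul]
  exact Subalgebra.mul_mem _ hx hy

/-- A rank-`r` representation of the free group `F_N`, `N = 2g` or `2g+1`, with finite
orbit under `Aut(F_N)` and `r² ≤ g`, has finite image. -/
theorem finite_image_of_Out_finite_free_group (g r N : ℕ)
    (hN : N = 2 * g ∨ N = 2 * g + 1) (hr : r ^ 2 ≤ g)
    (ρ : FreeGroup (Fin N) →* GL (Fin r) ℂ)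
    (hfin : FiniteAutOrbit ρ) :
    Set.Finite (Set.range ⇑ρ) := by
  rcases Nat.eq_zero_or_pos r with rfl | hr0
  · have : Subsingleton (GL (Fin 0) ℂ) := ⟨fun x y => Units.ext (Subsingleton.elim _ _)⟩
    exact Set.toFinite _
  · have h1 : 1 ≤ r ^ 2 := Nat.one_le_pow _ _ hr0
    have hcl := core_finite hr0 (fun i : Fin N => ρ (FreeGroup.of i))
      (by rw [Fintype.card_fin]; omega) (fun j h => finite_Gj ρ hfin j h)
    have e : (Subgroup.closure (Set.range fun i : Fin N => ρ (FreeGroup.of i))) = ρ.range := by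
      rw [MonoidHom.range_eq_map, ← FreeGroup.closure_range_of, MonoidHom.map_closure, ← Set.range_comp]
      rfl
    rw [e, MonoidHom.coe_range] at hcl
    exact hcl
end

section
/- Fix integers g ≥ 1, r ≥ 0 with r² ≤ g (equivalently r < √(g+1)), and let N = 2g or N = 2g+1. Let (A₁, …, A_N) be an N-tuple of matrices in GL_r(ℂ). Consider the four operations on N-tuples of invertible matrices: c : (A₁, A₂, …, A_N) ↦ (A₂, A₃, …, A_N, A₁); τ : (A₁, A₂, A₃, …, A_N) ↦ (A₂, A₁, A₃, …, A_N); ε : (A₁, A₂, …, A_N) ↦ (A₁⁻¹, A₂, …, A_N); d : (A₁, A₂, …, A_N) ↦ (A₁A₂, A₂, …, A_N). If the set of N-tuples obtained from (A₁, …, A_N) by repeatedly applying c, τ, ε and d meets only finitely many conjugacy classes of N-tuples, then A₁, …, A_N generate a finite subgroup of GL_r(ℂ). -/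
/-- Two `N`-tuples of invertible matrices are conjugate if they differ by simultaneous
conjugation: `Aᵢ = B Aᵢ′ B⁻¹` for all `i`. -/
def TupleConj {N r : ℕ} (A A' : Fin N → GL (Fin r) ℂ) : Prop :=
  ∃ B : GL (Fin r) ℂ, ∀ i, A i = B * A' i * B⁻¹

/-- The cyclic permutation `c : (A₁, A₂, …, A_N) ↦ (A₂, A₃, …, A_N, A₁)`. -/
def opCyc {N r : ℕ} (A : Fin N → GL (Fin r) ℂ) : Fin N → GL (Fin r) ℂ :=
  fun i => A ⟨(i.val + 1) % N, Nat.mod_lt _ i.pos⟩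

/-- The transposition `τ : (A₁, A₂, A₃, …, A_N) ↦ (A₂, A₁, A₃, …, A_N)`. -/
def opSwap {N r : ℕ} (h2 : 2 ≤ N) (A : Fin N → GL (Fin r) ℂ) : Fin N → GL (Fin r) ℂ :=
  fun i =>
    if i.val = 0 then A ⟨1, by omega⟩
    else if i.val = 1 then A ⟨0, by omega⟩
    else A i

/-- The inversion `ε : (A₁, A₂, …, A_N) ↦ (A₁⁻¹, A₂, …, A_N)`. -/
def opInv {N r : ℕ} (A : Fin N → GL (Fin r) ℂ) : Fin N → GL (Fin r) ℂ :=
  fun i => if i.val = 0 then (A i)⁻¹ else A i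

/-- The Dehn twist `d : (A₁, A₂, …, A_N) ↦ (A₁A₂, A₂, …, A_N)`. -/
def opDehn {N r : ℕ} (h2 : 2 ≤ N) (A : Fin N → GL (Fin r) ℂ) : Fin N → GL (Fin r) ℂ :=
  fun i => if i.val = 0 then A i * A ⟨1, by omega⟩ else A i

/-- The tuples obtained from `A` by repeatedly applying `c`, `τ`, `ε`, `d`. -/
inductive Reach {N r : ℕ} (h2 : 2 ≤ N) (A : Fin N → GL (Fin r) ℂ) :
    (Fin N → GL (Fin r) ℂ) → Prop
  | base : Reach h2 A A
  | cyc {B} : Reach h2 A B → Reach h2 A (opCyc B)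
  | swap {B} : Reach h2 A B → Reach h2 A (opSwap h2 B)
  | inv {B} : Reach h2 A B → Reach h2 A (opInv B)
  | dehn {B} : Reach h2 A B → Reach h2 A (opDehn h2 B)


def SLt {α : Type*} [LT α] (v u : List α) : Prop :=
  ∃ (c : List α) (b a : α) (v' u' : List α), v = c ++ b :: v' ∧ u = c ++ a :: u' ∧ b < a

lemma SLt.app {α : Type*} [LT α] {v u : List α} (h : SLt v u) (p x y : List α) :
    SLt (p ++ (v ++ x)) (p ++ (u ++ y)) := by
  obtain ⟨c, b, a, v', u', rfl, rfl, hab⟩ := h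
  exact ⟨p ++ c, b, a, v' ++ x, u' ++ y, by simp, by simp, hab⟩

lemma SLt.lt {α : Type*} [LinearOrder α] {v u : List α} (h : SLt v u) : v < u := by
  obtain ⟨c, b, a, v', u', rfl, rfl, hab⟩ := h
  induction c with
  | nil => simpa using List.Lex.rel hab
  | cons x c ih => simpa [List.cons_lt_cons_iff] using ih

lemma SLt_or_prefix {α : Type*} [LinearOrder α] (v u : List α) :
    SLt v u ∨ SLt u v ∨ v <+: u ∨ u <+: v := by
  induction v generalizing u with
  | nil => simp
  | cons x v ih =>
    cases u with
    | nil => simp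
    | cons y u =>
      rcases lt_trichotomy x y with h | h | h
      · exact Or.inl ⟨[], x, y, v, u, rfl, rfl, h⟩
      · subst h
        rcases ih u with h | h | h | h
        · left; simpa using h.app [x] [] []
        · right; left; simpa using h.app [x] [] []
        · right; right; left; simpa using h
        · right; right; right; simpa using h
      · exact Or.inr (Or.inl ⟨[], y, x, u, v, rfl, rfl, h⟩)

lemma pow_prefix {α : Type*} (u y : List α) (h : y <+: u ++ y) (e : ℕ)
    (he : e * u.length ≤ (u ++ y).length) :
    (List.replicate e u).flatten <+: u ++ y := by
  induction e with
  | zero => simp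
  | succ e ih =>
    have h1 : e * u.length ≤ y.length := by
      simp only [List.length_append] at he; nlinarith
    have h2 := ih (by simp only [List.length_append]; omega)
    have h3 : (List.replicate e u).flatten <+: y :=
      List.prefix_of_prefix_length_le h2 h (by simpa using h1)
    rw [List.replicate_succ, List.flatten_cons]
    exact (List.prefix_append_right_inj u).2 h3

/-- `w` contains `m` disjoint occurrences of `v`. -/
def Occ {α : Type*} (v : List α) : ℕ → List α → Prop
  | 0, _ => True
  | (m+1), w => ∃ p w', w = p ++ (v ++ w') ∧ Occ v m w'

lemma Occ.app {α : Type*} {v : List α} {m : ℕ} {w : List α} (h : Occ v m w) (p : List α) :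
    Occ v m (p ++ w) := by
  cases m with
  | zero => trivial
  | succ m =>
    obtain ⟨q, w', rfl, h⟩ := h
    exact ⟨p ++ q, w', by simp, h⟩

lemma Occ.split {α : Type*} {v : List α} {m : ℕ} {w : List α} (h : Occ v m w)
    (j : Fin m → ℕ) :
    ∃ (p : List α) (y : Fin m → List α),
      w = p ++ (List.ofFn (fun i => v.drop (j i) ++ y i)).flatten := by
  induction m generalizing w with
  | zero => exact ⟨w, fun _ => [], by simp⟩
  | succ m ih =>
    obtain ⟨q, w', rfl, h⟩ := h
    obtain ⟨p, y, rfl⟩ := ih h (fun i => j i.succ)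
    refine ⟨q ++ v.take (j 0), Fin.cons p y, ?_⟩
    simp only [List.ofFn_succ, Fin.cons_zero, Fin.cons_succ, List.flatten_cons]
    have e : ∀ z, v ++ z = v.take (j 0) ++ (v.drop (j 0) ++ z) := fun z => by
      rw [← List.append_assoc, List.take_append_drop]
    rw [e]
    simp only [List.append_assoc]

lemma blocks {α : Type*} (b M : ℕ) (w : List α) (h : M * b ≤ w.length) :
    ∃ (bs : List (List α)) (q : List α), bs.length = M ∧ (∀ v ∈ bs, v.length = b) ∧
      w = bs.flatten ++ q := by
  induction M generalizing w with
  | zero => exact ⟨[], w, by simp⟩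
  | succ M ih =>
    obtain ⟨bs, q, h1, h2, h3⟩ := ih (w.drop b) (by simp; rw [Nat.succ_mul] at h; omega)
    refine ⟨w.take b :: bs, q, by simp [h1], ?_, ?_⟩
    · intro v hv
      rcases List.mem_cons.1 hv with rfl | hv
      · rw [Nat.succ_mul] at h; simp; omega
      · exact h2 v hv
    · rw [List.flatten_cons, List.append_assoc, ← h3, List.take_append_drop]

lemma occ_count {α : Type*} [DecidableEq α] (v : List α) (bs : List (List α)) (q : List α) :
    Occ v (bs.count v) (bs.flatten ++ q) := by
  induction bs with
  | nil => trivial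
  | cons x bs ih =>
    by_cases hx : x = v
    · subst hx
      rw [List.count_cons_self]
      exact ⟨[], bs.flatten ++ q, by simp, ih⟩
    · rw [List.count_cons_of_ne hx, List.flatten_cons, List.append_assoc]
      exact ih.app x

lemma exists_occ {α : Type*} [DecidableEq α] [Finite α] (b n : ℕ) :
    ∃ L, ∀ w : List α, L ≤ w.length → ∃ v, v.length = b ∧ Occ v n w := by
  have hf : {l : List α | l.length = b}.Finite := List.finite_length_eq α b
  refine ⟨(hf.toFinset.card * n + 1) * b, fun w hw => ?_⟩
  obtain ⟨bs, q, h1, h2, rfl⟩ := blocks b _ w hw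
  have : ∃ v ∈ bs, n ≤ bs.count v := by
    by_contra! hc
    have h3 := Multiset.toFinset_sum_count_eq (bs : Multiset (List α))
    have h4 : ∑ a ∈ (bs : Multiset (List α)).toFinset, Multiset.count a (bs : Multiset _) ≤
        ∑ a ∈ (bs : Multiset (List α)).toFinset, n :=
      Finset.sum_le_sum fun a ha => by
        have := hc a (by simpa using ha)
        rw [Multiset.coe_count]
        convert this.le
    have h5 : (bs : Multiset (List α)).toFinset ⊆ hf.toFinset := by
      intro a ha
      simpa using h2 a (by simpa using ha)
    have h6 := Finset.card_le_card h5
    rw [Finset.sum_const, smul_eq_mul, h3] at h4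
    simp only [Multiset.coe_card, h1] at h4
    nlinarith [Nat.mul_le_mul_right n h6]
  obtain ⟨v, hv, hn⟩ := this
  refine ⟨v, h2 v hv, ?_⟩
  have := occ_count v bs q
  obtain ⟨t, ht⟩ := Nat.exists_eq_add_of_le hn
  rw [ht] at this
  clear ht hn h1 h2 hw
  generalize bs.flatten ++ q = w at this
  induction n generalizing w with
  | zero => trivial
  | succ n ih =>
    rw [show n + 1 + t = (n + t) + 1 by ring] at this
    obtain ⟨p, w', rfl, h⟩ := this
    exact ⟨p, w', rfl, ih _ h⟩

lemma tails {α : Type*} [LinearOrder α] (n d : ℕ) (v : List α)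
    (hv : v.length = n * d) (hd : 0 < d)
    (hno : ∀ u : List α, u ≠ [] → u.length < n → ¬ (List.replicate d u).flatten <:+: v) :
    ∃ j : Fin n → ℕ, ∀ a b, a < b → SLt (v.drop (j b)) (v.drop (j a)) := by
  have key : ∀ i j : ℕ, i < j → j < n → ¬ (v.drop j <+: v.drop i) := by
    intro i j hij hjn hp
    have hnd : n ≤ n * d := Nat.le_mul_of_pos_right n hd
    have e1 : v.drop i = (v.drop i).take (j - i) ++ v.drop j := by
      conv_lhs => rw [← List.take_append_drop (j - i) (v.drop i)]
      rw [List.drop_drop]; congr 3; omega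
    have hl : ((v.drop i).take (j - i)).length = j - i := by simp; omega
    refine hno ((v.drop i).take (j - i)) ?_ (by omega) ?_
    · intro h0; rw [h0] at hl; simp at hl; omega
    · refine List.IsInfix.trans (List.IsPrefix.isInfix ?_) (List.drop_suffix i v).isInfix
      rw [e1] at hp
      have := pow_prefix _ _ hp d ?_
      · rwa [← e1] at this
      · rw [← e1, hl, List.length_drop, hv]
        obtain ⟨t, ht⟩ := Nat.exists_eq_add_of_lt hjn
        have : j - i + i = j := by omega
        have h7 : d * (j - i) + i ≤ d * n := by
          subst ht
          have : d * (j - i) + i ≤ d * (j - i) + d * i := by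
            have := Nat.le_mul_of_pos_left i hd
            omega
          calc _ ≤ _ := this
            _ = d * j := by rw [← mul_add]; congr 1
            _ ≤ _ := Nat.mul_le_mul_left d (by omega)
        rw [mul_comm n d]; omega
  have hne : ∀ a b : Fin n, a ≠ b → v.drop a < v.drop b → SLt (v.drop a) (v.drop b) := by
    intro a b hab hlt
    have hab' : (a : ℕ) ≠ b := fun h => hab (Fin.ext h)
    have hnd : n ≤ n * d := Nat.le_mul_of_pos_right n hd
    rcases SLt_or_prefix (v.drop a) (v.drop b) with h | h | h | h
    · exact h
    · exact absurd h.lt (lt_asymm hlt)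
    · rcases lt_or_gt_of_ne hab' with h' | h'
      · have := h.length_le; simp at this; omega
      · exact absurd h (key _ _ h' a.2)
    · rcases lt_or_gt_of_ne hab' with h' | h'
      · exact absurd h (key _ _ h' b.2)
      · have := h.length_le; simp at this; omega
  let f : Fin n → List α := fun a => v.drop a
  have hinj : Function.Injective f := by
    intro a b hab
    have := congrArg List.length hab
    have hnd : n ≤ n * d := Nat.le_mul_of_pos_right n hd
    simp [f] at this
    ext; omega
  have hm : StrictMono (f ∘ Tuple.sort f) :=
    (Tuple.monotone_sort f).strictMono_of_injective (hinj.comp (Tuple.sort f).injective)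
  refine ⟨fun a => (Tuple.sort f (Fin.rev a) : Fin n), fun a b hab => ?_⟩
  have h1 : Fin.rev b < Fin.rev a := Fin.rev_lt_rev.2 hab
  exact hne _ _ (fun h => h1.ne ((Tuple.sort f).injective h)) (hm h1)

lemma perm_lt {α : Type*} [LinearOrder α] {n : ℕ} (x y : Fin n → List α)
    (hx : ∀ a b, a < b → SLt (x b) (x a)) (σ : Equiv.Perm (Fin n)) (hσ : σ ≠ 1) :
    SLt (List.ofFn (fun i => x (σ i) ++ y (σ i))).flatten
      (List.ofFn (fun i => x i ++ y i)).flatten := by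
  have hex : ∃ i, σ i ≠ i := by
    by_contra! h; exact hσ (Equiv.ext h)
  classical
  let i := Fin.find (fun i => σ i ≠ i) hex
  have hi : σ i ≠ i := Fin.find_spec hex
  have hlt : ∀ j < i, σ j = j := fun j hj => by
    by_contra h; exact Fin.find_min hex hj h
  have hgt : i < σ i := by
    rcases lt_or_gt_of_ne hi with h | h
    · exact absurd (σ.injective (hlt _ h)) hi
    · exact h
  have hdec : ∀ g : Fin n → List α, (List.ofFn g).flatten =
      ((List.ofFn g).take i).flatten ++ (g i ++ ((List.ofFn g).drop (i+1)).flatten) := by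
    intro g
    conv_lhs => rw [← List.take_append_drop i (List.ofFn g)]
    rw [List.flatten_append, List.drop_eq_getElem_cons (by simp)]
    simp
  rw [hdec, hdec (fun i => x i ++ y i)]
  have : (List.ofFn (fun i => x (σ i) ++ y (σ i))).take i =
      (List.ofFn (fun i => x i ++ y i)).take i := by
    apply List.ext_getElem
    · simp
    · intro k h1 h2
      have hk : k < i := by simp at h1; omega
      have hkn : k < n := by omega
      have := hlt ⟨k, hkn⟩ hk
      simp [this]
  rw [this]
  simp only [List.append_assoc]
  exact (hx _ _ hgt).app _ _ _

lemma std_identity {r : ℕ} (m : Fin (r^2+1) → Matrix (Fin r) (Fin r) ℂ) :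
    ∑ σ : Equiv.Perm (Fin (r^2+1)), Equiv.Perm.sign σ • (List.ofFn (fun i => m (σ i))).prod = 0 := by
  have h : ¬ LinearIndependent ℂ m := by
    intro h
    have := h.fintype_card_le_finrank
    simp [Module.finrank_matrix, sq] at this
  have := (MultilinearMap.alternatization
    (MultilinearMap.mkPiAlgebraFin ℂ (r^2+1) (Matrix (Fin r) (Fin r) ℂ))).map_linearDependent m h
  rw [MultilinearMap.alternatization_apply] at this
  simpa using this

theorem shirshov {k r d : ℕ} (hd : 0 < d) (B : Fin k → Matrix (Fin r) (Fin r) ℂ)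
    (h : ∀ u : List (Fin k), u ≠ [] → u.length ≤ r^2 → ((u.map B).prod)^d = 1) :
    ∃ L, ∀ w : List (Fin k), (w.map B).prod ∈
      Submodule.span ℤ ((fun w : List (Fin k) => (w.map B).prod) '' {w | w.length < L}) := by
  obtain ⟨L, hL⟩ := exists_occ (α := Fin k) ((r^2+1) * d) (r^2+1)
  refine ⟨L, ?_⟩
  set Λ := Submodule.span ℤ ((fun w : List (Fin k) => (w.map B).prod) '' {w | w.length < L})
  suffices H : ∀ ℓ, ∀ w : List (Fin k), w.length = ℓ → (w.map B).prod ∈ Λ from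
    fun w => H _ w rfl
  intro ℓ
  induction ℓ using Nat.strong_induction_on with
  | _ ℓ ih =>
  by_cases hℓ : ℓ < L
  · intro w hw
    exact Submodule.subset_span ⟨w, by simpa [hw] using hℓ, rfl⟩
  have hwf : WellFounded (fun a b : {w : List (Fin k) // w.length = ℓ} => a.1 < b.1) := by
    have : Finite {w : List (Fin k) // w.length = ℓ} := (List.finite_length_eq (Fin k) ℓ)
    have : IsTrans {w : List (Fin k) // w.length = ℓ} (fun a b => a.1 < b.1) :=
      ⟨fun a b c => lt_trans⟩
    have : Std.Irrefl (fun a b : {w : List (Fin k) // w.length = ℓ} => a.1 < b.1) :=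
      ⟨fun a => lt_irrefl _⟩
    exact Finite.wellFounded_of_trans_of_irrefl _
  intro w hw
  suffices H : ∀ w : {w : List (Fin k) // w.length = ℓ}, (w.1.map B).prod ∈ Λ from H ⟨w, hw⟩
  clear hw w
  intro w
  induction w using hwf.induction with
  | _ w ihw =>
  obtain ⟨w, hw⟩ := w
  obtain ⟨v, hv, hocc⟩ := hL w (by omega)
  show (w.map B).prod ∈ Λ
  by_cases hno : ∃ u : List (Fin k), u ≠ [] ∧ u.length < r^2+1 ∧ (List.replicate d u).flatten <:+: w
  · obtain ⟨u, hu0, hu1, s, t, rfl⟩ := hno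
    have h1 := h u hu0 (by omega)
    have h2 : ((s ++ (List.replicate d u).flatten ++ t).map B).prod = ((s ++ t).map B).prod := by
      simp [List.map_flatten, List.prod_flatten, h1]
    rw [h2]
    refine ih _ ?_ _ rfl
    have : 0 < u.length := List.length_pos_iff.2 hu0
    have := Nat.mul_pos hd this
    rw [← hw]; simp; omega
  · push Not at hno
    have hvw : v <:+: w := by
      obtain ⟨p, w', rfl, -⟩ := hocc
      exact ⟨p, w', by simp⟩
    obtain ⟨j, hj⟩ := tails (r^2+1) d v hv hd (fun u h1 h2 h3 => hno u h1 h2 (h3.trans hvw))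
    obtain ⟨p, y, hpy⟩ := hocc.split j
    have hid := std_identity (fun i => ((v.drop (j i) ++ y i).map B).prod)
    rw [← Finset.add_sum_erase _ _ (Finset.mem_univ 1)] at hid
    have hprod : ∀ σ : Equiv.Perm (Fin (r^2+1)),
        ((p ++ (List.ofFn (fun i => v.drop (j (σ i)) ++ y (σ i))).flatten).map B).prod =
        (p.map B).prod * (List.ofFn (fun i => ((v.drop (j (σ i)) ++ y (σ i)).map B).prod)).prod := by
      intro σ
      simp only [List.map_append, List.prod_append, List.map_flatten, List.prod_flatten,
        List.map_ofFn, Function.comp_def]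
    have hlen : ∀ σ : Equiv.Perm (Fin (r^2+1)),
        (p ++ (List.ofFn (fun i => v.drop (j (σ i)) ++ y (σ i))).flatten).length = ℓ := by
      intro σ
      rw [← hw, hpy]
      simp only [List.length_append, List.length_flatten, List.map_ofFn, List.sum_ofFn]
      congr 1
      exact Equiv.sum_comp σ (fun i => (v.drop (j i) ++ y i).length)
    have hmain : (w.map B).prod = - ∑ σ ∈ Finset.univ.erase (1 : Equiv.Perm (Fin (r^2+1))),
        Equiv.Perm.sign σ •
        ((p ++ (List.ofFn (fun i => v.drop (j (σ i)) ++ y (σ i))).flatten).map B).prod := by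
      simp_rw [hprod, ← mul_smul_comm, ← Finset.mul_sum]
      rw [← mul_neg, ← eq_neg_of_add_eq_zero_left hid, hpy]
      have := hprod 1
      simpa using this
    rw [hmain]
    refine Submodule.neg_mem _ (Submodule.sum_mem _ fun σ hσ => ?_)
    have h3 := perm_lt (fun i => v.drop (j i)) y hj σ (Finset.ne_of_mem_erase hσ)
    have h4 := ihw ⟨_, hlen σ⟩ (by
      show _ < w
      rw [hpy]
      simpa using (h3.app p [] []).lt)
    rw [Units.smul_def]
    exact Submodule.smul_mem _ _ h4
lemma ext_aux {K F₁ F₂ : Type} [Field K] [Countable K] [Field F₁] [Field F₂] [Algebra K F₁]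
    [Algebra K F₂] [IsAlgClosed F₁] [IsAlgClosed F₂] (h1 : Cardinal.aleph0 < Cardinal.mk F₁)
    (h12 : Cardinal.mk F₁ = Cardinal.mk F₂) :
    ∃ σ : F₁ →+* F₂, ∀ x : K, σ (algebraMap K F₁ x) = algebraMap K F₂ x := by
  obtain ⟨s, hs⟩ := exists_isTranscendenceBasis K F₁
  obtain ⟨t, ht⟩ := exists_isTranscendenceBasis K F₂
  have hK : Cardinal.mk K ≤ Cardinal.aleph0 := Cardinal.mk_le_aleph0
  have e1 := IsAlgClosed.cardinal_eq_cardinal_transcendence_basis_of_aleph0_lt' _ hs hK h1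
  have e2 := IsAlgClosed.cardinal_eq_cardinal_transcendence_basis_of_aleph0_lt' _ ht hK (h12 ▸ h1)
  obtain ⟨e⟩ := Cardinal.eq.1 (e1.symm.trans (h12.trans e2))
  let f : Algebra.adjoin K (Set.range ((↑) : s → F₁)) ≃ₐ[K] Algebra.adjoin K (Set.range ((↑) : t → F₂)) :=
    hs.1.aevalEquiv.symm.trans ((MvPolynomial.renameEquiv K e).trans ht.1.aevalEquiv)
  let := IsAlgClosed.isAlgClosure_of_transcendence_basis _ hs
  let := IsAlgClosed.isAlgClosure_of_transcendence_basis _ ht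
  refine ⟨(IsAlgClosure.equivOfEquiv F₁ F₂ f.toRingEquiv).toRingHom, fun x => ?_⟩
  have := IsAlgClosure.equivOfEquiv_algebraMap F₁ F₂ f.toRingEquiv (algebraMap K _ x)
  rw [← IsScalarTower.algebraMap_apply] at this
  refine this.trans ?_
  simp [← IsScalarTower.algebraMap_apply]

lemma ext_embedding {K : Type} [Field K] [Countable K] (ψ φ : K →+* ℂ) :
    ∃ σ : ℂ →+* ℂ, ∀ x, σ (ψ x) = φ x := by
  have h : Cardinal.aleph0 < Cardinal.mk ℂ := by
    rw [Cardinal.mk_complex]; exact Cardinal.aleph0_lt_continuum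
  exact @ext_aux K ℂ ℂ _ _ _ _ ψ.toAlgebra φ.toAlgebra _ _ h rfl

/- traces -/
lemma trace_integral {r : ℕ} (M : Matrix (Fin r) (Fin r) ℂ) (h : IsIntegral ℤ M) :
    IsIntegral ℤ M.trace := by
  rw [Matrix.trace_eq_sum_roots_charpoly]
  refine IsIntegral.multiset_sum fun x hx => ?_
  rw [Polynomial.mem_roots (Matrix.charpoly_monic M).ne_zero] at hx
  obtain ⟨p, hp, hp0⟩ := h
  refine ⟨p, hp, ?_⟩
  have h1 : x ∈ spectrum ℂ M := by
    rw [Matrix.mem_spectrum_iff_isRoot_charpoly]; exact hx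
  have h2 : (p.map (algebraMap ℤ ℂ)).eval x ∈ spectrum ℂ (Polynomial.aeval M (p.map (algebraMap ℤ ℂ))) :=
    spectrum.subset_polynomial_aeval M _ ⟨x, h1, rfl⟩
  rw [Polynomial.aeval_map_algebraMap, Polynomial.aeval_def, hp0] at h2
  rw [← Polynomial.eval_map]
  by_contra hne
  rw [spectrum.mem_iff, sub_zero] at h2
  exact h2 ((IsUnit.mk0 _ hne).map (algebraMap ℂ (Matrix (Fin r) (Fin r) ℂ)))

/-- If a set of matrices is contained in a f.g. `ℤ`-module, has integral traces, and all
conjugates have bounded traces, then it has finitely many traces. -/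
lemma finite_traces {r : ℕ} (Γ : Set (Matrix (Fin r) (Fin r) ℂ)) (F : Set (Matrix (Fin r) (Fin r) ℂ))
    (hF : F.Finite) (hFΓ : F ⊆ Γ) (hspan : ∀ x ∈ Γ, x ∈ Submodule.span ℤ F)
    (hint : ∀ x ∈ Γ, IsIntegral ℤ x)
    (hbd : ∀ σ : ℂ →+* ℂ, ∀ x ∈ Γ, ‖σ x.trace‖ ≤ r) :
    (Matrix.trace '' Γ).Finite := by
  let T : Set ℂ := Matrix.trace '' F
  have hT : T.Finite := hF.image _
  let K := IntermediateField.adjoin ℚ T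
  have hTi : ∀ x ∈ T, IsIntegral ℚ x := by
    rintro _ ⟨x, hx, rfl⟩
    exact (trace_integral x (hint x (hFΓ hx))).tower_top
  have : FiniteDimensional ℚ K := by
    have := hT.to_subtype
    exact IntermediateField.finiteDimensional_adjoin hTi
  have : NumberField K := ⟨⟩
  have : Countable K := (Module.finBasis ℚ K).equivFun.toEquiv.injective.countable
  have hmem : ∀ x ∈ Γ, x.trace ∈ K := by
    suffices H : ∀ x ∈ Submodule.span ℤ F, x.trace ∈ K from fun x hx => H x (hspan x hx)
    intro x h1
    induction h1 using Submodule.span_induction with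
    | mem x h => exact IntermediateField.subset_adjoin ℚ T ⟨x, h, rfl⟩
    | zero => simp
    | add x y _ _ h1 h2 => rw [Matrix.trace_add]; exact add_mem h1 h2
    | smul a x _ h => rw [Matrix.trace_smul]; exact zsmul_mem h a
  refine ((NumberField.Embeddings.finite_of_norm_le K ℂ r).image (algebraMap K ℂ)).subset ?_
  rintro _ ⟨x, hx, rfl⟩
  refine ⟨⟨x.trace, hmem x hx⟩, ⟨?_, fun φ => ?_⟩, rfl⟩
  · have := trace_integral x (hint x hx)
    rw [← isIntegral_algebraMap_iff (algebraMap K ℂ).injective]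
    exact this
  · obtain ⟨σ, hσ⟩ := ext_embedding (algebraMap K ℂ) φ
    rw [← hσ]
    exact hbd σ x hx
section CO
open scoped ComplexOrder

lemma inv_form {r : ℕ} (P : Subgroup (GL (Fin r) ℂ)) (hP : (P : Set (GL (Fin r) ℂ)).Finite) :
    ∃ H : GL (Fin r) ℂ, (H : Matrix (Fin r) (Fin r) ℂ).PosDef ∧ ∀ q ∈ P, star q * H * q = H := by
  have : Finite P := hP
  have := Fintype.ofFinite P
  let h : Matrix (Fin r) (Fin r) ℂ := ∑ p : P, star (p.1 : Matrix (Fin r) (Fin r) ℂ) * (p.1 : Matrix (Fin r) (Fin r) ℂ)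
  have hpos : h.PosDef := by
    refine Matrix.posDef_sum Finset.univ_nonempty fun p _ => ?_
    exact Matrix.PosDef.conjTranspose_mul_self _ (Matrix.mulVec_injective_of_isUnit p.1.isUnit)
  obtain ⟨H, hH⟩ := hpos.isUnit
  refine ⟨H, hH ▸ hpos, fun q hq => Units.ext ?_⟩
  simp only [Units.val_mul, Units.coe_star, hH]
  simp only [h, Finset.mul_sum, Finset.sum_mul]
  refine Fintype.sum_equiv (Equiv.mulRight (⟨q, hq⟩ : P)) _ _ fun p => ?_
  simp [mul_assoc]

def Gs {N r : ℕ} (B : Fin N → GL (Fin r) ℂ) (J : Set (Fin N)) : Subgroup (GL (Fin r) ℂ) :=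
  Subgroup.closure (B '' J)

lemma Gs_mono {N r : ℕ} (B : Fin N → GL (Fin r) ℂ) {J J' : Set (Fin N)} (h : J ⊆ J') :
    Gs B J ≤ Gs B J' := Subgroup.closure_mono (Set.image_mono h)

def Good {N r : ℕ} (B : Fin N → GL (Fin r) ℂ) (u v : Fin N) : Prop :=
  (∀ u, (Gs B {u}ᶜ : Set (GL (Fin r) ℂ)).Finite) ∧ u ≠ v ∧
    ∀ j, (B j : Matrix (Fin r) (Fin r) ℂ) ∈
      Submodule.span ℂ (Units.val '' (Gs B {u, v}ᶜ : Set (GL (Fin r) ℂ)))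

lemma Good.finite_uv {N r : ℕ} {B : Fin N → GL (Fin r) ℂ} {u v : Fin N} (h : Good B u v) :
    (Gs B {u, v}ᶜ : Set (GL (Fin r) ℂ)).Finite :=
  (h.1 u).subset (Gs_mono B (by simp))

lemma Good.form {N r : ℕ} {B : Fin N → GL (Fin r) ℂ} {u v : Fin N} (h : Good B u v) :
    ∃ H : GL (Fin r) ℂ, (H : Matrix (Fin r) (Fin r) ℂ).PosDef ∧
      ∀ q ∈ Subgroup.closure (Set.range B), star q * H * q = H := by
  obtain ⟨H, hH, hHP⟩ := inv_form _ h.finite_uv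
  have key : ∀ z, z ∈ ({u, v} : Set (Fin N)) → ∀ j, j ≠ z → star (B j) * H * B j = H := by
    intro z hz j hj
    obtain ⟨H', -, hHP'⟩ := inv_form _ (h.1 z)
    have hle : Gs B {u, v}ᶜ ≤ Gs B {z}ᶜ := Gs_mono B (by simpa using hz)
    have hX : ∀ p ∈ Gs B {u, v}ᶜ, Commute (H⁻¹ * H') p := by
      intro p hp
      have e1 := hHP p hp
      have e2 := hHP' p (hle hp)
      have e3 : p = H⁻¹ * (star p)⁻¹ * H := by
        rw [eq_comm, mul_assoc, inv_mul_eq_iff_eq_mul, inv_mul_eq_iff_eq_mul, ← e1]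
        simp only [e1, ← mul_assoc]
      have e4 : H' * p = (star p)⁻¹ * H' := by
        rw [eq_inv_mul_iff_mul_eq, ← mul_assoc, e2]
      show H⁻¹ * H' * p = p * (H⁻¹ * H')
      conv_rhs => rw [e3]
      rw [mul_assoc, e4]; group
    have hXj : Commute (H⁻¹ * H') (B j) := by
      have : Commute ((H⁻¹ * H' : GL (Fin r) ℂ) : Matrix (Fin r) (Fin r) ℂ) (B j) := by
        have hj := h.2.2 j
        generalize (B j : Matrix (Fin r) (Fin r) ℂ) = y at hj ⊢
        induction hj using Submodule.span_induction with
        | mem x hx =>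
          obtain ⟨p, hp, rfl⟩ := hx
          exact (hX p hp).map (Units.coeHom _)
        | zero => exact Commute.zero_right _
        | add x y _ _ h1 h2 => exact h1.add_right h2
        | smul a x _ h => exact h.smul_right a
      exact Units.ext this
    have e := hHP' (B j) (Subgroup.subset_closure ⟨j, by simpa using hj, rfl⟩)
    have e' : H * (H⁻¹ * H') = H' := by group
    rw [← e'] at e
    have e2 : star (B j) * H * B j * (H⁻¹ * H') = H * (H⁻¹ * H') := by
      rw [mul_assoc, ← hXj.eq]
      rw [← e]; group
    exact mul_right_cancel e2
  refine ⟨H, hH, fun q hq => ?_⟩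
  induction hq using Subgroup.closure_induction with
  | mem x hx =>
    obtain ⟨j, rfl⟩ := hx
    by_cases hju : j = u
    · exact key v (by simp) j (hju ▸ h.2.1)
    · exact key u (by simp) j hju
  | one => simp
  | mul x y _ _ hx hy =>
    rw [star_mul]
    calc _ = star y * (star x * H * x) * y := by group
      _ = H := by rw [hx, hy]
  | inv x _ hx =>
    rw [star_inv]
    nth_rw 1 [← hx]
    group

open scoped MatrixOrder Matrix.Norms.L2Operator in
lemma psd_fac {r : ℕ} {M : Matrix (Fin r) (Fin r) ℂ} (h : M.PosSemidef) :
    ∃ a : Matrix (Fin r) (Fin r) ℂ, M = star a * a :=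
  CStarAlgebra.nonneg_iff_eq_star_mul_self.mp h.nonneg

lemma Good.unitarize {N r : ℕ} {B : Fin N → GL (Fin r) ℂ} {u v : Fin N} (h : Good B u v) :
    ∃ S : GL (Fin r) ℂ, ∀ q ∈ Subgroup.closure (Set.range B),
      star (S * q * S⁻¹) = (S * q * S⁻¹)⁻¹ := by
  obtain ⟨H, hH, hq⟩ := h.form
  obtain ⟨a, ha⟩ := psd_fac hH.posSemidef
  have hu : IsUnit a := by
    have : IsUnit (star a * a) := ha ▸ H.isUnit
    rw [Matrix.isUnit_iff_isUnit_det] at this ⊢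
    rw [Matrix.det_mul] at this
    exact isUnit_of_mul_isUnit_right this
  obtain ⟨S, rfl⟩ := hu
  have hS : H = star S * S := Units.ext ha
  refine ⟨S, fun q hq' => ?_⟩
  have e := hq q hq'
  rw [hS] at e
  rw [eq_inv_iff_mul_eq_one, star_mul, star_mul, star_inv]
  calc _ = (star S)⁻¹ * (star q * (star S * S) * q) * S⁻¹ := by group
    _ = 1 := by rw [e]; group

lemma Good.trace_le {N r : ℕ} {B : Fin N → GL (Fin r) ℂ} {u v : Fin N} (h : Good B u v)
    (q) (hq : q ∈ Subgroup.closure (Set.range B)) :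
    ‖(q : Matrix (Fin r) (Fin r) ℂ).trace‖ ≤ r := by
  obtain ⟨S, hS⟩ := h.unitarize
  have h1 := hS q hq
  have h2 : (q : Matrix (Fin r) (Fin r) ℂ).trace = ((S * q * S⁻¹ : GL (Fin r) ℂ) : Matrix (Fin r) (Fin r) ℂ).trace := by
    rw [Units.val_mul, Matrix.trace_mul_comm, ← Units.val_mul]; congr 2; group
  have h3 : ((S * q * S⁻¹ : GL (Fin r) ℂ) : Matrix (Fin r) (Fin r) ℂ) ∈ Matrix.unitaryGroup (Fin r) ℂ := by
    rw [Matrix.mem_unitaryGroup_iff']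
    rw [← Units.coe_star, h1, Units.inv_mul]
  rw [h2, Matrix.trace]
  refine (norm_sum_le _ _).trans ?_
  refine (Finset.sum_le_sum fun i _ => entry_norm_bound_of_unitary h3 i i).trans ?_
  simp

lemma Gs_map {N r : ℕ} (B : Fin N → GL (Fin r) ℂ) (f : GL (Fin r) ℂ →* GL (Fin r) ℂ) (J : Set (Fin N)) :
    Gs (fun j => f (B j)) J = (Gs B J).map f := by
  rw [Gs, Gs, MonoidHom.map_closure, Set.image_image]

lemma Good.map {N r : ℕ} {B : Fin N → GL (Fin r) ℂ} {u v : Fin N} (h : Good B u v)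
    (σ : ℂ →+* ℂ) : Good (fun j => Matrix.GeneralLinearGroup.map σ (B j)) u v := by
  refine ⟨fun u => ?_, h.2.1, fun j => ?_⟩
  · rw [Gs_map]; exact (h.1 u).image _
  · rw [Gs_map]
    have : ∀ x : Matrix (Fin r) (Fin r) ℂ,
        x ∈ Submodule.span ℂ (Units.val '' (Gs B {u, v}ᶜ : Set (GL (Fin r) ℂ))) →
        x.map σ ∈ Submodule.span ℂ (Units.val '' (((Gs B {u, v}ᶜ).map (Matrix.GeneralLinearGroup.map σ) :
          Subgroup (GL (Fin r) ℂ)) : Set (GL (Fin r) ℂ))) := by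
      intro x hx
      induction hx using Submodule.span_induction with
      | mem x hx =>
        obtain ⟨p, hp, rfl⟩ := hx
        exact Submodule.subset_span ⟨_, ⟨p, hp, rfl⟩, rfl⟩
      | zero => simp
      | add x y _ _ h1 h2 => rw [Matrix.map_add _ (map_add σ)]; exact add_mem h1 h2
      | smul a x _ h =>
        have : (a • x).map σ = σ a • x.map σ := by ext; simp
        rw [this]; exact Submodule.smul_mem _ _ h
    exact this _ (h.2.2 j)

lemma Good.trace_le_map {N r : ℕ} {B : Fin N → GL (Fin r) ℂ} {u v : Fin N} (h : Good B u v)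
    (σ : ℂ →+* ℂ) (q) (hq : q ∈ Subgroup.closure (Set.range B)) :
    ‖σ (q : Matrix (Fin r) (Fin r) ℂ).trace‖ ≤ r := by
  have := (h.map σ).trace_le (Matrix.GeneralLinearGroup.map σ q) (by
    have : Set.range (fun j => Matrix.GeneralLinearGroup.map σ (B j)) =
      Matrix.GeneralLinearGroup.map σ '' Set.range B := by
        rw [← Set.range_comp]; rfl
    rw [this, ← MonoidHom.map_closure]
    exact ⟨q, hq, rfl⟩)
  convert this using 2
  simp [Matrix.trace, map_sum]

lemma Good.finite {N r : ℕ} {B : Fin N → GL (Fin r) ℂ} {u v : Fin N} (h : Good B u v)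
    (hN : r ^ 2 < N) :
    ((Subgroup.closure (Set.range B) : Subgroup (GL (Fin r) ℂ)) : Set (GL (Fin r) ℂ)).Finite := by
  -- uniform exponent
  have hcop : ∀ J : Set (Fin N), J ≠ Set.univ → (Gs B J : Set (GL (Fin r) ℂ)).Finite := by
    intro J hJ
    obtain ⟨z, hz⟩ := (Set.ne_univ_iff_exists_notMem J).1 hJ
    exact (h.1 z).subset (Gs_mono B (by simpa using hz))
  let d := ∏ z : Fin N, Nat.card (Gs B {z}ᶜ)
  have hd : 0 < d := Finset.prod_pos fun z _ => by
    have : Finite (Gs B {z}ᶜ) := h.1 z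
    exact Nat.card_pos
  have hpow : ∀ z, ∀ q ∈ Gs B {z}ᶜ, q ^ d = 1 := by
    intro z q hq
    have h1 : (⟨q, hq⟩ : Gs B {z}ᶜ) ^ Nat.card (Gs B {z}ᶜ) = 1 := pow_card_eq_one'
    have h2 : q ^ Nat.card (Gs B {z}ᶜ) = 1 := congrArg Subtype.val h1
    obtain ⟨c, hc⟩ : Nat.card (Gs B {z}ᶜ) ∣ d := Finset.dvd_prod_of_mem _ (Finset.mem_univ z)
    rw [hc, pow_mul, h2, one_pow]
  have hevalU : ∀ w : List (Fin N), (w.map (fun j => (B j : Matrix (Fin r) (Fin r) ℂ))).prod =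
      ((w.map B).prod : GL (Fin r) ℂ) := by
    intro w
    have := map_list_prod (Units.coeHom (Matrix (Fin r) (Fin r) ℂ)) (w.map B)
    rw [List.map_map] at this
    exact this.symm
  have hmemw : ∀ w : List (Fin N), (w.map B).prod ∈ Gs B {z | z ∈ w} := by
    intro w
    refine Subgroup.list_prod_mem _ fun x hx => ?_
    obtain ⟨z, hz, rfl⟩ := List.mem_map.1 hx
    exact Subgroup.subset_closure ⟨z, hz, rfl⟩
  obtain ⟨L, hL⟩ := shirshov (r := r) hd (fun j => (B j : Matrix (Fin r) (Fin r) ℂ)) (by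
    intro w _ hw
    rw [hevalU, ← Units.val_pow_eq_pow_val, ← Units.val_one]
    congr 1
    obtain ⟨z, hz⟩ : ∃ z, z ∉ w := by
      by_contra! hc
      have h1 : (Finset.univ : Finset (Fin N)) ⊆ w.toFinset := fun z _ => by simpa using hc z
      have h2 := Finset.card_le_card h1
      have h3 := w.toFinset_card_le
      simp at h2
      omega
    exact hpow z _ (Gs_mono B (by intro a ha; simp; rintro rfl; exact hz ha) (hmemw w)))
  -- elements are words
  have hword : ∀ q ∈ Subgroup.closure (Set.range B), ∃ w : List (Fin N), q = (w.map B).prod := by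
    have hfo : ∀ x ∈ Set.range B, IsOfFinOrder x := by
      rintro _ ⟨j, rfl⟩
      rw [isOfFinOrder_iff_pow_eq_one]
      obtain ⟨z, hz⟩ : ∃ z, j ≠ z := by
        by_cases hj : j = u
        · exact ⟨v, hj ▸ h.2.1⟩
        · exact ⟨u, hj⟩
      exact ⟨d, hd, hpow z _ (Subgroup.subset_closure ⟨j, by simpa using hz, rfl⟩)⟩
    intro q hq
    rw [← Subgroup.mem_toSubmonoid, Subgroup.closure_toSubmonoid_of_isOfFinOrder hfo] at hq
    obtain ⟨l, hl, rfl⟩ := Submonoid.exists_list_of_mem_closure hq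
    clear hq
    induction l with
    | nil => exact ⟨[], by simp⟩
    | cons x l ih =>
      obtain ⟨w, hw⟩ := ih (fun y hy => hl y (by simp [hy]))
      obtain ⟨j, hj⟩ := hl x (by simp)
      exact ⟨j :: w, by simp [hw, hj]⟩
  let Γ : Set (Matrix (Fin r) (Fin r) ℂ) := Units.val '' (Subgroup.closure (Set.range B) : Set (GL (Fin r) ℂ))
  let F : Set (Matrix (Fin r) (Fin r) ℂ) :=
    (fun w : List (Fin N) => (w.map (fun j => (B j : Matrix (Fin r) (Fin r) ℂ))).prod) '' {w | w.length < L}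
  have hF : F.Finite := (List.finite_length_lt (Fin N) L).image _
  have hFΓ : F ⊆ Γ := by
    rintro _ ⟨w, -, rfl⟩
    refine ⟨(w.map B).prod, ?_, (hevalU w).symm⟩
    exact Subgroup.closure_mono (Set.image_subset_range _ _) (hmemw w)
  have hspan : ∀ x ∈ Γ, x ∈ Submodule.span ℤ F := by
    rintro _ ⟨q, hq, rfl⟩
    obtain ⟨w, rfl⟩ := hword q hq
    rw [← hevalU]
    exact hL w
  have hint : ∀ x ∈ Γ, IsIntegral ℤ x := by
    let M : Submonoid (Matrix (Fin r) (Fin r) ℂ) :=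
      (Subgroup.closure (Set.range B)).toSubmonoid.map (Units.coeHom _)
    have hM : (M : Set (Matrix (Fin r) (Fin r) ℂ)) = Γ := rfl
    intro x hx
    refine IsIntegral.of_mem_of_fg (Algebra.adjoin ℤ Γ) ?_ x (Algebra.subset_adjoin hx)
    rw [Algebra.adjoin_eq_span, ← hM, Submonoid.closure_eq, hM]
    have : Submodule.span ℤ Γ = Submodule.span ℤ F :=
      le_antisymm (Submodule.span_le.2 hspan) (Submodule.span_mono hFΓ)
    rw [this]
    exact Submodule.fg_span hF
  have hT := finite_traces Γ F hF hFΓ hspan hint (by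
    rintro σ _ ⟨q, hq, rfl⟩
    exact h.trace_le_map σ q hq)
  -- conclude
  let P := Gs B {u, v}ᶜ
  have hPle : P ≤ Subgroup.closure (Set.range B) := Subgroup.closure_mono (Set.image_subset_range _ _)
  have hPfin : Finite P := h.finite_uv
  obtain ⟨S, hS⟩ := h.unitarize
  have hsp : ∀ q ∈ Subgroup.closure (Set.range B), (q : Matrix (Fin r) (Fin r) ℂ) ∈
      Submodule.span ℂ (Units.val '' (P : Set (GL (Fin r) ℂ))) := by
    intro q hq
    obtain ⟨w, rfl⟩ := hword q hq
    rw [← hevalU]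
    let M : Submonoid (Matrix (Fin r) (Fin r) ℂ) := P.toSubmonoid.map (Units.coeHom _)
    have e : Subalgebra.toSubmodule (Algebra.adjoin ℂ (M : Set (Matrix (Fin r) (Fin r) ℂ))) =
        Submodule.span ℂ (Units.val '' (P : Set (GL (Fin r) ℂ))) := by
      rw [Algebra.adjoin_eq_span, Submonoid.closure_eq]; rfl
    rw [← e]
    refine Subalgebra.list_prod_mem _ fun x hx => ?_
    obtain ⟨j, -, rfl⟩ := List.mem_map.1 hx
    rw [← Subalgebra.mem_toSubmodule, e]
    exact h.2.2 j
  have hadj : ∀ x ∈ Submodule.span ℂ (Units.val '' (P : Set (GL (Fin r) ℂ))),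
      ∃ y ∈ Submodule.span ℂ (Units.val '' (P : Set (GL (Fin r) ℂ))),
        star (S.1 * x * S⁻¹.1) = S.1 * y * S⁻¹.1 := by
    intro x hx
    induction hx using Submodule.span_induction with
    | mem x hx =>
      obtain ⟨p, hp, rfl⟩ := hx
      refine ⟨(p⁻¹ : GL (Fin r) ℂ), Submodule.subset_span ⟨p⁻¹, P.inv_mem hp, rfl⟩, ?_⟩
      have := congrArg Units.val (hS p (hPle hp))
      rw [Units.coe_star] at this
      simp only [Units.val_mul] at this
      rw [this, ← Units.val_mul, ← Units.val_mul]
      congr 1; group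
    | zero => exact ⟨0, zero_mem _, by simp⟩
    | add x y _ _ h1 h2 =>
      obtain ⟨x', hx', ex⟩ := h1
      obtain ⟨y', hy', ey⟩ := h2
      exact ⟨x' + y', add_mem hx' hy', by rw [mul_add, add_mul, star_add, ex, ey, mul_add, add_mul]⟩
    | smul a x _ h =>
      obtain ⟨x', hx', ex⟩ := h
      exact ⟨star a • x', Submodule.smul_mem _ _ hx', by
        rw [Matrix.mul_smul, Matrix.smul_mul, star_smul, ex, Matrix.mul_smul, Matrix.smul_mul]⟩
  have hnd : ∀ x ∈ Submodule.span ℂ (Units.val '' (P : Set (GL (Fin r) ℂ))),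
      (∀ p : P, (x * (p.1 : Matrix (Fin r) (Fin r) ℂ)).trace = 0) → x = 0 := by
    intro x hx hx0
    have h1 : ∀ y ∈ Submodule.span ℂ (Units.val '' (P : Set (GL (Fin r) ℂ))), (x * y).trace = 0 := by
      intro y hy
      induction hy using Submodule.span_induction with
      | mem y hy => obtain ⟨p, hp, rfl⟩ := hy; exact hx0 ⟨p, hp⟩
      | zero => simp
      | add y z _ _ h1 h2 => rw [mul_add, Matrix.trace_add, h1, h2, add_zero]
      | smul a y _ h => rw [Matrix.mul_smul, Matrix.trace_smul, h, smul_zero]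
    obtain ⟨y, hy, e⟩ := hadj x hx
    have h2 : ((S.1 * x * S⁻¹.1) * star (S.1 * x * S⁻¹.1)).trace = 0 := by
      rw [e]
      have : S.1 * x * S⁻¹.1 * (S.1 * y * S⁻¹.1) = S.1 * (x * y) * S⁻¹.1 := by
        simp only [mul_assoc, Units.inv_mul_cancel_left]
      rw [this, Matrix.trace_mul_comm, ← mul_assoc, Units.inv_mul, one_mul, h1 y hy]
    rw [Matrix.star_eq_conjTranspose, Matrix.trace_mul_conjTranspose_self_eq_zero_iff] at h2
    have h3 : S.1 * x = 0 := by
      have := congrArg (· * S.1) h2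
      simpa [mul_assoc] using this
    have := congrArg (S⁻¹.1 * ·) h3
    simpa [← mul_assoc] using this
  let Φ : GL (Fin r) ℂ → (P → ℂ) := fun q p => ((q * p.1 : GL (Fin r) ℂ) : Matrix (Fin r) (Fin r) ℂ).trace
  refine Set.Finite.of_finite_image (f := Φ) ?_ ?_
  · refine (Set.Finite.pi' (fun _ : P => hT)).subset ?_
    rintro _ ⟨q, hq, rfl⟩ p
    exact ⟨_, ⟨q * p.1, mul_mem hq (hPle p.2), rfl⟩, rfl⟩
  · intro q hq q' hq' hqq
    have := hnd (q.1 - q'.1) (sub_mem (hsp q hq) (hsp q' hq')) (fun p => by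
      rw [sub_mul, Matrix.trace_sub, sub_eq_zero]
      exact congrFun hqq p)
    exact Units.ext (sub_eq_zero.1 this)

end CO

lemma Reach.trans {N r : ℕ} {h2 : 2 ≤ N} {A B C : Fin N → GL (Fin r) ℂ} (h : Reach h2 A B)
    (h' : Reach h2 B C) : Reach h2 A C := by
  induction h' with
  | base => exact h
  | cyc _ ih => exact ih.cyc
  | swap _ ih => exact ih.swap
  | inv _ ih => exact ih.inv
  | dehn _ ih => exact ih.dehn

lemma reach_perm {N r : ℕ} (h2 : 2 ≤ N) (B : Fin N → GL (Fin r) ℂ) (σ : Equiv.Perm (Fin N)) :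
    Reach h2 B (B ∘ σ) := by
  obtain ⟨n, rfl⟩ : ∃ n, N = n + 2 := ⟨N - 2, by omega⟩
  let M : Submonoid (Equiv.Perm (Fin (n + 2))) :=
    { carrier := {σ | ∀ B : Fin (n + 2) → GL (Fin r) ℂ, Reach h2 B (B ∘ σ)}
      one_mem' := fun B => Reach.base
      mul_mem' := fun {x y} hx hy B => (hx B).trans (hy (B ∘ x)) }
  have hrot : finRotate (n + 2) ∈ M := by
    intro B
    have : B ∘ finRotate (n + 2) = opCyc B := by
      funext i
      simp only [Function.comp, opCyc]
      congr 1
      ext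
      simp [Fin.val_add]
    rw [this]; exact Reach.base.cyc
  have hsw : Equiv.swap 0 (finRotate (n + 2) 0) ∈ M := by
    intro B
    have : B ∘ Equiv.swap 0 (finRotate (n + 2) 0) = opSwap h2 B := by
      funext i
      simp only [Function.comp, opSwap]
      have e : finRotate (n + 2) 0 = 1 := by simp
      rw [e]
      split_ifs with h0 h1
      · have : i = 0 := Fin.ext h0
        subst this
        rw [Equiv.swap_apply_left]; rfl
      · have : i = 1 := Fin.ext h1
        subst this
        rw [Equiv.swap_apply_right]; rfl
      · rw [Equiv.swap_apply_of_ne_of_ne]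
        · exact fun h => h0 (by simp [h])
        · exact fun h => h1 (by simp [h])
    rw [this]; exact Reach.base.swap
  have htop := Equiv.Perm.closure_cycle_adjacent_swap (isCycle_finRotate (n := n))
    support_finRotate 0
  have hσ : σ ∈ Subgroup.closure {finRotate (n + 2), Equiv.swap 0 (finRotate (n + 2) 0)} := by
    rw [htop]; trivial
  rw [← Subgroup.mem_toSubmonoid, Subgroup.closure_toSubmonoid_of_finite] at hσ
  have hle : Submonoid.closure {finRotate (n + 2), Equiv.swap 0 (finRotate (n + 2) 0)} ≤ M := by
    rw [Submonoid.closure_le]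
    rintro x (rfl | rfl)
    · exact hrot
    · exact hsw
  exact hle hσ B

lemma reach_mul {N r : ℕ} (h2 : 2 ≤ N) (B : Fin N → GL (Fin r) ℂ) {i j : Fin N} (hij : i ≠ j) :
    Reach h2 B (Function.update B i (B i * B j)) := by
  let a : Fin N := ⟨0, by omega⟩
  let b : Fin N := ⟨1, by omega⟩
  have hab : a ≠ b := by simp [a, b]
  let σ : Equiv.Perm (Fin N) := Equiv.swap a i * Equiv.swap b (Equiv.swap a i j)
  have hk : Equiv.swap a i j ≠ a := by
    intro h
    rw [Equiv.swap_apply_eq_iff, Equiv.swap_apply_left] at h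
    exact hij h.symm
  have h0 : σ a = i := by
    simp only [σ, Equiv.Perm.mul_apply]
    rw [Equiv.swap_apply_of_ne_of_ne hab hk.symm, Equiv.swap_apply_left]
  have h1 : σ b = j := by
    simp only [σ, Equiv.Perm.mul_apply]
    rw [Equiv.swap_apply_left, Equiv.swap_apply_self]
  have e : opDehn h2 (B ∘ σ) ∘ σ.symm = Function.update B i (B i * B j) := by
    funext k
    simp only [Function.comp, opDehn, Function.update_apply]
    have : ((σ.symm k).val = 0) ↔ k = i := by
      rw [← h0, ← Equiv.symm_apply_eq]
      exact ⟨fun h => Fin.ext h, fun h => by rw [h]⟩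
    by_cases hki : k = i
    · rw [if_pos (this.2 hki), if_pos hki]
      rw [Equiv.apply_symm_apply]
      subst hki
      congr 2
    · rw [if_neg (fun h => hki (this.1 h)), if_neg hki, Equiv.apply_symm_apply]
  rw [← e]
  exact ((reach_perm h2 B σ).dehn).trans (reach_perm h2 _ _)

lemma reach_word {N r : ℕ} (h2 : 2 ≤ N) (B : Fin N → GL (Fin r) ℂ) (i : Fin N)
    (w : GL (Fin r) ℂ) (hw : w ∈ Submonoid.closure (B '' {i}ᶜ)) :
    Reach h2 B (Function.update B i (B i * w)) := by
  induction hw using Submonoid.closure_induction_right with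
  | one => simpa using Reach.base
  | mul_right x _ y hy ih =>
    obtain ⟨j, hj, rfl⟩ := hy
    have hji : j ≠ i := hj
    have := ih.trans (reach_mul h2 _ hji.symm)
    simpa [hji, mul_assoc] using this

/-- algebra generated by part of a tuple -/
def Ad {N r : ℕ} (B : Fin N → GL (Fin r) ℂ) (I : Set (Fin N)) :
    Subalgebra ℂ (Matrix (Fin r) (Fin r) ℂ) :=
  Algebra.adjoin ℂ ((fun j => (B j : Matrix (Fin r) (Fin r) ℂ)) '' I)

lemma Ad_mono {N r : ℕ} (B : Fin N → GL (Fin r) ℂ) {I J : Set (Fin N)} (h : I ⊆ J) :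
    Ad B I ≤ Ad B J := Algebra.adjoin_mono (Set.image_mono h)

lemma mem_Ad {N r : ℕ} (B : Fin N → GL (Fin r) ℂ) {I : Set (Fin N)} {j} (h : j ∈ I) :
    (B j : Matrix (Fin r) (Fin r) ℂ) ∈ Ad B I := Algebra.subset_adjoin ⟨j, h, rfl⟩

lemma Ad_congr {N r : ℕ} {B C : Fin N → GL (Fin r) ℂ} {I : Set (Fin N)}
    (h : ∀ i ∈ I, B i = C i) : Ad B I = Ad C I := by
  unfold Ad
  congr 1
  exact Set.image_congr fun i hi => by rw [h i hi]

lemma Ad_commute {N r : ℕ} (B : Fin N → GL (Fin r) ℂ) (I : Set (Fin N))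
    (X : Matrix (Fin r) (Fin r) ℂ) (hX : ∀ j ∈ I, Commute X (B j)) :
    ∀ y ∈ Ad B I, Commute X y := by
  intro y hy
  unfold Ad at hy
  induction hy using Algebra.adjoin_induction with
  | mem y hy => obtain ⟨j, hj, rfl⟩ := hy; exact hX j hj
  | algebraMap c => exact (Algebra.commutes c X).symm
  | add y z _ _ h1 h2 => exact h1.add_right h2
  | mul y z _ _ h1 h2 => exact h1.mul_right h2

lemma redundant_finite {N r : ℕ} (h2 : 2 ≤ N) (B : Fin N → GL (Fin r) ℂ)
    (s : Set (Fin N → GL (Fin r) ℂ)) (hs : s.Finite)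
    (hcl : ∀ C, Reach h2 B C → ∃ B' ∈ s, TupleConj C B') (u : Fin N)
    (hu : (B u : Matrix (Fin r) (Fin r) ℂ) ∈ Ad B {u}ᶜ) :
    (Gs B {u}ᶜ : Set (GL (Fin r) ℂ)).Finite := by
  have hfin : (Submonoid.closure (B '' {u}ᶜ) : Set (GL (Fin r) ℂ)).Finite := by
    have hch : ∀ w : Submonoid.closure (B '' {u}ᶜ), ∃ B' : s,
        TupleConj (Function.update B u (B u * w.1)) B' := by
      intro w
      obtain ⟨B', hB', h⟩ := hcl _ (reach_word h2 B u w.1 w.2)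
      exact ⟨⟨B', hB'⟩, h⟩
    choose f hf using hch
    have : Finite s := hs
    have hinj : Function.Injective f := by
      intro w w' hww
      obtain ⟨C1, h1⟩ := hf w
      obtain ⟨C2, h2⟩ := hf w'
      rw [← hww] at h2
      have hX : ∀ j, Function.update B u (B u * w.1) j * (C1 * C2⁻¹) =
          (C1 * C2⁻¹) * Function.update B u (B u * w'.1) j := by
        intro j; rw [h1, h2]; group
      have hc : ∀ j, j ≠ u → Commute (C1 * C2⁻¹) (B j) := by
        intro j hj
        have := hX j
        rw [Function.update_of_ne hj, Function.update_of_ne hj] at this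
        exact this.symm
      have hcu : Commute (C1 * C2⁻¹) (B u) := by
        apply Units.ext
        exact Ad_commute B {u}ᶜ (C1 * C2⁻¹ : GL (Fin r) ℂ).1
          (fun j hj => (hc j hj).map (Units.coeHom _)) _ hu
      have hcw : Commute (C1 * C2⁻¹) w'.1 := by
        have := w'.2
        generalize w'.1 = y at this ⊢
        induction this using Submonoid.closure_induction with
        | mem x hx => obtain ⟨j, hj, rfl⟩ := hx; exact hc j hj
        | one => exact Commute.one_right _
        | mul x y _ _ h1 h2 => exact h1.mul_right h2
      have e := hX u
      rw [Function.update_self, Function.update_self, (hcu.mul_right hcw).eq] at e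
      exact Subtype.ext (mul_left_cancel (mul_right_cancel e))
    exact Finite.of_injective f hinj
  have hfo : ∀ x ∈ B '' {u}ᶜ, IsOfFinOrder x := by
    intro x hx
    have hsub : (Set.range fun n : ℕ => x ^ n) ⊆ Submonoid.closure (B '' {u}ᶜ) := by
      rintro _ ⟨n, rfl⟩
      exact pow_mem (Submonoid.subset_closure hx) n
    have := hfin.subset hsub
    by_contra hno
    exact Set.infinite_range_of_injective (injective_pow_iff_not_isOfFinOrder.2 hno) this
  have e := Subgroup.closure_toSubmonoid_of_isOfFinOrder hfo
  have e2 : (Gs B {u}ᶜ : Set (GL (Fin r) ℂ)) = (Submonoid.closure (B '' {u}ᶜ) : Set (GL (Fin r) ℂ)) := by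
    rw [← e]; rfl
  rw [e2]; exact hfin

lemma Ad_cancel {N r : ℕ} (B : Fin N → GL (Fin r) ℂ) (I : Set (Fin N)) (x y : GL (Fin r) ℂ)
    (hx : x.1 ∈ Ad B I) (hxy : x.1 * y.1 ∈ Ad B I) : y.1 ∈ Ad B I := by
  let f : Ad B I →ₗ[ℂ] Ad B I := LinearMap.mulLeft ℂ (⟨x.1, hx⟩ : Ad B I)
  have hf : Function.Injective f := by
    intro a b hab
    have : x.1 * a.1 = x.1 * b.1 := congrArg Subtype.val hab
    exact Subtype.ext ((Units.mul_right_inj x).1 this)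
  obtain ⟨z, hz⟩ := LinearMap.injective_iff_surjective.1 hf ⟨_, hxy⟩
  have : x.1 * z.1 = x.1 * y.1 := congrArg Subtype.val hz
  rw [← (Units.mul_right_inj x).1 this]
  exact z.2

/-- configurations -/
def Cfg {N r : ℕ} (B : Fin N → GL (Fin r) ℂ) (I I' : Finset (Fin N)) : Prop :=
  Disjoint I I' ∧ I.card + 1 ≤ Module.finrank ℂ (Ad B I) ∧ I'.card + 1 ≤ Module.finrank ℂ (Ad B I')

lemma Cfg.symm {N r : ℕ} {B : Fin N → GL (Fin r) ℂ} {I I' : Finset (Fin N)} (h : Cfg B I I') :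
    Cfg B I' I := ⟨h.1.symm, h.2.2, h.2.1⟩

lemma Cfg.congr {N r : ℕ} {B C : Fin N → GL (Fin r) ℂ} {I I' : Finset (Fin N)} (h : Cfg B I I')
    (h1 : ∀ i ∈ I, B i = C i) (h2 : ∀ i ∈ I', B i = C i) : Cfg C I I' := by
  refine ⟨h.1, ?_, ?_⟩
  · rw [← Ad_congr (B := B) h1]; exact h.2.1
  · rw [← Ad_congr (B := B) h2]; exact h.2.2

lemma Cfg.ins {N r : ℕ} {B : Fin N → GL (Fin r) ℂ} {I I' : Finset (Fin N)} (h : Cfg B I I')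
    {t : Fin N} (ht : t ∉ I) (ht' : t ∉ I') (hn : (B t).1 ∉ Ad B I) :
    Cfg B (insert t I) I' := by
  refine ⟨?_, ?_, h.2.2⟩
  · rw [Finset.disjoint_insert_left]; exact ⟨ht', h.1⟩
  · rw [Finset.card_insert_of_notMem ht]
    have hlt : Subalgebra.toSubmodule (Ad B I) < Subalgebra.toSubmodule (Ad B (insert t I : Finset (Fin N))) := by
      refine lt_of_le_of_ne (Ad_mono B (by simp)) fun e => hn ?_
      have := mem_Ad B (I := (insert t I : Finset (Fin N))) (j := t) (by simp)
      rw [← Subalgebra.mem_toSubmodule, ← e] at this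
      exact this
    have := Submodule.finrank_lt_finrank_of_lt hlt
    have h1 := h.2.1
    simp only [Subalgebra.finrank_toSubmodule] at this
    omega

lemma Cfg.le {N r : ℕ} {B : Fin N → GL (Fin r) ℂ} {I I' : Finset (Fin N)} (h : Cfg B I I') :
    I.card + I'.card + 2 ≤ 2 * r ^ 2 := by
  have key : ∀ J : Set (Fin N), Module.finrank ℂ (Ad B J) ≤ r ^ 2 := by
    intro J
    have := Submodule.finrank_le (Subalgebra.toSubmodule (Ad B J))
    rw [Module.finrank_matrix] at this
    simpa [sq] using this
  have h1 := h.2.1.trans (key _)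
  have h2 := h.2.2.trans (key _)
  omega

lemma exists_good {N r : ℕ} (h2 : 2 ≤ N) (hr : 1 ≤ r) (hN : 2 * r ^ 2 ≤ N)
    (A : Fin N → GL (Fin r) ℂ) (s : Set (Fin N → GL (Fin r) ℂ)) (hs : s.Finite)
    (hcl : ∀ B, Reach h2 A B → ∃ B' ∈ s, TupleConj B B') :
    ∃ B u v, Reach h2 A B ∧ Good B u v := by
  classical
  let K : Set ℕ := {k | ∃ B I I', Reach h2 A B ∧ Cfg B I I' ∧ k = I.card + I'.card}
  have hne : K.Nonempty := by
    refine ⟨0, A, ∅, ∅, Reach.base, ⟨by simp, ?_, ?_⟩, by simp⟩ <;>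
    · have : Nonempty (Fin r) := ⟨⟨0, hr⟩⟩
      have e : Ad A ((∅ : Finset (Fin N)) : Set (Fin N)) = ⊥ := by
        rw [Ad, Finset.coe_empty, Set.image_empty, Algebra.adjoin_empty]
      rw [e, Subalgebra.finrank_bot]
      simp
  have hbd : BddAbove K := by
    refine ⟨2 * r ^ 2, ?_⟩
    rintro k ⟨B, I, I', -, h, rfl⟩
    have := h.le
    omega
  obtain ⟨B, I, I', hB, hc, hk⟩ := Nat.sSup_mem hne hbd
  have hmax : ∀ C J J', Reach h2 A C → Cfg C J J' → J.card + J'.card ≤ I.card + I'.card := by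
    intro C J J' h1 h2
    rw [← hk]
    exact le_csSup hbd ⟨C, J, J', h1, h2, rfl⟩
  -- symmetric packaging
  have main : ∀ J J', Cfg B J J' → J.card + J'.card = I.card + I'.card →
      (∀ C, Reach h2 A C → (∀ i ∈ J, B i = C i) → (∀ i ∈ J', B i = C i) →
        ∀ t, t ∉ J → t ∉ J' → (C t).1 ∈ Ad B J) := by
    intro J J' hJ hJc C hC e1 e2 t ht ht'
    by_contra hn
    rw [Ad_congr (B := B) (C := C) e1] at hn
    have h3 := hmax C _ _ hC ((hJ.congr e1 e2).ins ht ht' hn)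
    rw [Finset.card_insert_of_notMem ht] at h3
    omega
  have main2 : ∀ J J', Cfg B J J' → J.card + J'.card = I.card + I'.card →
      (∃ t, t ∉ J ∧ t ∉ J') → ∀ j, (B j).1 ∈ Ad B J := by
    rintro J J' hJ hJc ⟨t, ht, ht'⟩ j
    by_cases hj : j ∈ J
    · exact mem_Ad B hj
    by_cases hj' : j ∈ J'
    · have htj : t ≠ j := fun h => ht' (h ▸ hj')
      have h1 := main J J' hJ hJc B hB (fun _ _ => rfl) (fun _ _ => rfl) t ht ht'
      have h3 := main J J' hJ hJc (Function.update B t (B t * B j)) (hB.trans (reach_mul h2 B htj))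
        (fun i hi => (Function.update_of_ne (ne_of_mem_of_not_mem hi ht) _ _).symm)
        (fun i hi => (Function.update_of_ne (ne_of_mem_of_not_mem hi ht') _ _).symm) t ht ht'
      rw [Function.update_self] at h3
      exact Ad_cancel B J (B t) (B j) h1 h3
    · exact main J J' hJ hJc B hB (fun _ _ => rfl) (fun _ _ => rfl) j hj hj'
  have hcard : 1 < ((I ∪ I')ᶜ).card := by
    rw [Finset.card_compl, Fintype.card_fin]
    have := Finset.card_union_le I I'
    have := hc.le
    omega
  obtain ⟨u, hu, v, hv, huv⟩ := Finset.one_lt_card.1 hcard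
  simp only [Finset.mem_compl, Finset.mem_union, not_or] at hu hv
  have hI := main2 I I' hc rfl ⟨u, hu.1, hu.2⟩
  have hI' := main2 I' I hc.symm (by omega) ⟨u, hu.2, hu.1⟩
  refine ⟨B, u, v, hB, fun z => ?_, huv, fun j => ?_⟩
  · refine redundant_finite h2 B s hs (fun C hC => hcl C (hB.trans hC)) z ?_
    by_cases hz : z ∈ I
    · have hz' : z ∉ I' := Finset.disjoint_left.1 hc.1 hz
      exact Ad_mono B (by simpa using hz') (hI' z)
    · exact Ad_mono B (by simpa using hz) (hI z)
  · let P := Gs B {u, v}ᶜ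
    let M : Submonoid (Matrix (Fin r) (Fin r) ℂ) := P.toSubmonoid.map (Units.coeHom _)
    have e : Subalgebra.toSubmodule (Algebra.adjoin ℂ (M : Set (Matrix (Fin r) (Fin r) ℂ))) =
        Submodule.span ℂ (Units.val '' (P : Set (GL (Fin r) ℂ))) := by
      rw [Algebra.adjoin_eq_span, Submonoid.closure_eq]; rfl
    rw [← e]
    have hle : Ad B I ≤ Algebra.adjoin ℂ (M : Set (Matrix (Fin r) (Fin r) ℂ)) := by
      refine Algebra.adjoin_mono ?_
      rintro _ ⟨i, hi, rfl⟩
      refine ⟨B i, Subgroup.subset_closure ⟨i, ?_, rfl⟩, rfl⟩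
      simp only [Set.mem_compl_iff, Set.mem_insert_iff, Set.mem_singleton_iff, not_or]
      exact ⟨fun h => hu.1 (h ▸ hi), fun h => hv.1 (h ▸ hi)⟩
    exact hle (hI j)

lemma Reach.closure_le {N r : ℕ} {h2 : 2 ≤ N} {A B : Fin N → GL (Fin r) ℂ} (h : Reach h2 A B) :
    Subgroup.closure (Set.range A) ≤ Subgroup.closure (Set.range B) := by
  induction h with
  | base => exact le_rfl
  | @cyc B _ ih =>
    refine ih.trans ((Subgroup.closure_le _).2 ?_)
    rintro _ ⟨i, rfl⟩
    refine Subgroup.subset_closure ⟨⟨(i.val + (N - 1)) % N, Nat.mod_lt _ i.pos⟩, ?_⟩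
    simp only [opCyc]
    congr 1
    ext
    simp only [Nat.mod_add_mod]
    rw [add_assoc, Nat.sub_add_cancel (by omega), Nat.add_mod_right, Nat.mod_eq_of_lt i.2]
  | @swap B _ ih =>
    refine ih.trans ((Subgroup.closure_le _).2 ?_)
    rintro _ ⟨i, rfl⟩
    by_cases h0 : i.val = 0
    · refine Subgroup.subset_closure ⟨⟨1, by omega⟩, ?_⟩
      simp only [opSwap]
      simp
      congr 1; ext; simp [h0]
    · by_cases h1 : i.val = 1
      · refine Subgroup.subset_closure ⟨⟨0, by omega⟩, ?_⟩
        simp only [opSwap]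
        simp
        congr 1; ext; simp [h1]
      · exact Subgroup.subset_closure ⟨i, by simp [opSwap, h0, h1]⟩
  | @inv B _ ih =>
    refine ih.trans ((Subgroup.closure_le _).2 ?_)
    rintro _ ⟨i, rfl⟩
    have hm : opInv B i ∈ Subgroup.closure (Set.range (opInv B)) :=
      Subgroup.subset_closure ⟨i, rfl⟩
    by_cases h0 : i.val = 0
    · have : B i = (opInv B i)⁻¹ := by simp [opInv, h0]
      rw [this]; exact inv_mem hm
    · have : B i = opInv B i := by simp [opInv, h0]
      rw [this]; exact hm
  | @dehn B _ ih =>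
    refine ih.trans ((Subgroup.closure_le _).2 ?_)
    rintro _ ⟨i, rfl⟩
    have hm : ∀ i, opDehn h2 B i ∈ Subgroup.closure (Set.range (opDehn h2 B)) :=
      fun i => Subgroup.subset_closure ⟨i, rfl⟩
    by_cases h0 : i.val = 0
    · have : B i = opDehn h2 B i * (opDehn h2 B ⟨1, by omega⟩)⁻¹ := by simp [opDehn, h0]
      rw [this]; exact mul_mem (hm _) (inv_mem (hm _))
    · have : B i = opDehn h2 B i := by simp [opDehn, h0]
      rw [this]; exact hm i

/-- If the tuples obtained from `(A₁, …, A_N)` by repeatedly applying `c`, `τ`, `ε`, `d`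
meet only finitely many conjugacy classes, and `r² ≤ g` with `N = 2g` or `2g+1`, `g ≥ 1`,
then `A₁, …, A_N` generate a finite subgroup of `GL_r(ℂ)`. -/
theorem finite_generated_subgroup_of_finitely_many_classes
    (g r N : ℕ) (hg : 1 ≤ g) (hr : r ^ 2 ≤ g)
    (hN : N = 2 * g ∨ N = 2 * g + 1) (h2 : 2 ≤ N)
    (A : Fin N → GL (Fin r) ℂ)
    (hfin : ∃ s : Set (Fin N → GL (Fin r) ℂ), s.Finite ∧
      ∀ B, Reach h2 A B → ∃ B' ∈ s, TupleConj B B') :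
    Set.Finite ((Subgroup.closure (Set.range A) : Subgroup (GL (Fin r) ℂ)) : Set (GL (Fin r) ℂ)) := by
  obtain ⟨s, hs, hcl⟩ := hfin
  rcases Nat.eq_zero_or_pos r with rfl | hr1
  · have : Subsingleton (GL (Fin 0) ℂ) := ⟨fun a b => Units.ext (Subsingleton.elim _ _)⟩
    exact Set.toFinite _
  · obtain ⟨B, u, v, hB, hG⟩ := exists_good h2 hr1 (by omega) A s hs hcl
    have hpos : 0 < r ^ 2 := by positivity
    exact (hG.finite (by omega)).subset hB.closure_le
end

section
/- Let g, r ≥ 0 be integers, N = 2g or N = 2g+1, F_N the free group on N generators, and K ≤ F_N a characteristic subgroup (i.e. φ(K) = K for every automorphism φ of F_N). Set G = F_N/K. If ρ : G → GL_r(ℂ) is a representation with finite orbit under Aut(G) and r² ≤ g (equivalently r < √(g+1)), then ρ has finite image. -/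
section helpers
open Matrix
open scoped ComplexOrder MatrixOrder

section unitary
variable {F : Type*} [Group F] {n : Type*} [Fintype n] [DecidableEq n]

/-- Invariant positive definite Hermitian form of a finite matrix group. -/
lemma exists_inv_form_s3 (f : F →* Matrix n n ℂ) (P : Subgroup F) (hP : (f '' P).Finite) :
    ∃ h : Matrix n n ℂ, h.PosDef ∧ ∀ g ∈ P, (f g)ᴴ * h * f g = h := by
  classical
  refine ⟨∑ m ∈ hP.toFinset, mᴴ * m, ?_, ?_⟩
  · have h1 : (1 : Matrix n n ℂ) ∈ hP.toFinset := by
      simp only [Set.Finite.mem_toFinset]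
      exact ⟨1, P.one_mem, map_one f⟩
    rw [← Finset.add_sum_erase _ _ h1]
    refine Matrix.PosDef.add_posSemidef (by simpa using Matrix.PosDef.one) ?_
    exact Matrix.posSemidef_sum _ fun m _ => Matrix.posSemidef_conjTranspose_mul_self m
  · intro g hg
    rw [Finset.mul_sum, Finset.sum_mul]
    refine Finset.sum_bij (fun m _ => m * f g) ?_ ?_ ?_ ?_
    · intro m hm
      simp only [Set.Finite.mem_toFinset] at hm ⊢
      obtain ⟨p, hp, rfl⟩ := hm
      exact ⟨p * g, P.mul_mem hp hg, map_mul f _ _⟩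
    · intro a _ b _ hab
      have := congrArg (· * f g⁻¹) hab
      simpa [mul_assoc, ← map_mul] using this
    · intro m hm
      simp only [Set.Finite.mem_toFinset] at hm
      obtain ⟨p, hp, rfl⟩ := hm
      refine ⟨f (p * g⁻¹), ?_, ?_⟩
      · simp only [Set.Finite.mem_toFinset]
        exact ⟨_, P.mul_mem hp (P.inv_mem hg), rfl⟩
      · simp [← map_mul]
    · intro m _
      simp [Matrix.conjTranspose_mul, mul_assoc]

lemma posDef_factor {h : Matrix n n ℂ} (hh : h.PosDef) :
    ∃ C D : Matrix n n ℂ, h = Cᴴ * C ∧ C * D = 1 ∧ D * C = 1 := by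
  obtain ⟨C, hC⟩ := CStarAlgebra.nonneg_iff_eq_star_mul_self.1 hh.posSemidef.nonneg
  have hu : IsUnit C.det := by
    have := (Matrix.isUnit_iff_isUnit_det _).1 hh.isUnit
    rw [hC, Matrix.det_mul] at this
    exact isUnit_of_mul_isUnit_right this
  exact ⟨C, C⁻¹, hC, Matrix.mul_nonsing_inv _ hu, Matrix.nonsing_inv_mul _ hu⟩

lemma trace_le_of_inv_form {h m : Matrix n n ℂ} (hh : h.PosDef) (hm : mᴴ * h * m = h) :
    ‖m.trace‖ ≤ Fintype.card n := by
  obtain ⟨C, D, rfl, hCD, hDC⟩ := posDef_factor hh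
  have hCD' : Dᴴ * Cᴴ = 1 := by rw [← conjTranspose_mul, hCD, conjTranspose_one]
  have hU : C * m * D ∈ Matrix.unitaryGroup n ℂ := by
    rw [Matrix.mem_unitaryGroup_iff', star_eq_conjTranspose]
    calc (C * m * D)ᴴ * (C * m * D) = Dᴴ * (mᴴ * (Cᴴ * C) * m) * D := by
          simp [conjTranspose_mul, mul_assoc]
      _ = (Dᴴ * Cᴴ) * (C * D) := by rw [hm]; simp [mul_assoc]
      _ = 1 := by rw [hCD, hCD', one_mul]
  have ht : m.trace = (C * m * D).trace := by
    rw [Matrix.trace_mul_comm, ← mul_assoc, hDC, one_mul]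
  rw [ht, Matrix.trace]
  refine (norm_sum_le _ _).trans ?_
  refine (Finset.sum_le_sum fun i _ => entry_norm_bound_of_unitary hU i i).trans ?_
  simp

lemma nondeg (f : F →* Matrix n n ℂ) (P : Subgroup F) (hP : (f '' P).Finite)
    (a : Matrix n n ℂ) (ha : a ∈ Submodule.span ℂ (f '' P))
    (h0 : ∀ b ∈ P, (a * f b).trace = 0) : a = 0 := by
  obtain ⟨h, hh, hinv⟩ := exists_inv_form_s3 f P hP
  have h1 : ∀ a ∈ Submodule.span ℂ (f '' P), ∃ a' ∈ Submodule.span ℂ (f '' P), aᴴ * h = h * a' := by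
    intro a ha
    induction ha using Submodule.span_induction with
    | mem x hx =>
      obtain ⟨b, hb, rfl⟩ := hx
      refine ⟨f b⁻¹, Submodule.subset_span ⟨_, P.inv_mem hb, rfl⟩, ?_⟩
      conv_rhs => rw [← hinv b hb]
      simp [mul_assoc, ← map_mul]
    | zero => exact ⟨0, Submodule.zero_mem _, by simp⟩
    | add x y _ _ hx hy =>
      obtain ⟨x', hx', ex⟩ := hx
      obtain ⟨y', hy', ey⟩ := hy
      exact ⟨x' + y', Submodule.add_mem _ hx' hy', by simp [add_mul, mul_add, ex, ey]⟩
    | smul c x _ hx =>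
      obtain ⟨x', hx', ex⟩ := hx
      exact ⟨star c • x', Submodule.smul_mem _ _ hx', by simp [ex]⟩
  have h2 : ∀ a' ∈ Submodule.span ℂ (f '' P), (a * a').trace = 0 := by
    intro a' ha'
    induction ha' using Submodule.span_induction with
    | mem x hx => obtain ⟨b, hb, rfl⟩ := hx; exact h0 b hb
    | zero => simp
    | add x y _ _ hx hy => simp [mul_add, hx, hy]
    | smul c x _ hx => simp [hx]
  obtain ⟨a', ha', e⟩ := h1 a ha
  have h3 := h2 a' ha'
  obtain ⟨C, D, rfl, hCD, hDC⟩ := posDef_factor hh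
  have hCD' : Dᴴ * Cᴴ = 1 := by rw [← conjTranspose_mul, hCD, conjTranspose_one]
  have hDC' : Cᴴ * Dᴴ = 1 := by rw [← conjTranspose_mul, hDC, conjTranspose_one]
  have e' : a' = D * (Dᴴ * (aᴴ * (Cᴴ * C))) := by
    rw [e]
    calc a' = D * ((Dᴴ * Cᴴ) * C) * a' := by rw [hCD', one_mul, hDC, one_mul]
      _ = _ := by simp only [mul_assoc]
  have h4 : ((C * a * D)ᴴ * (C * a * D)).trace = 0 := by
    rw [← h3, e', Matrix.trace_mul_comm, conjTranspose_mul, conjTranspose_mul]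
    rw [show C * a * D * (Dᴴ * (aᴴ * Cᴴ)) = C * (a * D * (Dᴴ * (aᴴ * Cᴴ))) by simp [mul_assoc],
      Matrix.trace_mul_comm]
    simp only [mul_assoc]
  rw [Matrix.trace_conjTranspose_mul_self_eq_zero_iff] at h4
  calc a = (D * C) * a * (D * C) := by rw [hDC]; simp
    _ = D * (C * a * D) * C := by simp only [mul_assoc]
    _ = 0 := by rw [h4]; simp

lemma trace_bound {ι : Type*} (f : F →* Matrix n n ℂ) (x : ι → F)
    (hx : Subgroup.closure (Set.range x) = ⊤)
    (H : ι → Subgroup F) (B : Subgroup F) (T : Set ι)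
    (hBH : ∀ i ∈ T, B ≤ H i) (hxH : ∀ i ∈ T, ∀ j ≠ i, x j ∈ H i)
    (hT : T.Nontrivial)
    (hfin : ∀ i ∈ T, (f '' H i).Finite)
    (hspan : ∀ g, f g ∈ Submodule.span ℂ (f '' B)) (g : F) :
    ‖(f g).trace‖ ≤ Fintype.card n := by
  obtain ⟨i0, hi0⟩ := hT.nonempty
  obtain ⟨h, hh, hinv⟩ := exists_inv_form_s3 f B ((hfin i0 hi0).subset (Set.image_mono (hBH i0 hi0)))
  refine trace_le_of_inv_form hh ?_
  have key : ∀ i ∈ T, ∀ g ∈ H i, (f g)ᴴ * h * f g = h := by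
    intro i hi g hg
    obtain ⟨k, hk, kinv⟩ := exists_inv_form_s3 f (H i) (hfin i hi)
    obtain ⟨u, v, huv, hvu⟩ : ∃ u v : Matrix n n ℂ, u * h = 1 ∧ h * u = 1 ∧ k * v = 1 := by
      obtain ⟨u, hu⟩ := hh.isUnit
      obtain ⟨v, hv⟩ := hk.isUnit
      exact ⟨(u⁻¹ : (Matrix n n ℂ)ˣ), (v⁻¹ : (Matrix n n ℂ)ˣ), by simp [← hu], by simp [← hu],
        by simp [← hv]⟩
    obtain ⟨hhu, hkv⟩ := hvu
    -- the matrix u k commutes with everything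
    have hcomm : ∀ b ∈ B, (u * k) * f b = f b * (u * k) := by
      intro b hb
      have e1 := hinv b hb
      have e2 := kinv b (hBH i hi hb)
      have e5 : f b * f b⁻¹ = 1 := by simp [← map_mul]
      have e6 : f b⁻¹ * f b = 1 := by simp [← map_mul]
      have e3 : (f b)ᴴ * k = k * f b⁻¹ := by
        conv_rhs => rw [← e2]
        simp [mul_assoc, ← map_mul]
      have e3' : (f b)ᴴ * h = h * f b⁻¹ := by
        conv_rhs => rw [← e1]
        simp [mul_assoc, ← map_mul]
      have e4 : (f b⁻¹) * u = u * (f b)ᴴ := by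
        calc (f b⁻¹) * u = (u * h) * f b⁻¹ * u := by rw [huv, one_mul]
          _ = u * (h * f b⁻¹) * u := by simp only [mul_assoc]
          _ = u * (f b)ᴴ * (h * u) := by rw [← e3']; simp only [mul_assoc]
          _ = _ := by rw [hhu, mul_one]
      calc (u * k) * f b = (f b * f b⁻¹) * (u * k * f b) := by
            rw [e5, one_mul]
        _ = f b * (f b⁻¹ * u) * k * f b := by simp only [mul_assoc]
        _ = f b * u * ((f b)ᴴ * k) * f b := by rw [e4]; simp only [mul_assoc]
        _ = f b * u * k * (f b⁻¹ * f b) := by rw [e3]; simp only [mul_assoc]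
        _ = _ := by rw [e6]; simp only [mul_assoc, mul_one]
    have hcomm' : ∀ a ∈ Submodule.span ℂ (f '' B), (u * k) * a = a * (u * k) := by
      intro a ha
      induction ha using Submodule.span_induction with
      | mem x hx => obtain ⟨b, hb, rfl⟩ := hx; exact hcomm b hb
      | zero => simp
      | add x y _ _ hx hy => rw [mul_add, add_mul, hx, hy]
      | smul c x _ hx => rw [mul_smul_comm, smul_mul_assoc, hx]
    have hc := hcomm' _ (hspan g)
    have hk' : h * (u * k) = k := by rw [← mul_assoc, hhu, one_mul]
    have e := kinv g hg
    have : ((f g)ᴴ * h * f g) * (u * k) = k := by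
      calc _ = (f g)ᴴ * h * (f g * (u * k)) := by simp only [mul_assoc]
        _ = (f g)ᴴ * (h * (u * k)) * f g := by rw [← hc]; simp only [mul_assoc]
        _ = k := by rw [hk', e]
    calc (f g)ᴴ * h * f g = ((f g)ᴴ * h * f g) * u * (k * v) * h := by
          rw [hkv, mul_one, mul_assoc _ u h, huv, mul_one]
      _ = ((f g)ᴴ * h * f g * (u * k)) * v * h := by simp only [mul_assoc]
      _ = h := by rw [this, hkv, one_mul]
  have hg : g ∈ Subgroup.closure (Set.range x) := by rw [hx]; trivial
  induction hg using Subgroup.closure_induction with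
  | mem y hy =>
    obtain ⟨j, rfl⟩ := hy
    obtain ⟨i, hi, hij⟩ := hT.exists_ne j
    exact key i hi _ (hxH i hi j hij.symm)
  | one => simp
  | mul a b _ _ ha hb =>
    rw [map_mul, conjTranspose_mul]
    calc _ = (f b)ᴴ * ((f a)ᴴ * h * f a) * f b := by simp only [mul_assoc]
      _ = h := by rw [ha, hb]
  | inv a _ ha =>
    have e1 : f a * f a⁻¹ = 1 := by simp [← map_mul]
    have e2 : (f a⁻¹)ᴴ * (f a)ᴴ = 1 := by rw [← conjTranspose_mul, e1, conjTranspose_one]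
    calc _ = (f a⁻¹)ᴴ * ((f a)ᴴ * h * f a) * f a⁻¹ := by rw [ha]
      _ = ((f a⁻¹)ᴴ * (f a)ᴴ) * h * (f a * f a⁻¹) := by simp only [mul_assoc]
      _ = h := by rw [e1, e2]; simp

end unitary

section integral

lemma isIntegral_trace_of_isIntegral {n : Type*} [Fintype n] [DecidableEq n]
    {R : Type*} [CommRing R] [Algebra R ℂ] (M : Matrix n n ℂ) (hM : IsIntegral R M) :
    IsIntegral R M.trace := by
  rw [Matrix.trace_eq_sum_roots_charpoly]
  refine IsIntegral.multiset_sum ?_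
  intro z hz
  obtain ⟨p, hp, hp0⟩ := hM
  refine ⟨p, hp, ?_⟩
  have hdvd : minpoly ℂ M ∣ p.map (algebraMap R ℂ) := by
    apply minpoly.dvd
    rw [Polynomial.aeval_map_algebraMap]
    exact hp0
  have hroot : (minpoly ℂ M).IsRoot z := by
    have h1 := (Polynomial.mem_roots'.1 hz).2
    have h2 : (Matrix.toLin' M).charpoly.IsRoot z := by
      rwa [Matrix.charpoly_toLin']
    have h3 := (Module.End.hasEigenvalue_iff_isRoot_charpoly _ _).2 h2
    have h4 := Module.End.isRoot_of_hasEigenvalue h3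
    rwa [Matrix.minpoly_toLin'] at h4
  have := hroot.dvd hdvd
  rwa [Polynomial.IsRoot, Polynomial.eval_map] at this

variable {F : Type*} [Group F] {n : Type*} [Fintype n] [DecidableEq n]

lemma exists_pow_eq_one {M : Type*} [Monoid M] (f : F →* M) (P : Subgroup F) (hP : (f '' P).Finite)
    (g : F) (hg : g ∈ P) : ∃ m : ℕ, f g ^ (m + 1) = 1 := by
  have : ¬ Function.Injective (fun k : ℕ => (⟨f (g ^ k), g ^ k, P.pow_mem hg k, rfl⟩ : f '' P)) := by
    have := hP.to_subtype
    exact not_injective_infinite_finite _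
  rw [Function.Injective] at this
  push Not at this
  obtain ⟨a, b, hab, hne⟩ := this
  replace hab : f (g ^ a) = f (g ^ b) := congrArg Subtype.val hab
  wlog hlt : a < b generalizing a b
  · exact this b a hne.symm hab.symm (by omega)
  refine ⟨b - a - 1, ?_⟩
  rw [← map_pow, show b - a - 1 + 1 = b - a by omega]
  have e : g ^ (b - a) = (g ^ a)⁻¹ * g ^ b := by
    rw [eq_inv_mul_iff_mul_eq, ← pow_add]; congr 1; omega
  rw [e, map_mul, ← hab, ← map_mul]; simp

lemma all_mem {M : Type*} [Monoid M] {ι : Type*} (f : F →* M) (x : ι → F)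
    (hx : Subgroup.closure (Set.range x) = ⊤) (hord : ∀ j, ∃ m : ℕ, f (x j) ^ (m + 1) = 1)
    (P : Submonoid M) (hP : ∀ j, f (x j) ∈ P) (g : F) : f g ∈ P := by
  have hg : g ∈ (Subgroup.closure (Set.range x)).toSubmonoid := by rw [hx]; trivial
  rw [Subgroup.closure_toSubmonoid] at hg
  have : Submonoid.closure (Set.range x ∪ (Set.range x)⁻¹) ≤ P.comap f := by
    rw [Submonoid.closure_le]
    rintro y (⟨j, rfl⟩ | ⟨j, hj⟩)
    · exact hP j
    · obtain ⟨m, hm⟩ := hord j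
      have e : f y = f (x j) ^ m := by
        have : y = (x j)⁻¹ := by rw [hj]; simp
        subst this
        calc f (x j)⁻¹ = f (x j)⁻¹ * f (x j) ^ (m + 1) := by rw [hm, mul_one]
          _ = (f (x j)⁻¹ * f (x j)) * f (x j) ^ m := by rw [pow_succ', mul_assoc]
          _ = _ := by rw [← map_mul]; simp
      change f y ∈ P
      rw [e]
      exact P.pow_mem (hP j) m
  exact this hg

lemma trace_integral_s3 {ι : Type*} (f : F →* Matrix n n ℂ) (x : ι → F)
    (hx : Subgroup.closure (Set.range x) = ⊤)
    (H : ι → Subgroup F) (T : Finset ι)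
    (hxH : ∀ i ∈ T, ∀ j ≠ i, x j ∈ H i)
    (hT : (T : Set ι).Nontrivial)
    (hfin : ∀ i ∈ T, (f '' H i).Finite)
    (hdep : ¬ LinearIndependent ℂ (fun t : T => f (x t))) (g : F) :
    IsIntegral ℤ (f g).trace := by
  classical
  have hord : ∀ j, ∃ m : ℕ, f (x j) ^ (m + 1) = 1 := by
    intro j
    obtain ⟨i, hi, hij⟩ := hT.exists_ne j
    exact exists_pow_eq_one f (H i) (hfin i hi) _ (hxH i hi j hij.symm)
  rw [Fintype.not_linearIndependent_iff] at hdep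
  obtain ⟨c, hc0, t0, ht0⟩ := hdep
  have key : ∀ O : ValuationSubring ℂ, (f g).trace ∈ O := by
    intro O
    obtain ⟨i, -, hi⟩ := Finset.exists_max_image (Finset.univ : Finset T) (fun t => O.valuation (c t))
      ⟨t0, Finset.mem_univ _⟩
    have hci : c i ≠ 0 := by
      intro h
      have := hi t0 (Finset.mem_univ _)
      rw [h, map_zero, le_zero_iff, map_eq_zero] at this
      exact ht0 this
    have hq : ∀ t, -(c t / c i) ∈ O := by
      intro t
      apply neg_mem
      rw [← O.valuation_le_one_iff, map_div₀]
      exact div_le_one_of_le₀ (hi t (Finset.mem_univ _)) zero_le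
    let A := Algebra.adjoin O (f '' H i)
    have hA : A.toSubmodule.FG := by
      have e : (Submonoid.closure (f '' (H i : Set F)) : Set (Matrix n n ℂ)) = f '' H i := by
        have := Submonoid.closure_eq ((H i).toSubmonoid.map f)
        exact congrArg (fun S : Submonoid (Matrix n n ℂ) => (S : Set (Matrix n n ℂ))) this
      rw [Algebra.adjoin_eq_span, e]
      exact Submodule.fg_span (hfin i i.2)
    have hmem : ∀ j, f (x j) ∈ A.toSubmonoid := by
      intro j
      by_cases hj : j = i
      · subst hj
        have e : f (x i) = ∑ t ∈ Finset.univ.erase i, (⟨_, hq t⟩ : O) • f (x t) := by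
          rw [← Finset.add_sum_erase _ _ (Finset.mem_univ i)] at hc0
          have h1 : f (x i) = (c i)⁻¹ • (c i • f (x i)) := by rw [smul_smul, inv_mul_cancel₀ hci, one_smul]
          rw [h1, eq_neg_of_add_eq_zero_left hc0, smul_neg, Finset.smul_sum, ← Finset.sum_neg_distrib]
          refine Finset.sum_congr rfl fun t _ => ?_
          rw [smul_smul, ← neg_smul]
          change _ = (-(c t / c i)) • f (x t)
          congr 1
          rw [div_eq_mul_inv, mul_comm]
        rw [e]
        refine A.sum_mem fun t ht => A.smul_mem (Algebra.subset_adjoin ?_) _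
        refine ⟨_, hxH i i.2 t ?_, rfl⟩
        exact fun h => (Finset.mem_erase.1 ht).1 (Subtype.ext h)
      · exact Algebra.subset_adjoin ⟨_, hxH i i.2 j hj, rfl⟩
    have hgA : f g ∈ A := all_mem f x hx hord A.toSubmonoid hmem g
    have hint : IsIntegral O (f g) := IsIntegral.of_mem_of_fg A hA _ hgA
    have := isIntegral_trace_of_isIntegral (f g) hint
    obtain ⟨y, hy⟩ := (IsIntegrallyClosed.isIntegral_iff (R := O) (K := ℂ)).1 this
    rw [← hy]; exact y.2
  have h1 : (f g).trace ∈ (⨅ V : {V : ValuationSubring ℂ // (∅ : Set ℂ) ⊆ V.toSubring}, V.1.toSubring) := by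
    rw [Subring.mem_iInf]
    intro V
    exact key V.1
  rw [iInf_valuationSubring_superset] at h1
  have h2 : IsIntegral (Subring.closure (∅ : Set ℂ)) (f g).trace := h1
  obtain ⟨p, hp, hp0⟩ := h2
  have hsurj : Function.Surjective (algebraMap ℤ (Subring.closure (∅ : Set ℂ))) := by
    rintro ⟨y, hy⟩
    rw [Subring.closure_empty] at hy
    obtain ⟨m, hm⟩ := Subring.mem_bot.1 hy
    exact ⟨m, Subtype.ext (by simpa using hm)⟩
  have : Algebra.IsIntegral ℤ (Subring.closure (∅ : Set ℂ)) := by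
    refine ⟨fun y => ?_⟩
    obtain ⟨m, rfl⟩ := hsurj y
    exact isIntegral_algebraMap
  exact isIntegral_trans _ h1
end integral
section field
variable {F : Type*} [Group F] {n : Type*} [Fintype n] [DecidableEq n]

lemma descend (f : F →* Matrix n n ℂ) (P : Subgroup F) (hP : (f '' P).Finite)
    (K : IntermediateField ℚ ℂ) (hK : ∀ b ∈ P, (f b).trace ∈ K) :
    ∃ b : Finset (Matrix n n ℂ), b.card ≤ Fintype.card n ^ 2 ∧
      (b : Set (Matrix n n ℂ)) ⊆ f '' P ∧
      ∀ a ∈ Submodule.span ℂ (f '' P), (∀ b ∈ P, (a * f b).trace ∈ K) →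
        a ∈ Submodule.span K (b : Set (Matrix n n ℂ)) := by
  classical
  obtain ⟨b, hbP, hbspan, hbli⟩ := exists_linearIndependent ℂ (f '' (P : Set F))
  have hbf : b.Finite := hP.subset hbP
  have := hbf.fintype
  refine ⟨hbf.toFinset, ?_, by simpa using hbP, ?_⟩
  · have := hbli.fintype_card_le_finrank
    rw [Module.finrank_matrix, Module.finrank_self] at this
    rw [Set.Finite.card_toFinset]
    rw [pow_two]
    simpa using this
  have hmem : ∀ u : b, ∃ p ∈ P, f p = u := fun u => hbP u.2
  have nd : ∀ a ∈ Submodule.span ℂ (f '' (P : Set F)), (∀ u : b, (a * u).trace = 0) → a = 0 := by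
    intro a ha h0
    refine nondeg f P hP a ha ?_
    have h2 : ∀ a' ∈ Submodule.span ℂ b, (a * a').trace = 0 := by
      intro a' ha'
      induction ha' using Submodule.span_induction with
      | mem x hx => exact h0 ⟨x, hx⟩
      | zero => simp
      | add x y _ _ hx hy => simp [mul_add, hx, hy]
      | smul c x _ hx => simp [hx]
    intro p hp
    exact h2 _ (hbspan ▸ Submodule.subset_span ⟨p, hp, rfl⟩)
  have hG : ∀ u v : b, ((u : Matrix n n ℂ) * v).trace ∈ K := by
    intro u v
    obtain ⟨p, hp, hp'⟩ := hmem u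
    obtain ⟨q, hq, hq'⟩ := hmem v
    rw [← hp', ← hq', ← map_mul]
    exact hK _ (P.mul_mem hp hq)
  have hsub : ∀ c : b → K, (∑ v, (c v : ℂ) • (v : Matrix n n ℂ)) ∈ Submodule.span ℂ (f '' (P : Set F)) :=
    fun c => Submodule.sum_mem _ fun v _ => Submodule.smul_mem _ _ (Submodule.subset_span (hbP v.2))
  let G : Matrix b b K := fun u v => ⟨((v : Matrix n n ℂ) * u).trace, hG v u⟩
  have hGc : ∀ (c : b → K) (u : b), ((G.mulVec c u : K) : ℂ) =
      ((∑ v, (c v : ℂ) • (v : Matrix n n ℂ)) * u).trace := by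
    intro c u
    simp only [Matrix.mulVec, dotProduct, Finset.sum_mul, Matrix.trace_sum, smul_mul_assoc,
      Matrix.trace_smul, G]
    push_cast
    refine Finset.sum_congr rfl fun v _ => ?_
    rw [smul_eq_mul, mul_comm]
  have hinj : Function.Injective G.mulVecLin := by
    rw [injective_iff_map_eq_zero]
    intro c hc
    have h1 : (∑ v, (c v : ℂ) • (v : Matrix n n ℂ)) = 0 := by
      refine nd _ (hsub c) fun u => ?_
      rw [← hGc]
      have : G.mulVec c u = 0 := congrFun hc u
      rw [this]; rfl
    have := Fintype.linearIndependent_iff.1 hbli (fun v => (c v : ℂ)) h1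
    funext v
    exact Subtype.ext (this v)
  have hsurj : Function.Surjective G.mulVecLin := LinearMap.injective_iff_surjective.1 hinj
  intro a ha hat
  have hat' : ∀ u : b, (a * u).trace ∈ K := by
    intro u
    obtain ⟨p, hp, hp'⟩ := hmem u
    rw [← hp']; exact hat p hp
  obtain ⟨c, hc⟩ := hsurj (fun u => ⟨_, hat' u⟩)
  have : a - (∑ v, (c v : ℂ) • (v : Matrix n n ℂ)) = 0 := by
    refine nd _ (Submodule.sub_mem _ ha (hsub c)) fun u => ?_
    rw [sub_mul, Matrix.trace_sub, ← hGc]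
    have : G.mulVec c u = ⟨_, hat' u⟩ := congrFun hc u
    rw [this, sub_self]
  rw [sub_eq_zero] at this
  rw [this]
  refine Submodule.sum_mem _ fun v _ => ?_
  exact Submodule.smul_mem (Submodule.span K _) (c v) (Submodule.subset_span (by simp))

/-- Finiteness over a number field. -/
lemma finite_over_numberField {ι : Type*} {K : Type*} [Field K] [NumberField K]
    (f : F →* Matrix n n K) (x : ι → F)
    (hx : Subgroup.closure (Set.range x) = ⊤)
    (H : ι → Subgroup F) (B : Subgroup F) (T : Finset ι)
    (hBH : ∀ i ∈ T, B ≤ H i) (hxH : ∀ i ∈ T, ∀ j ≠ i, x j ∈ H i)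
    (hT : (T : Set ι).Nontrivial)
    (hfin : ∀ i ∈ T, (f '' H i).Finite)
    (hspan : ∀ g, f g ∈ Submodule.span K (f '' B))
    (hdep : ¬ LinearIndependent K (fun t : T => f (x t))) : (Set.range f).Finite := by
  classical
  let F' : (K →+* ℂ) → (F →* Matrix n n ℂ) := fun τ =>
    (RingHom.toMonoidHom (τ.mapMatrix : Matrix n n K →+* Matrix n n ℂ)).comp f
  have hF' : ∀ τ g, F' τ g = (f g).map τ := fun _ _ => rfl
  have hfin' : ∀ τ, ∀ i ∈ T, (F' τ '' H i).Finite := by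
    intro τ i hi
    have := (hfin i hi).image (fun m : Matrix n n K => m.map τ)
    rwa [Set.image_image] at this
  have hmap : ∀ τ : K →+* ℂ, ∀ a ∈ Submodule.span K (f '' (B : Set F)),
      a.map τ ∈ Submodule.span ℂ (F' τ '' (B : Set F)) := by
    intro τ a ha
    induction ha using Submodule.span_induction with
    | mem y hy => obtain ⟨b, hb, rfl⟩ := hy; exact Submodule.subset_span ⟨b, hb, rfl⟩
    | zero => simp
    | add y z _ _ hy hz =>
      rw [Matrix.map_add _ (map_add τ)]; exact Submodule.add_mem _ hy hz
    | smul c y _ hy =>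
      have : (c • y).map τ = τ c • y.map τ := by ext; simp
      rw [this]; exact Submodule.smul_mem _ _ hy
  have htr : ∀ (τ : K →+* ℂ) (m : Matrix n n K), (m.map τ).trace = τ m.trace := by
    intro τ m; simp [Matrix.trace]
  obtain ⟨τ0⟩ : Nonempty (K →+* ℂ) := inferInstance
  have hdep' : ¬ LinearIndependent ℂ (fun t : T => F' τ0 (x t)) := by
    rw [Fintype.not_linearIndependent_iff] at hdep ⊢
    obtain ⟨c, hc, t, ht⟩ := hdep
    refine ⟨fun t => τ0 (c t), ?_, t, by simpa using ht⟩
    have := congrArg τ0.mapMatrix hc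
    rw [map_sum, map_zero] at this
    rw [← this]
    refine Finset.sum_congr rfl fun u _ => ?_
    ext; simp [hF']
  have htraces : ∀ g, (f g).trace ∈ {z : K | IsIntegral ℤ z ∧ ∀ φ : K →+* ℂ, ‖φ z‖ ≤ Fintype.card n} := by
    intro g
    constructor
    · have := trace_integral_s3 (F' τ0) x hx H T hxH hT (hfin' τ0) hdep' g
      rw [hF', htr] at this
      exact (isIntegral_algHom_iff (τ0.toIntAlgHom) τ0.injective).1 this
    · intro τ
      have := trace_bound (F' τ) x hx H B T hBH hxH hT (hfin' τ) (fun g => hmap τ _ (hspan g)) g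
      rwa [hF', htr] at this
  have hZ := NumberField.Embeddings.finite_of_norm_le K ℂ (Fintype.card n)
  set Z := {z : K | IsIntegral ℤ z ∧ ∀ φ : K →+* ℂ, ‖φ z‖ ≤ Fintype.card n} with hZdef
  obtain ⟨i0, hi0⟩ := hT.nonempty
  have hBfin : (f '' (B : Set F)).Finite := (hfin i0 hi0).subset (Set.image_mono (hBH i0 hi0))
  have hBfin' : (F' τ0 '' (B : Set F)).Finite :=
    (hfin' τ0 i0 hi0).subset (Set.image_mono (hBH i0 hi0))
  have := hBfin.to_subtype
  refine Set.Finite.of_injOn (f := fun m (u : f '' (B : Set F)) => (m * (u : Matrix n n K)).trace)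
    (t := Set.univ.pi fun _ => Z) ?_ ?_ (Set.Finite.pi fun _ => hZ)
  · rintro _ ⟨g, rfl⟩ ⟨_, b, hb, rfl⟩ _
    change (f g * f b).trace ∈ Z
    rw [← map_mul]
    exact htraces _
  · rintro _ ⟨g, rfl⟩ _ ⟨g', rfl⟩ h
    have h1 : (f g - f g').map τ0 = 0 := by
      refine nondeg (F' τ0) B hBfin' _ (hmap τ0 _ (Submodule.sub_mem _ (hspan g) (hspan g'))) ?_
      intro b hb
      have h2 : (f g * f b).trace = (f g' * f b).trace := congrFun h ⟨f b, b, hb, rfl⟩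
      rw [hF', ← Matrix.map_mul, htr, sub_mul, Matrix.trace_sub, h2, sub_self, map_zero]
    rw [← sub_eq_zero]
    ext i j
    have : τ0 ((f g - f g') i j) = 0 := congrFun (congrFun h1 i) j
    simpa only [Matrix.zero_apply] using (map_eq_zero τ0).1 this

lemma finite_of_good {ι : Type*} (f : F →* Matrix n n ℂ) (x : ι → F)
    (hx : Subgroup.closure (Set.range x) = ⊤)
    (H : ι → Subgroup F) (B : Subgroup F) (T : Finset ι)
    (hBH : ∀ i ∈ T, B ≤ H i) (hxH : ∀ i ∈ T, ∀ j ≠ i, x j ∈ H i)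
    (hT : (T : Set ι).Nontrivial)
    (hfin : ∀ i ∈ T, (f '' H i).Finite)
    (hspan : ∀ g, f g ∈ Submodule.span ℂ (f '' B))
    (hcard : Fintype.card n ^ 2 < T.card) : (Set.range f).Finite := by
  classical
  have hord : ∀ j, ∃ m : ℕ, f (x j) ^ (m + 1) = 1 := by
    intro j
    obtain ⟨i, hi, hij⟩ := hT.exists_ne j
    exact exists_pow_eq_one f (H i) (hfin i hi) _ (hxH i hi j hij.symm)
  let tr : Set ℂ := Matrix.trace '' (⋃ i ∈ T, f '' H i)
  have htr : tr.Finite := (T.finite_toSet.biUnion fun i hi => hfin i hi).image _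
  let K : IntermediateField ℚ ℂ := IntermediateField.adjoin ℚ tr
  have hfd : FiniteDimensional ℚ K := by
    have := htr.to_subtype
    refine IntermediateField.finiteDimensional_adjoin ?_
    rintro _ ⟨m, hm, rfl⟩
    simp only [Set.mem_iUnion] at hm
    obtain ⟨i, hi, g, hg, rfl⟩ := hm
    apply isIntegral_trace_of_isIntegral
    obtain ⟨m, hm⟩ := exists_pow_eq_one f (H i) (hfin i hi) _ hg
    refine IsIntegral.of_pow (Nat.succ_pos m) ?_
    rw [hm]; exact isIntegral_one
  have : NumberField K := ⟨⟩
  have hKt : ∀ i ∈ T, ∀ g ∈ H i, (f g).trace ∈ K := by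
    intro i hi g hg
    refine IntermediateField.subset_adjoin _ _ ⟨f g, ?_, rfl⟩
    simp only [Set.mem_iUnion]
    exact ⟨i, hi, g, hg, rfl⟩
  obtain ⟨i0, hi0⟩ := hT.nonempty
  have hBfin : (f '' (B : Set F)).Finite := (hfin i0 hi0).subset (Set.image_mono (hBH i0 hi0))
  obtain ⟨b, hbcard, hbB, hb⟩ := descend f B hBfin K (fun p hp => hKt i0 hi0 p (hBH i0 hi0 hp))
  -- all elements of the K-span of f(B) lie in span of b
  let A : Subalgebra K (Matrix n n ℂ) := Algebra.adjoin K (f '' (B : Set F))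
  have hA : A.toSubmodule = Submodule.span K (f '' (B : Set F)) := by
    have e : (Submonoid.closure (f '' (B : Set F)) : Set (Matrix n n ℂ)) = f '' B := by
      have := Submonoid.closure_eq (B.toSubmonoid.map f)
      exact congrArg (fun S : Submonoid (Matrix n n ℂ) => (S : Set (Matrix n n ℂ))) this
    rw [Algebra.adjoin_eq_span, e]
  have hAb : A.toSubmodule ≤ Submodule.span K (b : Set (Matrix n n ℂ)) := by
    rw [hA, Submodule.span_le]
    rintro _ ⟨p, hp, rfl⟩
    refine hb _ (Submodule.subset_span ⟨p, hp, rfl⟩) fun q hq => ?_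
    rw [← map_mul]
    exact hKt i0 hi0 _ (hBH i0 hi0 (B.mul_mem hp hq))
  have hfdb : FiniteDimensional K (Submodule.span K (b : Set (Matrix n n ℂ))) :=
    FiniteDimensional.span_finset K b
  have hfdA : FiniteDimensional K A := by
    change FiniteDimensional K A.toSubmodule
    exact Submodule.finiteDimensional_of_le hAb
  have hrank : Module.finrank K A ≤ Fintype.card n ^ 2 := by
    have h1 : Module.finrank K A.toSubmodule ≤ _ := Submodule.finrank_mono hAb
    exact (h1.trans (finrank_span_finset_le_card b)).trans hbcard
  have hxA : ∀ j, f (x j) ∈ A.toSubmonoid := by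
    intro j
    change f (x j) ∈ A.toSubmodule
    rw [hA]
    refine Submodule.span_mono hbB (hb _ (hspan _) fun p hp => ?_)
    obtain ⟨i, hi, hij⟩ := hT.exists_ne j
    rw [← map_mul]
    exact hKt i hi _ ((H i).mul_mem (hxH i hi j hij.symm) (hBH i hi hp))
  have hgA : ∀ g, f g ∈ A := all_mem f x hx hord A.toSubmonoid hxA
  let f' : F →* A := f.codRestrict A hgA
  have hf' : ∀ g, (f' g : Matrix n n ℂ) = f g := fun _ => rfl
  let bas := Module.finBasis K A
  let L : A →ₐ[K] Matrix _ _ K := Algebra.leftMulMatrix bas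
  have hL : Function.Injective L := Algebra.leftMulMatrix_injective bas
  let f2 : F →* Matrix _ _ K := (AlgHom.toRingHom L).toMonoidHom.comp f'
  have hf2 : ∀ g, f2 g = L (f' g) := fun _ => rfl
  have hmain : (Set.range f2).Finite := by
    refine finite_over_numberField f2 x hx H B T hBH hxH hT ?_ ?_ ?_
    · intro i hi
      have h1 : (f' '' (H i : Set F)).Finite := by
        refine Set.Finite.of_finite_image (f := Subtype.val) ?_ Subtype.val_injective.injOn
        rw [Set.image_image]
        exact hfin i hi
      have := h1.image L
      rwa [Set.image_image] at this
    · intro g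
      have h1 : f' g ∈ Submodule.span K (f' '' (B : Set F)) := by
        have h2 : f g ∈ (Submodule.span K (f' '' (B : Set F))).map A.val.toLinearMap := by
          rw [Submodule.map_span, Set.image_image]
          have : f g ∈ A.toSubmodule := hgA g
          rw [hA] at this
          exact this
        obtain ⟨y, hy, hyg⟩ := h2
        have : y = f' g := Subtype.ext hyg
        rwa [← this]
      have h3 := Submodule.mem_map_of_mem (f := L.toLinearMap) h1
      rw [Submodule.map_span, Set.image_image] at h3
      exact h3
    · intro hli
      have h1 : LinearIndependent K (fun t : T => f' (x t)) :=
        LinearIndependent.of_comp L.toLinearMap hli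
      have := h1.fintype_card_le_finrank
      rw [Fintype.card_coe] at this
      omega
  have h1 : (Set.range f').Finite := by
    refine Set.Finite.of_finite_image (f := L) ?_ hL.injOn
    rw [← Set.range_comp]
    exact hmain
  have := h1.image Subtype.val
  rw [← Set.range_comp] at this
  exact this
end field

section freegroup

/-- The subgroup generated by all generators but the `i`-th. -/
def HH {N : ℕ} (i : Fin N) : Subgroup (FreeGroup (Fin N)) :=
  Subgroup.closure (FreeGroup.of '' {j | j ≠ i})

/-- The endomorphism `x_i ↦ x_i w`, fixing the other generators. -/
def tv {N : ℕ} (i : Fin N) (w : FreeGroup (Fin N)) : FreeGroup (Fin N) →* FreeGroup (Fin N) :=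
  FreeGroup.lift (fun j => if j = i then FreeGroup.of i * w else FreeGroup.of j)

lemma tv_self {N : ℕ} (i : Fin N) (w : FreeGroup (Fin N)) : tv i w (FreeGroup.of i) = FreeGroup.of i * w := by
  simp [tv]

lemma tv_ne {N : ℕ} (i j : Fin N) (h : j ≠ i) (w : FreeGroup (Fin N)) : tv i w (FreeGroup.of j) = FreeGroup.of j := by
  simp [tv, h]

lemma tv_fix {N : ℕ} (i : Fin N) (w u : FreeGroup (Fin N)) (hu : u ∈ HH i) : tv i w u = u := by
  have : HH i ≤ (tv i w).eqLocus (MonoidHom.id _) := by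
    rw [HH, Subgroup.closure_le]
    rintro _ ⟨j, hj, rfl⟩
    exact tv_ne i j hj w
  exact this hu

lemma tv_comp {N : ℕ} (i : Fin N) (w u : FreeGroup (Fin N)) (hu : u ∈ HH i) (hwu : w * u = 1) :
    (tv i w).comp (tv i u) = MonoidHom.id _ := by
  refine FreeGroup.ext_hom _ _ fun j => ?_
  by_cases hj : j = i
  · subst hj
    simp only [MonoidHom.comp_apply, tv_self, map_mul, tv_fix j w u hu, MonoidHom.id_apply]
    rw [mul_assoc, hwu, mul_one]
  · simp [tv_ne i j hj]

/-- The automorphism `x_i ↦ x_i w`. -/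
def tvAut {N : ℕ} (i : Fin N) (w : FreeGroup (Fin N)) (hw : w ∈ HH i) : MulAut (FreeGroup (Fin N)) :=
  MonoidHom.toMulEquiv (tv i w) (tv i w⁻¹) (tv_comp i _ _ hw (by simp))
    (tv_comp i _ _ ((HH i).inv_mem hw) (by simp))

lemma tvAut_apply {N : ℕ} (i : Fin N) (w : FreeGroup (Fin N)) (hw : w ∈ HH i) (u) :
    tvAut i w hw u = tv i w u := rfl

lemma commute_of_adjoin {r : ℕ} (s : Set (Matrix (Fin r) (Fin r) ℂ)) (L : Matrix (Fin r) (Fin r) ℂ)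
    (h : ∀ m ∈ s, L * m = m * L) (m) (hm : m ∈ Algebra.adjoin ℂ s) : L * m = m * L := by
  have : Algebra.adjoin ℂ s ≤ Subalgebra.centralizer ℂ {L} := by
    rw [Algebra.adjoin_le_iff]
    intro m hm
    simp only [SetLike.mem_coe, Subalgebra.mem_centralizer_iff, Set.mem_singleton_iff, forall_eq]
    exact h m hm
  have := this hm
  simp only [Subalgebra.mem_centralizer_iff, Set.mem_singleton_iff, forall_eq] at this
  exact this

lemma finite_HH {r N : ℕ} (ρ : FreeGroup (Fin N) →* GL (Fin r) ℂ) (hρ : FiniteAutOrbit ρ)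
    (i : Fin N) (hi : (ρ (FreeGroup.of i) : Matrix (Fin r) (Fin r) ℂ) ∈
      Algebra.adjoin ℂ ((fun j => (ρ (FreeGroup.of j) : Matrix (Fin r) (Fin r) ℂ)) '' {j | j ≠ i})) :
    (ρ '' (HH i : Set (FreeGroup (Fin N)))).Finite := by
  classical
  obtain ⟨s, hs, hconj⟩ := hρ
  have h1 : ∀ m ∈ ρ '' (HH i : Set (FreeGroup (Fin N))), ∃ w, ∃ hw : w ∈ HH i, ρ w = m := by
    rintro _ ⟨w, hw, rfl⟩; exact ⟨w, hw, rfl⟩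
  choose! W hW hWm using h1
  have h2 : ∀ w, w ∈ HH i → ∃ ρ' ∈ s, ∃ M : GL (Fin r) ℂ, ∀ x, ρ' x = M * ρ (tv i w x) * M⁻¹ := by
    intro w hw
    exact hconj (tvAut i w hw)
  choose! c hc M hM using h2
  refine Set.Finite.of_injOn (f := fun m => c (W m)) (t := s) (fun m hm => hc _ (hW m hm)) ?_ hs
  intro m hm m' hm' he
  simp only at he
  rw [← hWm m hm, ← hWm m' hm']
  have hw := hW m hm
  have hw' := hW m' hm'
  have hE : ∀ x, ((M (W m'))⁻¹ * M (W m)) * ρ (tv i (W m) x) =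
      ρ (tv i (W m') x) * ((M (W m'))⁻¹ * M (W m)) := by
    intro x
    have e1 := hM _ hw x
    rw [he, hM _ hw' x] at e1
    rw [mul_assoc, inv_mul_eq_iff_eq_mul]
    rw [eq_mul_inv_iff_mul_eq] at e1
    rw [← e1]
    group
  generalize ((M (W m'))⁻¹ * M (W m)) = L at hE
  generalize W m = w at hw hE
  generalize W m' = w' at hw' hE
  have hLj : ∀ j, j ≠ i → L * ρ (FreeGroup.of j) = ρ (FreeGroup.of j) * L := by
    intro j hj
    have := hE (FreeGroup.of j)
    rwa [tv_ne i j hj, tv_ne i j hj] at this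
  have hLi : L * ρ (FreeGroup.of i) = ρ (FreeGroup.of i) * L := by
    apply Units.ext
    simp only [Units.val_mul]
    refine commute_of_adjoin _ _ ?_ _ hi
    rintro _ ⟨j, hj, rfl⟩
    simpa using congrArg Units.val (hLj j hj)
  have hL : ∀ u, L * ρ u = ρ u * L := by
    intro u
    have : u ∈ (Subgroup.centralizer {L}).comap ρ := by
      have h3 : (⊤ : Subgroup (FreeGroup (Fin N))) ≤ (Subgroup.centralizer {L}).comap ρ := by
        rw [← FreeGroup.closure_range_of (Fin N), Subgroup.closure_le]
        rintro _ ⟨j, rfl⟩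
        simp only [SetLike.mem_coe, Subgroup.mem_comap, Subgroup.mem_centralizer_singleton_iff]
        by_cases hj : j = i
        · subst hj; exact hLi.symm
        · exact (hLj j hj).symm
      exact h3 trivial
    rw [Subgroup.mem_comap, Subgroup.mem_centralizer_singleton_iff] at this
    exact this.symm
  have := hE (FreeGroup.of i)
  rw [tv_self, tv_self, ← hL] at this
  have := mul_left_cancel this
  rw [map_mul, map_mul] at this
  exact mul_left_cancel this

lemma exists_S {r N : ℕ} (hr : 0 < r) (v : Fin N → Matrix (Fin r) (Fin r) ℂ) :
    ∃ S : Finset (Fin N), S.card + 1 ≤ r ^ 2 ∧ ∀ j, v j ∈ Algebra.adjoin ℂ (v '' S) := by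
  classical
  have : NeZero r := ⟨hr.ne'⟩
  have hne : (Finset.univ.filter fun S : Finset (Fin N) =>
      S.card + 1 ≤ Module.finrank ℂ (Algebra.adjoin ℂ (v '' (S : Set (Fin N))))).Nonempty := by
    refine ⟨∅, ?_⟩
    simp only [Finset.mem_filter, Finset.mem_univ, true_and, Finset.card_empty, zero_add]
    exact Module.finrank_pos
  obtain ⟨S, hS, hmax⟩ := Finset.exists_max_image _ Finset.card hne
  simp only [Finset.mem_filter, Finset.mem_univ, true_and] at hS hmax
  refine ⟨S, hS.trans ?_, ?_⟩
  · have h1 : Module.finrank ℂ (Subalgebra.toSubmodule (Algebra.adjoin ℂ (v '' (S : Set (Fin N))))) ≤ _ :=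
      Submodule.finrank_le _
    rw [Module.finrank_matrix, Module.finrank_self] at h1
    simp only [Fintype.card_fin, mul_one] at h1
    rw [pow_two]; exact h1
  · intro j
    by_contra hj
    have hjS : j ∉ S := fun h => hj (Algebra.subset_adjoin ⟨j, h, rfl⟩)
    have hlt : Subalgebra.toSubmodule (Algebra.adjoin ℂ (v '' (S : Set (Fin N)))) <
        Subalgebra.toSubmodule (Algebra.adjoin ℂ (v '' (insert j S : Finset (Fin N)))) := by
      refine lt_of_le_of_ne ?_ ?_
      · exact Algebra.adjoin_mono (Set.image_mono (by simp))
      · intro h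
        apply hj
        have h3 : v j ∈ Subalgebra.toSubmodule (Algebra.adjoin ℂ (v '' (insert j S : Finset (Fin N)))) :=
          Algebra.subset_adjoin ⟨j, by simp, rfl⟩
        rw [← h] at h3
        exact h3
    have h2 := Submodule.finrank_lt_finrank_of_lt hlt
    have h4 := hmax (insert j S) (by
      rw [Finset.card_insert_of_notMem hjS]
      exact (Nat.succ_le_succ hS).trans h2)
    rw [Finset.card_insert_of_notMem hjS] at h4
    omega

lemma finite_free {r N : ℕ} (hN : 2 * r ^ 2 ≤ N)
    (ρ : FreeGroup (Fin N) →* GL (Fin r) ℂ) (hρ : FiniteAutOrbit ρ) : (Set.range ρ).Finite := by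
  classical
  rcases Nat.eq_zero_or_pos r with rfl | hr
  · have : Subsingleton (GL (Fin 0) ℂ) := ⟨fun a b => Units.ext (Subsingleton.elim _ _)⟩
    exact Set.toFinite _
  let f : FreeGroup (Fin N) →* Matrix (Fin r) (Fin r) ℂ := (Units.coeHom _).comp ρ
  obtain ⟨S, hScard, hS⟩ := exists_S hr (fun j => f (FreeGroup.of j))
  have hTc : r ^ 2 + 1 ≤ Sᶜ.card := by
    rw [Finset.card_compl, Fintype.card_fin]; omega
  have hSi : ∀ i ∈ Sᶜ, (S : Set (Fin N)) ⊆ {j | j ≠ i} := by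
    rintro i hi j hj rfl
    exact (Finset.mem_compl.1 hi) hj
  have hTn : ((Sᶜ : Finset (Fin N)) : Set (Fin N)).Nontrivial := by
    have h1 : 1 < (Sᶜ : Finset (Fin N)).card := by
      have : 0 < r ^ 2 := by positivity
      omega
    exact Finset.one_lt_card_iff_nontrivial.1 h1
  have hxH : ∀ i ∈ Sᶜ, ∀ j ≠ i, FreeGroup.of j ∈ HH i := by
    intro i _ j hj
    exact Subgroup.subset_closure ⟨j, hj, rfl⟩
  have hfinH : ∀ i ∈ Sᶜ, (f '' (HH i : Set (FreeGroup (Fin N)))).Finite := by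
    intro i hi
    have := finite_HH ρ hρ i (Algebra.adjoin_mono (Set.image_mono (hSi i hi)) (hS i))
    have := this.image (Units.coeHom _)
    rwa [Set.image_image] at this
  have hord : ∀ j, ∃ m : ℕ, f (FreeGroup.of j) ^ (m + 1) = 1 := by
    intro j
    obtain ⟨i, hi, hij⟩ := hTn.exists_ne j
    exact exists_pow_eq_one f (HH i) (hfinH i hi) _ (hxH i hi j hij.symm)
  have hspan : ∀ g, f g ∈ Submodule.span ℂ
      (f '' (Subgroup.closure (FreeGroup.of '' (S : Set (Fin N))) : Set (FreeGroup (Fin N)))) := by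
    intro g
    have h1 : f g ∈ Algebra.adjoin ℂ ((fun j => f (FreeGroup.of j)) '' (S : Set (Fin N))) :=
      all_mem f FreeGroup.of (FreeGroup.closure_range_of _) hord
        (Algebra.adjoin ℂ ((fun j => f (FreeGroup.of j)) '' (S : Set (Fin N)))).toSubmonoid hS g
    rw [← Subalgebra.mem_toSubmodule, Algebra.adjoin_eq_span] at h1
    refine Submodule.span_mono ?_ h1
    have h2 : Submonoid.closure ((fun j => f (FreeGroup.of j)) '' (S : Set (Fin N))) ≤
        (Subgroup.closure (FreeGroup.of '' (S : Set (Fin N)))).toSubmonoid.map f := by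
      rw [Submonoid.closure_le]
      rintro _ ⟨j, hj, rfl⟩
      exact ⟨FreeGroup.of j, Subgroup.subset_closure ⟨j, hj, rfl⟩, rfl⟩
    exact h2
  have hfin : (Set.range f).Finite := by
    refine finite_of_good f FreeGroup.of (FreeGroup.closure_range_of _) HH
      (Subgroup.closure (FreeGroup.of '' (S : Set (Fin N)))) Sᶜ ?_ hxH hTn hfinH hspan ?_
    · intro i hi
      exact Subgroup.closure_mono (Set.image_mono (hSi i hi))
    · rw [Fintype.card_fin]; omega
  refine Set.Finite.of_finite_image (f := Units.val) ?_ Units.val_injective.injOn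
  rw [← Set.range_comp]
  exact hfin

end freegroup

end helpers

/-- For `K` a characteristic subgroup of the free group `F_N`, `N = 2g` or `2g+1`,
and `G = F_N/K`, a rank-`r` representation of `G` with finite orbit under `Aut G` and
`r² ≤ g` has finite image. -/
theorem finite_image_of_Out_finite_characteristic_quotient (g r N : ℕ)
    (hN : N = 2 * g ∨ N = 2 * g + 1) (hr : r ^ 2 ≤ g)
    (K : Subgroup (FreeGroup (Fin N))) [K.Characteristic]
    (ρ : FreeGroup (Fin N) ⧸ K →* GL (Fin r) ℂ)
    (hfin : FiniteAutOrbit ρ) :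
    Set.Finite (Set.range ⇑ρ) := by
  have key : FiniteAutOrbit (ρ.comp (QuotientGroup.mk' K)) := by
    obtain ⟨s, hs, h⟩ := hfin
    refine ⟨(fun σ => σ.comp (QuotientGroup.mk' K)) '' s, hs.image _, fun φ => ?_⟩
    obtain ⟨ρ', hρ', M, hM⟩ := h (QuotientGroup.congr K K φ
      (Subgroup.characteristic_iff_map_eq.1 inferInstance φ))
    exact ⟨_, ⟨ρ', hρ', rfl⟩, M, fun x => hM (QuotientGroup.mk' K x)⟩
  have h := finite_free (r := r) (N := N) (by omega) _ key
  refine h.subset ?_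
  rintro _ ⟨x, rfl⟩
  obtain ⟨y, rfl⟩ := QuotientGroup.mk'_surjective K x
  exact ⟨y, rfl⟩
end

section
/- Let G be a group, H ⊴ G a normal subgroup, and ρ : G → GL_r(ℂ) a representation such that det ∘ ρ : G → ℂ^× has finite image and such that the restriction ρ|_H is irreducible. If ρ(H) is a finite subgroup of GL_r(ℂ), then ρ(G) is a finite subgroup of GL_r(ℂ). -/
/-- A representation of `H` is irreducible if the only invariant subspaces of `ℂ^r`
are `0` and `ℂ^r`.  Here we state it for the restriction of `ρ : G →* GL_r(ℂ)` to a
subgroup `H ≤ G`. -/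
def IsIrreducibleOn {G : Type*} [Group G] {r : ℕ} (ρ : G →* GL (Fin r) ℂ)
    (H : Subgroup G) : Prop :=
  ∀ W : Submodule ℂ (Fin r → ℂ),
    (∀ h ∈ H, ∀ v ∈ W, (ρ h : Matrix (Fin r) (Fin r) ℂ).mulVec v ∈ W) → W = ⊥ ∨ W = ⊤

theorem scalar_of_commute_aux {G : Type*} [Group G] (H : Subgroup G) {r : ℕ} (hr : 0 < r)
    (ρ : G →* GL (Fin r) ℂ) (hirr : IsIrreducibleOn ρ H) (A : Matrix (Fin r) (Fin r) ℂ)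
    (hA : ∀ h ∈ H, A * (ρ h : Matrix (Fin r) (Fin r) ℂ) = (ρ h : Matrix (Fin r) (Fin r) ℂ) * A) :
    ∃ c : ℂ, A = c • (1 : Matrix (Fin r) (Fin r) ℂ) := by
  haveI : Nonempty (Fin r) := ⟨⟨0, hr⟩⟩
  obtain ⟨c, hc⟩ := Module.End.exists_eigenvalue (Matrix.toLin' A)
  refine ⟨c, ?_⟩
  have key := hirr (Module.End.eigenspace (Matrix.toLin' A) c) (by
    intro h hh v hv
    rw [Module.End.mem_eigenspace_iff, Matrix.toLin'_apply] at hv ⊢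
    rw [Matrix.mulVec_mulVec, hA h hh, ← Matrix.mulVec_mulVec, hv, Matrix.mulVec_smul])
  rcases key with h | h
  · exact absurd h hc
  · apply Matrix.toLin'.injective
    ext1 i
    ext1
    have : (Pi.single i 1 : Fin r → ℂ) ∈ Module.End.eigenspace (Matrix.toLin' A) c := by
      rw [h]; trivial
    rw [Module.End.mem_eigenspace_iff] at this
    simp only [LinearMap.comp_apply, LinearMap.coe_single]
    rw [this]
    simp

/-- If `H ⊴ G`, `ρ : G →* GL_r(ℂ)` has finite determinant, `ρ|_H` is irreducible and
`ρ(H)` is finite, then `ρ(G)` is finite. -/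
theorem finite_image_of_finite_on_normal_subgroup
    {G : Type*} [Group G] (H : Subgroup G) (hH : H.Normal) {r : ℕ}
    (ρ : G →* GL (Fin r) ℂ)
    (hdet : Set.Finite (Set.range fun g => Matrix.GeneralLinearGroup.det (ρ g)))
    (hirr : IsIrreducibleOn ρ H)
    (hfin : Set.Finite ((fun g => ρ g) '' (H : Set G))) :
    Set.Finite (Set.range ⇑ρ) := by
  classical
  rcases Nat.eq_zero_or_pos r with rfl | hr
  · exact Set.toFinite _
  set S := (fun g => ρ g) '' (H : Set G) with hS
  haveI : Finite S := hfin
  let f : GL (Fin r) ℂ → (S → GL (Fin r) ℂ) × ℂˣ :=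
    fun A => (fun s => A * s.1 * A⁻¹, Matrix.GeneralLinearGroup.det A)
  have him : (f '' Set.range ρ).Finite := by
    refine ((Set.Finite.pi (fun _ : S => hfin)).prod hdet).subset ?_
    rintro _ ⟨_, ⟨g, rfl⟩, rfl⟩
    refine ⟨?_, g, rfl⟩
    rintro ⟨_, h, hh, rfl⟩ -
    exact ⟨g * h * g⁻¹, hH.conj_mem h hh g, by simp [f]⟩
  refine Set.Finite.of_finite_fibers f him ?_
  rintro _ ⟨_, ⟨g, rfl⟩, rfl⟩
  have hroots : {c : ℂ | c ^ r = 1}.Finite := by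
    refine (Polynomial.nthRoots r (1 : ℂ)).toFinset.finite_toSet.subset ?_
    intro c hc
    simpa [Polynomial.mem_nthRoots hr] using hc
  refine Set.Finite.of_finite_image (f := Units.val) ?_ Units.val_injective.injOn
  refine (hroots.image (fun c => (ρ g : Matrix (Fin r) (Fin r) ℂ) * (c • 1))).subset ?_
  rintro _ ⟨_, ⟨⟨g', rfl⟩, hg'⟩, rfl⟩
  have h1 := congrArg Prod.fst hg'
  have h2 := congrArg Prod.snd hg'
  simp only [f] at h1 h2
  set B : GL (Fin r) ℂ := (ρ g)⁻¹ * ρ g' with hB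
  have hcomm : ∀ h ∈ H, B * ρ h = ρ h * B := by
    intro h hh
    have := congrFun h1 ⟨ρ h, h, hh, rfl⟩
    simp only at this
    rw [mul_inv_eq_iff_eq_mul] at this
    rw [hB, mul_assoc, this]
    group
  obtain ⟨c, hc⟩ := scalar_of_commute_aux H hr ρ hirr B.1
    (fun h hh => congrArg Units.val (hcomm h hh))
  have hdB : Matrix.GeneralLinearGroup.det B = 1 := by
    rw [hB, map_mul, map_inv, h2, inv_mul_cancel]
  have hdB' : Matrix.det B.1 = 1 := congrArg Units.val hdB
  refine ⟨c, ?_, ?_⟩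
  · rw [hc, Matrix.det_smul] at hdB'
    simpa using hdB'
  · simp only
    rw [← hc, ← Units.val_mul, hB, mul_inv_cancel_left]
end

section
/- Let G be a group, H ⊴ G a normal subgroup, and ρ : G → GL_r(ℂ) a representation such that det ∘ ρ : G → ℂ^× has finite image and such that the restriction ρ|_H is irreducible. If ρ|_H is unitary, then ρ is unitary; that is, if there exists M ∈ GL_r(ℂ) with M ρ(h) M⁻¹ ∈ U(r) for all h ∈ H, then there exists M′ ∈ GL_r(ℂ) with M′ ρ(g) M′⁻¹ ∈ U(r) for all g ∈ G. -/
/-- If `H ⊴ G`, `ρ : G →* GL_r(ℂ)` has finite determinant, `ρ|_H` is irreducible and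
`ρ|_H` is unitary (conjugate into `U(r)`), then `ρ` is unitary. -/
theorem unitary_of_unitary_on_normal_subgroup
    {G : Type*} [Group G] (H : Subgroup G) (hH : H.Normal) {r : ℕ}
    (ρ : G →* GL (Fin r) ℂ)
    (hdet : Set.Finite (Set.range fun g => Matrix.GeneralLinearGroup.det (ρ g)))
    (hirr : IsIrreducibleOn ρ H)
    (hunit : ∃ M : GL (Fin r) ℂ, ∀ h ∈ H,
      ((M * ρ h * M⁻¹ : GL (Fin r) ℂ) : Matrix (Fin r) (Fin r) ℂ)
        ∈ Matrix.unitaryGroup (Fin r) ℂ) :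
    ∃ M' : GL (Fin r) ℂ, ∀ g : G,
      ((M' * ρ g * M'⁻¹ : GL (Fin r) ℂ) : Matrix (Fin r) (Fin r) ℂ)
        ∈ Matrix.unitaryGroup (Fin r) ℂ := by
  obtain ⟨M, hM⟩ := hunit
  refine ⟨M, fun g => ?_⟩
  rcases Nat.eq_zero_or_pos r with rfl | hr
  · rw [Matrix.mem_unitaryGroup_iff']
    exact Subsingleton.elim _ _
  haveI : Nonempty (Fin r) := ⟨⟨0, hr⟩⟩
  set A : Matrix (Fin r) (Fin r) ℂ := ((M * ρ g * M⁻¹ : GL (Fin r) ℂ) : Matrix (Fin r) (Fin r) ℂ) with hA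
  set P : Matrix (Fin r) (Fin r) ℂ := star A * A with hP
  have hcomm : ∀ h ∈ H, P * ((M * ρ h * M⁻¹ : GL (Fin r) ℂ) : Matrix (Fin r) (Fin r) ℂ)
      = ((M * ρ h * M⁻¹ : GL (Fin r) ℂ) : Matrix (Fin r) (Fin r) ℂ) * P := by
    intro h hh
    have h1 := hM h hh
    have h2 := hM (g * h * g⁻¹) (hH.conj_mem h hh g)
    set U : Matrix (Fin r) (Fin r) ℂ := ((M * ρ h * M⁻¹ : GL (Fin r) ℂ) : Matrix (Fin r) (Fin r) ℂ)
      with hU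
    set V : Matrix (Fin r) (Fin r) ℂ :=
      ((M * ρ (g * h * g⁻¹) * M⁻¹ : GL (Fin r) ℂ) : Matrix (Fin r) (Fin r) ℂ) with hV
    have hAU : A * U = V * A := by
      rw [hA, hU, hV, ← Units.val_mul, ← Units.val_mul]
      congr 1
      simp only [map_mul, map_inv]
      group
    have hUU := Matrix.mem_unitaryGroup_iff.1 h1
    have hVV := Matrix.mem_unitaryGroup_iff'.1 h2
    have key : star U * P * U = P := by
      calc star U * P * U = star (A * U) * (A * U) := by
            rw [hP, star_mul]; simp only [mul_assoc]
        _ = star A * (star V * V) * A := by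
            rw [hAU, star_mul]; simp only [mul_assoc]
        _ = P := by rw [hVV, mul_one]
    calc P * U = (U * star U) * P * U := by rw [hUU, one_mul]
      _ = U * (star U * P * U) := by simp only [mul_assoc]
      _ = U * P := by rw [key]
  have hMi : (M : Matrix (Fin r) (Fin r) ℂ) * ((M⁻¹ : GL (Fin r) ℂ) : Matrix (Fin r) (Fin r) ℂ) = 1 :=
    Units.mul_inv M
  have hiM : ((M⁻¹ : GL (Fin r) ℂ) : Matrix (Fin r) (Fin r) ℂ) * (M : Matrix (Fin r) (Fin r) ℂ) = 1 :=
    Units.inv_mul M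
  set N : Matrix (Fin r) (Fin r) ℂ := (M : Matrix (Fin r) (Fin r) ℂ) with hN
  set N' : Matrix (Fin r) (Fin r) ℂ := ((M⁻¹ : GL (Fin r) ℂ) : Matrix (Fin r) (Fin r) ℂ) with hN'
  set Q : Matrix (Fin r) (Fin r) ℂ := N' * P * N with hQ
  have hQc : ∀ h ∈ H, Q * (ρ h : Matrix (Fin r) (Fin r) ℂ) = (ρ h : Matrix (Fin r) (Fin r) ℂ) * Q := by
    intro h hh
    have h1 := hcomm h hh
    simp only [Units.val_mul] at h1
    rw [← hN, ← hN'] at h1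
    set R : Matrix (Fin r) (Fin r) ℂ := (ρ h : Matrix (Fin r) (Fin r) ℂ)
    calc Q * R = N' * (P * (N * R * N')) * N := by
          rw [hQ]; simp only [mul_assoc]; rw [hiM, mul_one]
      _ = (N' * N) * R * (N' * P * N) := by rw [h1]; simp only [mul_assoc]
      _ = R * Q := by rw [hiM, one_mul]
  obtain ⟨c, hc⟩ := Module.End.exists_eigenvalue (Matrix.toLin' Q)
  have hQs : Q = c • (1 : Matrix (Fin r) (Fin r) ℂ) := by
    have := hirr (Module.End.eigenspace (Matrix.toLin' Q) c) (by
      intro h hh v hv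
      rw [Module.End.mem_eigenspace_iff, Matrix.toLin'_apply] at hv ⊢
      rw [Matrix.mulVec_mulVec, hQc h hh, ← Matrix.mulVec_mulVec, hv, Matrix.mulVec_smul])
    rcases this with h0 | h0
    · exact absurd h0 hc
    · apply Matrix.toLin'.injective
      ext1 v
      apply LinearMap.ext
      intro x
      have hx : (Pi.single v x : Fin r → ℂ) ∈ Module.End.eigenspace (Matrix.toLin' Q) c := by
        rw [h0]; trivial
      rw [Module.End.mem_eigenspace_iff] at hx
      simpa using hx
  have hPs : P = c • (1 : Matrix (Fin r) (Fin r) ℂ) := by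
    calc P = (N * N') * P * (N * N') := by rw [hMi, one_mul, mul_one]
      _ = N * Q * N' := by rw [hQ]; simp only [mul_assoc]
      _ = c • 1 := by rw [hQs]; simp [hMi]
  have hdA : ‖A.det‖ = 1 := by
    have hd : A.det = ((Matrix.GeneralLinearGroup.det (ρ g) : ℂˣ) : ℂ) := by
      rw [hA]
      simp only [Units.val_mul, Matrix.det_mul]
      rw [mul_right_comm, ← Matrix.det_mul, hMi, Matrix.det_one, one_mul]
      rfl
    have hfin : IsOfFinOrder (Matrix.GeneralLinearGroup.det (ρ g)) := by
      rw [← finite_powers]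
      refine hdet.subset ?_
      rintro _ ⟨n, rfl⟩
      exact ⟨g ^ n, by simp⟩
    obtain ⟨n, hn, hn1⟩ := isOfFinOrder_iff_pow_eq_one.1 hfin
    have h3 : A.det ^ n = 1 := by
      rw [hd, ← Units.val_pow_eq_pow_val, hn1, Units.val_one]
    have h7 : ‖A.det‖ ^ n = 1 := by rw [← norm_pow, h3, norm_one]
    exact (pow_eq_one_iff_of_nonneg (norm_nonneg _) hn.ne').1 h7
  have hcn : ‖c‖ = 1 := by
    have h4 : P.det = c ^ r := by rw [hPs]; simp
    have h5 : ‖P.det‖ = 1 := by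
      rw [hP, Matrix.det_mul, Matrix.star_eq_conjTranspose, Matrix.det_conjTranspose]
      simp [hdA]
    rw [h4, norm_pow] at h5
    exact (pow_eq_one_iff_of_nonneg (norm_nonneg c) hr.ne').1 h5
  have hc0 : c = ((∑ j, ‖A j ⟨0, hr⟩‖ ^ 2 : ℝ) : ℂ) := by
    have h6 : P ⟨0, hr⟩ ⟨0, hr⟩ = c := by rw [hPs]; simp
    rw [← h6, hP, Matrix.mul_apply]
    push_cast
    refine Finset.sum_congr rfl fun j _ => ?_
    rw [Matrix.star_apply]
    exact Complex.conj_mul' _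
  have hc1 : c = 1 := by
    have hnn : (0:ℝ) ≤ ∑ j, ‖A j ⟨0, hr⟩‖ ^ 2 := by positivity
    rw [hc0, Complex.norm_real, Real.norm_of_nonneg hnn] at hcn
    rw [hc0, hcn, Complex.ofReal_one]
  rw [Matrix.mem_unitaryGroup_iff']
  rw [← hP, hPs, hc1, one_smul]
end

section
/- Let N ⊴ G be groups with quotient Q = G/N. Let A be an Artinian local commutative ℂ-algebra whose residue field is ℂ, and let ρ : G → GL_r(A) be a representation. Assume H⁰(Q, H¹(N, ad ρ|_N)) = 0, i.e.: every 1-cocycle c on N valued in ad ρ such that, for each g ∈ G, the 1-cocycle n ↦ ρ(g)⁻¹ c(g n g⁻¹) ρ(g) differs from c by a 1-coboundary, is itself a 1-coboundary. Let A[ε] = A[X]/(X²) be the dual numbers over A, and let ρ_ε : G → GL_r(A[ε]) be a representation with ρ_ε ≡ ρ (mod ε) and with constant determinant, i.e. det ρ_ε(g) equals the image of det ρ(g) in A[ε] for every g ∈ G. Then ρ_ε|_N is equivalent to the constant deformation of ρ|_N: there exists M ∈ GL_r(A[ε]) with M ≡ id (mod ε) such that M ρ_ε(n) M⁻¹ equals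 the image of ρ(n) in GL_r(A[ε]) for every n ∈ N. -/
open TrivSqZeroExt

/-- `c : N → sl_r(R)` is a 1-cocycle valued in `ad γ`:
`c(n n′) = c(n) + γ(n) c(n′) γ(n)⁻¹`. -/
def IsCocycle {G : Type*} [Group G] (N : Subgroup G) {r : ℕ} {R : Type*} [CommRing R]
    (γ : G →* GL (Fin r) R) (c : ↥N → Matrix (Fin r) (Fin r) R) : Prop :=
  ∀ n m : ↥N, c (n * m) = c n + (γ ↑n).val * c m * ((γ ↑n)⁻¹).val

/-- `c : N → sl_r(R)` is a 1-coboundary: `c(n) = γ(n) m γ(n)⁻¹ − m` for some trace-zero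
matrix `m`. -/
def IsCoboundary {G : Type*} [Group G] (N : Subgroup G) {r : ℕ} {R : Type*} [CommRing R]
    (γ : G →* GL (Fin r) R) (c : ↥N → Matrix (Fin r) (Fin r) R) : Prop :=
  ∃ m : Matrix (Fin r) (Fin r) R, m.trace = 0 ∧
    ∀ n : ↥N, c n = (γ ↑n).val * m * ((γ ↑n)⁻¹).val - m

/-- `H⁰(Q, H¹(N, ad γ|_N)) = 0`: every 1-cocycle `c` on `N` valued in `ad γ` such that,
for each `g ∈ G`, the cocycle `n ↦ γ(g)⁻¹ c(g n g⁻¹) γ(g)` differs from `c` by a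
coboundary, is itself a coboundary. -/
def H0H1Vanishes {G : Type*} [Group G] (N : Subgroup G) (hN : N.Normal) {r : ℕ}
    {R : Type*} [CommRing R] (γ : G →* GL (Fin r) R) : Prop :=
  ∀ c : ↥N → Matrix (Fin r) (Fin r) R,
    (∀ n, (c n).trace = 0) →
    IsCocycle N γ c →
    (∀ g : G, IsCoboundary N γ fun n =>
      ((γ g)⁻¹).val * c ⟨g * ↑n * g⁻¹, hN.conj_mem ↑n n.2 g⟩ * (γ g).val - c n) →
    IsCoboundary N γ c

theorem fo_fst_mul {r : ℕ} {A : Type*} [CommRing A] (X Y : Matrix (Fin r) (Fin r) (DualNumber A)) :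
    (X * Y).map TrivSqZeroExt.fst = X.map TrivSqZeroExt.fst * Y.map TrivSqZeroExt.fst := by
  ext i j
  simp [Matrix.mul_apply, TrivSqZeroExt.fst_sum]

theorem fo_snd_mul {r : ℕ} {A : Type*} [CommRing A] (X Y : Matrix (Fin r) (Fin r) (DualNumber A)) :
    (X * Y).map TrivSqZeroExt.snd = X.map TrivSqZeroExt.fst * Y.map TrivSqZeroExt.snd
      + X.map TrivSqZeroExt.snd * Y.map TrivSqZeroExt.fst := by
  ext i j
  simp [Matrix.mul_apply, TrivSqZeroExt.snd_sum, Finset.sum_add_distrib, mul_comm]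

theorem fo_ext {r : ℕ} {A : Type*} [CommRing A] (X Y : Matrix (Fin r) (Fin r) (DualNumber A))
    (h1 : X.map TrivSqZeroExt.fst = Y.map TrivSqZeroExt.fst)
    (h2 : X.map TrivSqZeroExt.snd = Y.map TrivSqZeroExt.snd) : X = Y := by
  ext i j
  · exact congrFun (congrFun h1 i) j
  · exact congrFun (congrFun h2 i) j

/-- the matrix `1 + ε m` -/
def foOne {r : ℕ} {A : Type*} [CommRing A] (m : Matrix (Fin r) (Fin r) A) :
    Matrix (Fin r) (Fin r) (DualNumber A) :=
  1 + (DualNumber.eps : DualNumber A) • m.map (TrivSqZeroExt.inl : A → DualNumber A)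

theorem foOne_fst {r : ℕ} {A : Type*} [CommRing A] (m : Matrix (Fin r) (Fin r) A) :
    (foOne m).map TrivSqZeroExt.fst = 1 := by
  ext i j
  by_cases h : i = j <;> simp [foOne, Matrix.one_apply, h]

theorem foOne_snd {r : ℕ} {A : Type*} [CommRing A] (m : Matrix (Fin r) (Fin r) A) :
    (foOne m).map TrivSqZeroExt.snd = m := by
  ext i j
  by_cases h : i = j <;> simp [foOne, Matrix.one_apply, h]

theorem foOne_det {r : ℕ} {A : Type*} [CommRing A] (m : Matrix (Fin r) (Fin r) A) :
    (foOne m).det.snd = m.trace := by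
  rw [foOne, Matrix.det_one_add_smul, pow_two, DualNumber.eps_mul_eps]
  simp [Matrix.trace, TrivSqZeroExt.fst_sum]

theorem fo_inl_fst {r : ℕ} {A : Type*} [CommRing A] (m : Matrix (Fin r) (Fin r) A) :
    (m.map (TrivSqZeroExt.inl : A → DualNumber A)).map TrivSqZeroExt.fst = m := by
  ext i j; simp

theorem fo_inl_snd {r : ℕ} {A : Type*} [CommRing A] (m : Matrix (Fin r) (Fin r) A) :
    (m.map (TrivSqZeroExt.inl : A → DualNumber A)).map TrivSqZeroExt.snd = 0 := by
  ext i j; simp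

theorem foOne_mul_neg {r : ℕ} {A : Type*} [CommRing A] (m : Matrix (Fin r) (Fin r) A) :
    foOne m * foOne (-m) = 1 := by
  apply fo_ext
  · rw [fo_fst_mul, foOne_fst, foOne_fst]
    ext i j
    by_cases h : i = j <;> simp [Matrix.one_apply, h]
  · rw [fo_snd_mul, foOne_fst, foOne_fst, foOne_snd, foOne_snd]
    ext i j
    by_cases h : i = j <;> simp [Matrix.one_apply, h]

theorem fo_inl_det {r : ℕ} {A : Type*} [CommRing A] (m : Matrix (Fin r) (Fin r) A) :
    (m.map (TrivSqZeroExt.inl : A → DualNumber A)).det = TrivSqZeroExt.inl m.det :=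
  ((TrivSqZeroExt.inlHom A A).map_det m).symm

theorem first_order_deformation_constant_on_normal_subgroup
    {G : Type*} [Group G] (N : Subgroup G) (hN : N.Normal) {r : ℕ}
    (A : Type*) [CommRing A] [Algebra ℂ A] [IsArtinianRing A] [IsLocalRing A]
    (hres : Function.Bijective ⇑((IsLocalRing.residue A).comp (algebraMap ℂ A)))
    (ρ : G →* GL (Fin r) A)
    (hvan : H0H1Vanishes N hN ρ)
    (ρε : G →* GL (Fin r) (DualNumber A))
    (hmod : ∀ g : G, ∀ i j, ((ρε g).val i j).fst = (ρ g).val i j)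
    (hdet : ∀ g : G, ((ρε g).val).det = TrivSqZeroExt.inl (((ρ g).val).det)) :
    ∃ M : GL (Fin r) (DualNumber A),
      (∀ i j, (M.val i j).fst = (1 : Matrix (Fin r) (Fin r) A) i j) ∧
      ∀ n : ↥N, (M * ρε ↑n * M⁻¹).val
        = ((ρ ↑n).val).map (TrivSqZeroExt.inl : A → DualNumber A) := by
  have hF : ∀ g, (ρε g).val.map TrivSqZeroExt.fst = (ρ g).val := fun g => by
    ext i j; exact hmod g i j
  have hvi : ∀ g, (ρ g).val * ((ρ g)⁻¹).val = 1 := fun g => Units.mul_inv _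
  have hiv : ∀ g, ((ρ g)⁻¹).val * (ρ g).val = 1 := fun g => Units.inv_mul _
  obtain ⟨c, hc⟩ : ∃ c : G → Matrix (Fin r) (Fin r) A,
      ∀ g, c g = (ρε g).val.map TrivSqZeroExt.snd * ((ρ g)⁻¹).val := ⟨_, fun _ => rfl⟩
  have hS : ∀ g, (ρε g).val.map TrivSqZeroExt.snd = c g * (ρ g).val := fun g => by
    rw [hc, mul_assoc, hiv, mul_one]
  have hcoc : ∀ g h, c (g * h) = c g + (ρ g).val * c h * ((ρ g)⁻¹).val := by
    intro g h
    rw [hc (g * h), map_mul, map_mul, mul_inv_rev, Units.val_mul, Units.val_mul, fo_snd_mul,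
      hF, hF, hS, hS, add_comm, add_mul]
    congr 1
    · calc _ = c g * ((ρ g).val * ((ρ h).val * ((ρ h)⁻¹).val) * ((ρ g)⁻¹).val) := by
            noncomm_ring
        _ = _ := by rw [hvi, mul_one, hvi, mul_one]
    · calc _ = (ρ g).val * c h * ((ρ h).val * ((ρ h)⁻¹).val) * ((ρ g)⁻¹).val := by
            noncomm_ring
        _ = _ := by rw [hvi, mul_one]
  have htr : ∀ g, (c g).trace = 0 := by
    intro g
    have h1 : (ρε g).val = foOne (c g) * (ρ g).val.map (TrivSqZeroExt.inl : A → DualNumber A) := by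
      apply fo_ext
      · rw [fo_fst_mul, foOne_fst, fo_inl_fst, one_mul, hF]
      · rw [fo_snd_mul, foOne_fst, fo_inl_fst, fo_inl_snd, foOne_snd, mul_zero, zero_add, hS]
    have h2 := hdet g
    rw [h1, Matrix.det_mul, fo_inl_det] at h2
    have hu : IsUnit (ρ g).val.det := (Matrix.isUnit_iff_isUnit_det _).1 (ρ g).isUnit
    have h3 := congrArg TrivSqZeroExt.snd h2
    simp only [TrivSqZeroExt.snd_mul, TrivSqZeroExt.snd_inl, TrivSqZeroExt.fst_inl, smul_zero,
      zero_add, foOne_det, MulOpposite.smul_eq_mul_unop, MulOpposite.unop_op] at h3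
    exact (hu.mul_left_eq_zero).1 h3
  obtain ⟨m, -, hm⟩ := hvan (fun n => c n) (fun n => htr n) (fun n k => hcoc n k) (by
    intro g
    refine ⟨-(((ρ g)⁻¹).val * c g * (ρ g).val), ?_, ?_⟩
    · rw [Matrix.trace_neg, Matrix.trace_mul_comm, ← mul_assoc, hvi, one_mul, htr, neg_zero]
    · intro n
      have h1 := hcoc (g * n * g⁻¹) g
      rw [inv_mul_cancel_right, hcoc] at h1
      have h2 : c (g * n * g⁻¹) = c g + (ρ g).val * c n * ((ρ g)⁻¹).val
        - (ρ (g * n * g⁻¹)).val * c g * ((ρ (g * n * g⁻¹))⁻¹).val := eq_sub_of_add_eq h1.symm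
      have h3 : (ρ (g * n * g⁻¹)).val = (ρ g).val * (ρ n).val * ((ρ g)⁻¹).val := by
        simp only [map_mul, map_inv, Units.val_mul]
      have h4 : ((ρ (g * n * g⁻¹))⁻¹).val = (ρ g).val * ((ρ n)⁻¹).val * ((ρ g)⁻¹).val := by
        simp only [map_mul, map_inv, Units.val_mul, mul_inv_rev, inv_inv, mul_assoc]
      show ((ρ g)⁻¹).val * c (g * n * g⁻¹) * (ρ g).val - c n = _
      rw [h2, h3, h4]
      have e := hiv g
      generalize ((ρ g)⁻¹).val = Q at *
      generalize (ρ g).val = P at *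
      calc _ = Q * c g * P + (Q * P) * c n * (Q * P)
            - (Q * P) * (ρ n).val * Q * c g * P * ((ρ n)⁻¹).val * (Q * P) - c n := by
            noncomm_ring
        _ = _ := by rw [e]; noncomm_ring)
  refine ⟨⟨foOne m, foOne (-m), foOne_mul_neg m, by simpa using foOne_mul_neg (-m)⟩, ?_, ?_⟩
  · intro i j
    exact congrFun (congrFun (foOne_fst m) i) j
  · intro n
    have key : foOne m * (ρε n).val =
        (ρ n).val.map (TrivSqZeroExt.inl : A → DualNumber A) * foOne m := by
      apply fo_ext
      · rw [fo_fst_mul, fo_fst_mul, foOne_fst, fo_inl_fst, one_mul, mul_one, hF]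
      · rw [fo_snd_mul, fo_snd_mul, foOne_fst, fo_inl_fst, fo_inl_snd, foOne_snd, hF, hS, show c n = _ from hm n,
          sub_mul, mul_assoc _ _ (ρ n).val, hiv]
        simp
    show foOne m * (ρε n).val * foOne (-m) = _
    rw [key, mul_assoc, foOne_mul_neg, mul_one]
end
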